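/- Let m ≥ 1, σ ∈ (0,1), let f be a monostable nonlinearity and w the associated heteroclinic, and write ℝ^{m+1}_+ = ℝ^m × (0,∞). Then there exists a constant C > 0 such that: for every β : ℝ^m → ℝ with ‖β‖_{C^{1,σ}(ℝ^m)} < ∞ and every g : ℝ^{m+1}_+ → ℝ with ‖g‖_{C^{0,σ}(ℝ^{m+1}_+)} < ∞, there exist functions φ : closure(ℝ^{m+1}_+) → ℝ of class C² and α : ℝ^m → ℝ, depending linearly on (β, g), such that Δφ(y,t) + f'(w(t)) φ(y,t) = α(y) w'(t) + g(y,t) for all (y,t) ∈ ℝ^m × (0,∞), φ(y,0) = 0 and ∂_t φ(y,0) = β(y) for all y ∈ ℝ^m, and ‖φ‖_{C^{2,σ}(ℝ^{m+1}_+)} + ‖α‖_{C^{0,σ}(ℝ^m)} ≤ C ( ‖β‖_{C^{1,σ}(ℝ^m)} + ‖g‖_{C^{0,σ}(ℝ^{m+1}_+)} ). -/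

import Mathlib

open Set Filter

/-- A monostable nonlinearity: smooth, `f 0 = f 1 = 0`, positive on `(0,1)`, `f' 1 < 0`. -/
def Monostable (f : ℝ → ℝ) : Prop :=
  ContDiff ℝ (⊤ : ℕ∞) f ∧ f 0 = 0 ∧ f 1 = 0 ∧ (∀ s ∈ Set.Ioo (0 : ℝ) 1, 0 < f s) ∧ deriv f 1 < 0

/-- The heteroclinic associated with `f`. -/
def IsHeteroclinic (f w : ℝ → ℝ) : Prop :=
  ContDiffOn ℝ 2 w (Set.Ici 0) ∧
  (∀ t ∈ Set.Ioi (0 : ℝ),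
    derivWithin (derivWithin w (Set.Ici 0)) (Set.Ici 0) t + f (w t) = 0) ∧
  w 0 = 0 ∧
  Filter.Tendsto w Filter.atTop (nhds 1) ∧
  (∀ t ∈ Set.Ioi (0 : ℝ), 0 < w t) ∧
  StrictMonoOn w (Set.Ici 0) ∧
  (∀ t ∈ Set.Ici (0 : ℝ), 0 < derivWithin w (Set.Ici 0) t)

/-- `sup_Λ ‖h‖ + [h]_{σ,Λ} ≤ K`, componentwise: the `C^{0,σ}(Λ)` norm of `h` is
controlled by `K`. -/
def HolderLe {X Y : Type*} [PseudoMetricSpace X] [NormedAddCommGroup Y]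
    (σ : ℝ) (Λ : Set X) (h : X → Y) (K : ℝ) : Prop :=
  (∀ x ∈ Λ, ‖h x‖ ≤ K) ∧ ∀ x ∈ Λ, ∀ y ∈ Λ, ‖h x - h y‖ ≤ K * dist x y ^ σ

/-- The Laplacian of a function on `ℝ^m × ℝ`, as the sum of second directional
derivatives along the standard basis vectors. -/
noncomputable def lapP {m : ℕ} (u : EuclideanSpace ℝ (Fin m) × ℝ → ℝ)
    (x : EuclideanSpace ℝ (Fin m) × ℝ) : ℝ :=
  (∑ i : Fin m, fderiv ℝ (fun y => fderiv ℝ u y (EuclideanSpace.single i 1, 0)) x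
      (EuclideanSpace.single i 1, 0))
    + fderiv ℝ (fun y => fderiv ℝ u y (0, 1)) x (0, 1)

/-- The closed upper half-space `ℝ^m × [0,∞)`. -/
def halfSpace (m : ℕ) : Set (EuclideanSpace ℝ (Fin m) × ℝ) := {p | 0 ≤ p.2}



/-! ## Part 1: averaging against kernels -/
section Kernel
open MeasureTheory Topology SchwartzMap Module

variable {E : Type*} [NormedAddCommGroup E] [NormedSpace ℝ E] [FiniteDimensional ℝ E]
  [MeasureSpace E] [BorelSpace E] [(volume : Measure E).IsAddHaarMeasure]
  {F : Type*} [NormedAddCommGroup F] [NormedSpace ℝ F]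

lemma cont_aesm {f : E → F} (hf : Continuous f) : AEStronglyMeasurable f (volume : Measure E) := by
  haveI : ProperSpace E := FiniteDimensional.proper_real E
  haveI : SecondCountableTopologyEither E F := secondCountableTopologyEither_of_left E F
  exact hf.aestronglyMeasurable

/-- Average of `h` against the kernel `θ` at scale `r`. -/
noncomputable def kA (θ : E → F) (h : E → ℝ) (x : E) (r : ℝ) : F :=
  ∫ z, h (x + r • z) • θ z

lemma HolderLe.continuous' {X Y : Type*} [PseudoMetricSpace X] [NormedAddCommGroup Y]
    {σ : ℝ} (hσ : 0 < σ) {h : X → Y} {K : ℝ} (H : HolderLe σ univ h K) : Continuous h := by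
  rw [continuous_iff_continuousAt]
  intro x
  rw [ContinuousAt, tendsto_iff_dist_tendsto_zero]
  have h1 : Tendsto (fun y => K * dist y x ^ σ) (𝓝 x) (𝓝 0) := by
    have : Continuous (fun y => K * dist y x ^ σ) := by
      refine continuous_const.mul ?_
      exact (continuous_id.dist continuous_const).rpow_const (fun _ => Or.inr hσ.le)
    have h2 := this.tendsto x
    simpa [Real.zero_rpow hσ.ne'] using h2
  refine squeeze_zero (fun _ => dist_nonneg) (fun y => ?_) h1
  rw [dist_eq_norm]
  exact H.2 y trivial x trivial

lemma kA_integrable {θ : E → F} (hθ : Integrable θ) {h : E → ℝ} (hc : Continuous h) {M : ℝ}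
    (hM : ∀ x, |h x| ≤ M) (x : E) (r : ℝ) : Integrable (fun z => h (x + r • z) • θ z) := by
  refine hθ.bdd_smul (C := M) ?_ ?_
  · exact (by fun_prop : Continuous fun z => h (x + r • z)).aestronglyMeasurable
  · exact ae_of_all _ fun z => hM _

lemma kA_bound {θ : E → F} (hθ : Integrable θ) {h : E → ℝ} {M : ℝ}
    (hM : ∀ x, |h x| ≤ M) (x : E) (r : ℝ) : ‖kA θ h x r‖ ≤ M * ∫ z, ‖θ z‖ := by
  rw [kA, ← integral_const_mul]
  refine norm_integral_le_of_norm_le (hθ.norm.const_mul M) (ae_of_all _ fun z => ?_)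
  rw [norm_smul]
  exact mul_le_mul_of_nonneg_right (hM _) (norm_nonneg _)

lemma schwartz_integrable_one_add (θ : 𝓢(E, F)) : Integrable (fun z => (1 + ‖z‖) * ‖θ z‖) := by
  have h1 := (θ.integrable (μ := volume)).norm
  have h2 := θ.integrable_pow_mul volume 1
  refine (h1.add h2).congr (ae_of_all _ fun z => ?_)
  simp [add_mul]

lemma rpow_le_one_add {σ : ℝ} (h0 : 0 < σ) (h1 : σ < 1) {a : ℝ} (ha : 0 ≤ a) :
    (1 + a) ^ σ ≤ 1 + a := by
  calc (1 + a) ^ σ ≤ (1 + a) ^ (1 : ℝ) :=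
        Real.rpow_le_rpow_of_exponent_le (by linarith) h1.le
    _ = 1 + a := Real.rpow_one _

lemma kA_holder {σ : ℝ} (h0 : 0 < σ) (h1 : σ < 1) {θ : E → F} (hθ : Integrable θ)
    (hθ' : Integrable (fun z => (1 + ‖z‖) * ‖θ z‖))
    {h : E → ℝ} {K : ℝ} (hK : 0 ≤ K) (H : HolderLe σ univ h K) (x x' : E) (r r' : ℝ) :
    ‖kA θ h x r - kA θ h x' r'‖ ≤
      (K * ∫ z, (1 + ‖z‖) * ‖θ z‖) * dist ((x, r) : E × ℝ) (x', r') ^ σ := by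
  have hc := H.continuous' h0
  have hb : ∀ x, |h x| ≤ K := fun x => H.1 x trivial
  rw [kA, kA, ← integral_sub (kA_integrable hθ hc hb x r) (kA_integrable hθ hc hb x' r'),
    mul_assoc, ← integral_mul_const, ← integral_const_mul]
  refine norm_integral_le_of_norm_le ((hθ'.mul_const _).const_mul _) (ae_of_all _ fun z => ?_)
  rw [← sub_smul, norm_smul]
  set d := dist ((x, r) : E × ℝ) (x', r')
  have hd : 0 ≤ d := dist_nonneg
  have h2 := H.2 (x + r • z) trivial (x' + r' • z) trivial
  have h3 : dist (x + r • z) (x' + r' • z) ≤ (1 + ‖z‖) * d := by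
    have e : x + r • z - (x' + r' • z) = (x - x') + (r - r') • z := by module
    have hx : ‖x - x'‖ ≤ d := by rw [← dist_eq_norm]; exact le_max_left _ _
    have hr : ‖r - r'‖ ≤ d := by rw [← dist_eq_norm]; exact le_max_right _ _
    rw [dist_eq_norm, e]
    calc _ ≤ ‖x - x'‖ + ‖(r - r') • z‖ := norm_add_le _ _
      _ = ‖x - x'‖ + ‖r - r'‖ * ‖z‖ := by rw [norm_smul]
      _ ≤ d + d * ‖z‖ := by gcongr
      _ = _ := by ring
  have h4 : dist (x + r • z) (x' + r' • z) ^ σ ≤ (1 + ‖z‖) * d ^ σ := by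
    calc _ ≤ ((1 + ‖z‖) * d) ^ σ := Real.rpow_le_rpow dist_nonneg h3 h0.le
      _ = (1 + ‖z‖) ^ σ * d ^ σ := Real.mul_rpow (by positivity) hd
      _ ≤ _ := by gcongr; exact rpow_le_one_add h0 h1 (norm_nonneg _)
  calc _ ≤ (K * ((1 + ‖z‖) * d ^ σ)) * ‖θ z‖ := by
        gcongr; exact h2.trans (by gcongr)
    _ = _ := by ring

lemma kA_cancel {σ : ℝ} (h0 : 0 < σ) (h1 : σ < 1) {θ : E → F} (hθ : Integrable θ)
    (hθ' : Integrable (fun z => (1 + ‖z‖) * ‖θ z‖)) (hz : ∫ z, θ z = 0)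
    {h : E → ℝ} {K : ℝ} (hK : 0 ≤ K) (H : HolderLe σ univ h K) (x : E) {r : ℝ} (hr : 0 ≤ r) :
    ‖kA θ h x r‖ ≤ (K * ∫ z, (1 + ‖z‖) * ‖θ z‖) * r ^ σ := by
  have := kA_holder h0 h1 hθ hθ' hK H x x r 0
  have e : kA θ h x 0 = 0 := by
    simp only [kA, zero_smul, add_zero]
    rw [integral_smul, hz, smul_zero]
  simpa [e, Prod.dist_eq, abs_of_nonneg hr, hr] using this

/-- The kernel governing the joint `(x, r)`-derivative of `kA`. -/
noncomputable def kD (θ : 𝓢(E, F)) : 𝓢(E, E × ℝ →L[ℝ] F) :=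
  (fderivCLM ℝ E F θ).postcompCLM
      ((ContinuousLinearMap.compL ℝ (E × ℝ) E F).flip (ContinuousLinearMap.fst ℝ E ℝ))
  + (((finrank ℝ E : ℝ)) • θ + bilinLeftCLM (ContinuousLinearMap.id ℝ (E →L[ℝ] F))
      (Function.HasTemperateGrowth.id' (E := E)) (fderivCLM ℝ E F θ)).postcompCLM
      (ContinuousLinearMap.smulRightL ℝ (E × ℝ) F (ContinuousLinearMap.snd ℝ E ℝ))

lemma kD_apply (θ : 𝓢(E, F)) (z v : E) (τ : ℝ) :
    kD θ z (v, τ) = fderiv ℝ θ z v + τ • ((finrank ℝ E : ℝ) • θ z + fderiv ℝ θ z z) := by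
  simp [kD]
  exact smul_comm _ _ _


lemma schwartz_decay (θ : 𝓢(E, F)) (N : ℕ) :
    ∃ C, 0 ≤ C ∧ ∀ z, ‖θ z‖ ≤ C * (1 + ‖z‖) ^ (-(N : ℝ)) := by
  refine ⟨2 ^ N * (Finset.Iic (N, 0)).sup (fun m => SchwartzMap.seminorm ℝ m.1 m.2) θ,
    by positivity, fun z => ?_⟩
  have := SchwartzMap.one_add_le_sup_seminorm_apply (𝕜 := ℝ) (m := (N, 0)) (k := N) (n := 0)
    le_rfl le_rfl θ z
  rw [norm_iteratedFDeriv_zero] at this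
  have hp : 0 < (1 + ‖z‖) := by positivity
  rw [Real.rpow_neg hp.le, Real.rpow_natCast, ← div_eq_mul_inv, le_div_iff₀ (by positivity),
    mul_comm]
  exact this

lemma kA_change (θ : E → F) (h : E → ℝ) (x x0 : E) {r r0 : ℝ} (hr : 0 < r) (hr0 : 0 < r0) :
    kA θ h x r = ∫ z, h (x0 + r0 • z) • ((r0 * r⁻¹) ^ finrank ℝ E • θ (r⁻¹ • (x0 - x + r0 • z))) := by
  let G : E → F := fun z => h (x + r • z) • θ z
  have e1 : ∀ z, h (x0 + r0 • z) • ((r0 * r⁻¹) ^ finrank ℝ E • θ (r⁻¹ • (x0 - x + r0 • z)))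
      = (r0 * r⁻¹) ^ finrank ℝ E • G ((r0 * r⁻¹) • z + r⁻¹ • (x0 - x)) := by
    intro z
    have a1 : x + r • ((r0 * r⁻¹) • z + r⁻¹ • (x0 - x)) = x0 + r0 • z := by
      rw [smul_add, smul_smul, smul_smul, mul_inv_cancel₀ hr.ne', one_smul,
        show r * (r0 * r⁻¹) = r0 by field_simp]
      abel
    have a2 : r⁻¹ • (x0 - x + r0 • z) = (r0 * r⁻¹) • z + r⁻¹ • (x0 - x) := by
      module
    simp only [G]
    rw [a1, a2, smul_comm]
  simp_rw [e1]
  rw [integral_smul, Measure.integral_comp_smul volume (fun z => G (z + r⁻¹ • (x0 - x))),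
    integral_add_right_eq_self, smul_smul, kA, abs_of_pos (by positivity),
    mul_inv_cancel₀ (by positivity), one_smul]

lemma kA_hasFDerivAt (θ : 𝓢(E, F)) {h : E → ℝ} (hc : Continuous h) {M : ℝ}
    (hM : ∀ x, |h x| ≤ M) (x0 : E) {r0 : ℝ} (hr0 : 0 < r0) :
    HasFDerivAt (fun p : E × ℝ => kA θ h p.1 p.2) (-r0⁻¹ • kA (kD θ) h x0 r0) (x0, r0) := by
  set n := finrank ℝ E
  set N := (volume : Measure E).integrablePower
  obtain ⟨C, hC0, hC⟩ := schwartz_decay (kD θ) N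
  have hM0 : 0 ≤ M := (abs_nonneg _).trans (hM 0)
  let Φ : E × ℝ → E → F := fun p z =>
    h (x0 + r0 • z) • ((r0 * p.2⁻¹) ^ n • θ (p.2⁻¹ • (x0 - p.1 + r0 • z)))
  let Φ' : E × ℝ → E → (E × ℝ →L[ℝ] F) := fun p z =>
    h (x0 + r0 • z) • (-((r0 * p.2⁻¹) ^ n * p.2⁻¹) • kD θ (p.2⁻¹ • (x0 - p.1 + r0 • z)))
  have hs : Metric.ball ((x0, r0) : E × ℝ) (r0 / 2) ∈ 𝓝 ((x0, r0) : E × ℝ) :=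
    Metric.ball_mem_nhds _ (by positivity)
  have hball : ∀ p ∈ Metric.ball ((x0, r0) : E × ℝ) (r0 / 2),
      ‖p.1 - x0‖ < r0 / 2 ∧ r0 / 2 < p.2 ∧ p.2 < 2 * r0 := by
    intro p hp
    rw [Metric.mem_ball, Prod.dist_eq, max_lt_iff] at hp
    rw [dist_eq_norm, Real.dist_eq, abs_lt] at hp
    exact ⟨hp.1, by linarith [hp.2.1], by linarith [hp.2.2]⟩
  have hev : (fun p : E × ℝ => kA θ h p.1 p.2) =ᶠ[𝓝 (x0, r0)] fun p => ∫ z, Φ p z := by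
    filter_upwards [hs] with p hp
    exact kA_change θ h p.1 x0 (by linarith [(hball p hp).2.1]) hr0
  have hcont : ∀ p : E × ℝ, Continuous (Φ p) := by
    intro p
    have := θ.continuous
    fun_prop
  have hx0 : ∀ z, r0⁻¹ • (x0 - x0 + r0 • z) = z := by
    intro z; rw [sub_self, zero_add, smul_smul, inv_mul_cancel₀ hr0.ne', one_smul]
  have key := hasFDerivAt_integral_of_dominated_of_fderiv_le (𝕜 := ℝ) (μ := volume) (F := Φ)
    (F' := Φ') (x₀ := ((x0, r0) : E × ℝ))
    (bound := fun z => M * ((2 ^ n * (2 * r0⁻¹)) * (C * (2 ^ N * (1 + ‖z‖) ^ (-(N : ℝ))))))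
    hs (Eventually.of_forall fun p => cont_aesm (hcont p)) ?_ ?_ ?_ ?_ ?_
  · have e : (∫ z, Φ' (x0, r0) z) = -r0⁻¹ • kA (kD θ) h x0 r0 := by
      rw [kA, ← integral_smul]
      congr 1
      ext1 z
      simp only [Φ']
      rw [hx0, mul_inv_cancel₀ hr0.ne', one_pow, one_mul, smul_comm]
    rw [e] at key
    exact key.congr_of_eventuallyEq hev
  · simp only [Φ, hx0, mul_inv_cancel₀ hr0.ne', one_pow, one_smul]
    exact kA_integrable θ.integrable hc hM x0 r0
  · have := (kD θ).continuous
    refine cont_aesm ?_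
    simp only [Φ']
    fun_prop
  · refine ae_of_all _ fun z p hp => ?_
    obtain ⟨b1, b2, b3⟩ := hball p hp
    have p2 : 0 < p.2 := by linarith
    set z' := p.2⁻¹ • (x0 - p.1 + r0 • z) with hz'
    have hinv : p.2⁻¹ ≤ 2 * r0⁻¹ := by
      rw [inv_le_comm₀ p2 (by positivity), mul_inv, inv_inv]; linarith
    have hz : 1 + ‖z‖ ≤ 2 * (1 + ‖z'‖) := by
      have e : z = r0⁻¹ • (p.2 • z' + (p.1 - x0)) := by
        rw [hz', smul_smul, mul_inv_cancel₀ p2.ne', one_smul]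
        rw [show x0 - p.1 + r0 • z + (p.1 - x0) = r0 • z by abel, smul_smul,
          inv_mul_cancel₀ hr0.ne', one_smul]
      have : ‖z‖ ≤ r0⁻¹ * (2 * r0 * ‖z'‖ + r0 / 2) := by
        conv_lhs => rw [e]
        rw [norm_smul, Real.norm_of_nonneg (by positivity)]
        gcongr
        refine (norm_add_le _ _).trans ?_
        rw [norm_smul, Real.norm_of_nonneg p2.le]
        gcongr
      have e2 : r0⁻¹ * (2 * r0 * ‖z'‖ + r0 / 2) = 2 * ‖z'‖ + 1 / 2 := by field_simp
      linarith
    simp only [Φ']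
    rw [norm_smul, norm_smul]
    have c1 : ‖-((r0 * p.2⁻¹) ^ n * p.2⁻¹)‖ ≤ 2 ^ n * (2 * r0⁻¹) := by
      rw [norm_neg, Real.norm_of_nonneg (by positivity)]
      gcongr
      calc r0 * p.2⁻¹ ≤ r0 * (2 * r0⁻¹) := by gcongr
        _ = 2 := by field_simp
    have c2 : ‖kD θ z'‖ ≤ C * (2 ^ N * (1 + ‖z‖) ^ (-(N : ℝ))) := by
      refine (hC z').trans ?_
      gcongr
      rw [Real.rpow_neg (by positivity), Real.rpow_neg (by positivity), Real.rpow_natCast,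
        Real.rpow_natCast, ← div_eq_mul_inv, inv_le_comm₀ (by positivity) (by positivity), inv_div,
        ← div_pow]
      gcongr
      linarith
    have := hM (x0 + r0 • z)
    rw [← Real.norm_eq_abs] at this
    gcongr
  · exact ((((Measure.integrable_pow_neg_integrablePower volume).const_mul _).const_mul _).const_mul
      _).const_mul _
  · refine ae_of_all _ fun z p hp => ?_
    obtain ⟨b1, b2, b3⟩ := hball p hp
    have p2 : 0 < p.2 := by linarith
    simp only [Φ, Φ']
    refine HasFDerivAt.const_smul ?_ _
    have d2 : HasFDerivAt (fun p : E × ℝ => p.2⁻¹) (-(p.2 ^ 2)⁻¹ • ContinuousLinearMap.snd ℝ E ℝ) p :=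
      (hasDerivAt_inv p2.ne').comp_hasFDerivAt p hasFDerivAt_snd
    have d3 : HasFDerivAt (fun p : E × ℝ => x0 - p.1 + r0 • z) (-ContinuousLinearMap.fst ℝ E ℝ) p :=
      (hasFDerivAt_fst.const_sub x0).add_const _
    have d4 := (θ.hasFDerivAt (p.2⁻¹ • (x0 - p.1 + r0 • z))).comp p (d2.smul d3)
    have d5 := ((d2.const_mul r0).pow n).smul d4
    refine d5.congr_fderiv ?_
    refine ContinuousLinearMap.ext ?_
    rintro ⟨v, τ⟩
    set z' := p.2⁻¹ • (x0 - p.1 + r0 • z) with hz'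
    have e : x0 - p.1 + r0 • z = p.2 • z' := by
      rw [hz', smul_smul, mul_inv_cancel₀ p2.ne', one_smul]
    have e3 : ((fun p : E × ℝ => p.2⁻¹) • fun p : E × ℝ => x0 - p.1 + r0 • z) p = z' := rfl
    simp only [ContinuousLinearMap.add_apply, ContinuousLinearMap.smul_apply,
      ContinuousLinearMap.comp_apply, ContinuousLinearMap.smulRight_apply, Function.comp_apply, e3,
      kD_apply, ContinuousLinearMap.neg_apply, ContinuousLinearMap.coe_fst',
      ContinuousLinearMap.coe_snd', map_add, map_smul, map_neg, e, smul_eq_mul, nsmul_eq_mul]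
    rw [show finrank ℝ E = n from rfl]
    rcases Nat.eq_zero_or_pos n with hn | hn
    · simp only [hn]
      match_scalars <;> field_simp <;> simp
    · obtain ⟨k, hk⟩ := Nat.exists_eq_succ_of_ne_zero hn.ne'
      simp only [hk, Nat.succ_sub_one, pow_succ]
      match_scalars <;> field_simp <;> try ring

end Kernel


section Kernel2
open MeasureTheory Topology SchwartzMap Module

variable {E : Type*} [NormedAddCommGroup E] [NormedSpace ℝ E] [FiniteDimensional ℝ E]
  [MeasureSpace E] [BorelSpace E] [(volume : Measure E).IsAddHaarMeasure]
  {F : Type*} [NormedAddCommGroup F] [NormedSpace ℝ F] [CompleteSpace F]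
  {G : Type*} [NormedAddCommGroup G] [NormedSpace ℝ G] [CompleteSpace G]

lemma kA_clm (L : F →L[ℝ] G) {θ : E → F} (hθ : Integrable θ) {h : E → ℝ} (hc : Continuous h) {M : ℝ}
    (hM : ∀ x, |h x| ≤ M) (x : E) (r : ℝ) : kA (fun z => L (θ z)) h x r = L (kA θ h x r) := by
  rw [kA, kA, ← L.integral_comp_comm (kA_integrable hθ hc hM x r)]
  simp

lemma kA_fderiv_x (θ : 𝓢(E, F)) {h : E → ℝ} (hc : Continuous h) {M : ℝ}
    (hM : ∀ x, |h x| ≤ M) (x0 : E) {r0 : ℝ} (hr0 : 0 < r0) :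
    HasFDerivAt (fun x => kA θ h x r0) (-r0⁻¹ • kA (fderivCLM ℝ E F θ) h x0 r0) x0 := by
  have h1 : HasFDerivAt (fun x : E => (x, r0)) (ContinuousLinearMap.inl ℝ E ℝ) x0 :=
    hasFDerivAt_prodMk_left x0 r0
  have h2 := HasFDerivAt.comp (f := fun x : E => (x, r0)) x0 (kA_hasFDerivAt θ hc hM x0 hr0) h1
  refine h2.congr_fderiv ?_
  have h3 := kA_clm ((ContinuousLinearMap.compL ℝ E (E × ℝ) F).flip (ContinuousLinearMap.inl ℝ E ℝ))
    (kD θ).integrable hc hM x0 r0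
  have h4 : (fun z => ((ContinuousLinearMap.compL ℝ E (E × ℝ) F).flip
      (ContinuousLinearMap.inl ℝ E ℝ)) (kD θ z)) = fderivCLM ℝ E F θ := by
    funext z
    ext v
    simp [kD_apply]
  rw [h4] at h3
  rw [h3]
  rfl

lemma kA_deriv_r (θ : 𝓢(E, F)) {h : E → ℝ} (hc : Continuous h) {M : ℝ}
    (hM : ∀ x, |h x| ≤ M) (x0 : E) {r0 : ℝ} (hr0 : 0 < r0) :
    HasDerivAt (fun r => kA θ h x0 r)
      (-r0⁻¹ • kA (fun z => (finrank ℝ E : ℝ) • θ z + fderiv ℝ θ z z) h x0 r0) r0 := by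
  have h1 : HasFDerivAt (fun r : ℝ => (x0, r)) (ContinuousLinearMap.inr ℝ E ℝ) r0 :=
    hasFDerivAt_prodMk_right x0 r0
  have h2 := HasFDerivAt.comp (f := fun r : ℝ => (x0, r)) r0 (kA_hasFDerivAt θ hc hM x0 hr0) h1
  have h5 := h2.hasDerivAt
  refine h5.congr_deriv ?_
  have h3 := kA_clm (ContinuousLinearMap.apply ℝ F ((0, 1) : E × ℝ))
    (kD θ).integrable hc hM x0 r0
  have h4 : (fun z => (ContinuousLinearMap.apply ℝ F ((0, 1) : E × ℝ)) (kD θ z)) =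
      fun z => (finrank ℝ E : ℝ) • θ z + fderiv ℝ θ z z := by
    funext z
    simp [kD_apply]
  rw [h4] at h3
  rw [h3]
  simp

lemma integral_kD_zero (θ : 𝓢(E, F)) : ∫ z, kD θ z = 0 := by
  have h := kA_hasFDerivAt θ (h := fun _ => 1) continuous_const (M := 1) (by simp) 0 one_pos
  have e : (fun p : E × ℝ => kA θ (fun _ => 1) p.1 p.2) = fun _ => ∫ z, θ z := by
    funext p; simp [kA]
  rw [e] at h
  have h2 := h.unique (hasFDerivAt_const _ _)
  simpa [kA] using h2

lemma integral_fderiv_zero (θ : 𝓢(E, F)) : ∫ z, fderivCLM ℝ E F θ z = 0 := by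
  have h := kA_fderiv_x θ (h := fun _ => 1) continuous_const (M := 1) (by simp) 0 one_pos
  have e : (fun x : E => kA θ (fun _ => 1) x 1) = fun _ => ∫ z, θ z := by
    funext p; simp [kA]
  rw [e] at h
  have h2 := h.unique (hasFDerivAt_const _ _)
  simpa [kA] using h2

lemma kA_continuousOn (θ : 𝓢(E, F)) {h : E → ℝ} (hc : Continuous h) {M : ℝ}
    (hM : ∀ x, |h x| ≤ M) (x0 : E) : ContinuousOn (fun r => kA θ h x0 r) (Ioi 0) :=
  fun r hr => (kA_deriv_r θ hc hM x0 hr).continuousAt.continuousWithinAt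

lemma kA_cont_zero {θ : E → F} (hθ : Integrable θ) {h : E → ℝ} (hc : Continuous h) {M : ℝ}
    (hM : ∀ x, |h x| ≤ M) (x0 : E) : Continuous (fun r => kA θ h x0 r) := by
  refine continuous_of_dominated (bound := fun z => M * ‖θ z‖)
    (fun r => (kA_integrable hθ hc hM x0 r).1) (fun r => ae_of_all _ fun z => ?_)
    (hθ.norm.const_mul _) (ae_of_all _ fun z => ?_)
  · rw [norm_smul]; exact mul_le_mul_of_nonneg_right (hM _) (norm_nonneg _)
  · fun_prop

lemma kJ_hasFDerivAt (θ : 𝓢(E, F)) {h : E → ℝ} (hc : Continuous h) {M : ℝ}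
    (hM : ∀ x, |h x| ≤ M) {c b : ℝ → ℝ} (hcc : ContinuousOn c (Ioi 0))
    (hb : ∀ x, ∀ r > 0, ‖kA (fderivCLM ℝ E F θ) h x r‖ ≤ b r)
    (hbi : IntegrableOn (fun r => |c r| * r⁻¹ * b r) (Ioi 0))
    (x0 : E) (hi : IntegrableOn (fun r => c r • kA θ h x0 r) (Ioi 0)) :
    HasFDerivAt (fun x => ∫ r in Ioi 0, c r • kA θ h x r)
      (∫ r in Ioi 0, (-(c r * r⁻¹)) • kA (fderivCLM ℝ E F θ) h x0 r) x0 := by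
  refine hasFDerivAt_integral_of_dominated_of_fderiv_le (𝕜 := ℝ) (s := univ)
    (F' := fun x r => (-(c r * r⁻¹)) • kA (fderivCLM ℝ E F θ) h x r)
    (bound := fun r => |c r| * r⁻¹ * b r) univ_mem (Eventually.of_forall fun x => ?_) hi ?_ ?_ hbi ?_
  · exact (hcc.smul (kA_continuousOn θ hc hM x)).aestronglyMeasurable measurableSet_Ioi
  · refine ContinuousOn.aestronglyMeasurable ?_ measurableSet_Ioi
    have hA := kA_continuousOn (fderivCLM ℝ E F θ) hc hM x0
    have hB : ContinuousOn (fun r => -(c r * r⁻¹)) (Ioi 0) :=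
      (hcc.mul (continuousOn_inv₀.mono fun r hr => ne_of_gt hr)).neg
    exact hB.smul hA
  · refine (ae_restrict_mem measurableSet_Ioi).mono fun r hr x _ => ?_
    have hr : 0 < r := hr
    rw [norm_smul, norm_neg, norm_mul, Real.norm_eq_abs, Real.norm_of_nonneg (by positivity)]
    gcongr
    exact hb x r hr
  · refine (ae_restrict_mem measurableSet_Ioi).mono fun r hr x _ => ?_
    refine ((kA_fderiv_x θ hc hM x hr).const_smul (c r)).congr_fderiv ?_
    rw [smul_smul]; congr 1; ring

end Kernel2


section Gauss
open MeasureTheory Topology SchwartzMap Module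

lemma schwartz_of_log_deriv {E : Type*} [NormedAddCommGroup E] [NormedSpace ℝ E]
    (γ : E → ℝ) (ℓ : E →L[ℝ] E →L[ℝ] ℝ) (hs : ContDiff ℝ (⊤ : ℕ∞) γ)
    (hd : ∀ z, fderiv ℝ γ z = γ z • ℓ z)
    (hdec : ∀ k : ℕ, ∃ C : ℝ, ∀ z, (1 + ‖z‖) ^ k * ‖γ z‖ ≤ C) :
    ∀ n k : ℕ, ∃ C : ℝ, ∀ z, (1 + ‖z‖) ^ k * ‖iteratedFDeriv ℝ n γ z‖ ≤ C := by
  intro n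
  induction n using Nat.strong_induction_on with
  | _ n ih =>
    rcases n with _ | n
    · intro k
      obtain ⟨C, hC⟩ := hdec k
      exact ⟨C, fun z => by simpa [norm_iteratedFDeriv_zero] using hC z⟩
    · intro k
      obtain ⟨K, C0, hC0, hl⟩ := ℓ.hasTemperateGrowth.norm_iteratedFDeriv_le_uniform n
      have h1 : ∀ i, ∃ C : ℝ, i ≤ n → ∀ z, (1 + ‖z‖) ^ (k + K) * ‖iteratedFDeriv ℝ i γ z‖ ≤ C := by
        intro i
        by_cases hi : i ≤ n
        · obtain ⟨C, hC⟩ := ih i (by omega) (k + K)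
          exact ⟨C, fun _ => hC⟩
        · exact ⟨0, fun h => absurd h hi⟩
      choose C hC using h1
      refine ⟨∑ i ∈ Finset.range (n + 1), (n.choose i : ℝ) * C i * C0, fun z => ?_⟩
      have e : fderiv ℝ γ = fun z => γ z • ℓ z := funext hd
      rw [← norm_iteratedFDeriv_fderiv, e]
      have h2 := norm_iteratedFDeriv_smul_le (𝕜 := ℝ) (f := γ) (g := ℓ) (N := (⊤ : ℕ∞)) hs ℓ.contDiff z (n := n)
        (by exact_mod_cast le_top)
      calc _ ≤ (1 + ‖z‖) ^ k * _ := mul_le_mul_of_nonneg_left h2 (by positivity)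
        _ = ∑ i ∈ Finset.range (n + 1), (1 + ‖z‖) ^ k * ((n.choose i : ℝ) * ‖iteratedFDeriv ℝ i γ z‖ *
          ‖iteratedFDeriv ℝ (n - i) (⇑ℓ) z‖) := Finset.mul_sum _ _ _
        _ ≤ _ := by
          refine Finset.sum_le_sum fun i hi => ?_
          have hi' : i ≤ n := by simpa [Nat.lt_succ_iff] using hi
          have a1 := hC i hi' z
          have a2 := hl (n - i) (by omega) z
          calc _ ≤ (1 + ‖z‖) ^ k * ((n.choose i : ℝ) * ‖iteratedFDeriv ℝ i γ z‖ *
                (C0 * (1 + ‖z‖) ^ K)) := by gcongr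
            _ = (n.choose i : ℝ) * ((1 + ‖z‖) ^ (k + K) * ‖iteratedFDeriv ℝ i γ z‖) * C0 := by
              rw [pow_add]; ring
            _ ≤ _ := by gcongr

/-- The ambient space `ℝ^m × ℝ`. -/
abbrev XX (m : ℕ) := EuclideanSpace ℝ (Fin m) × ℝ

instance instHaarXX (m : ℕ) : (volume : Measure (XX m)).IsAddHaarMeasure :=
  Measure.prod.instIsAddHaarMeasure _ _

noncomputable def gLa (m : ℕ) : XX m →L[ℝ] XX m →L[ℝ] ℝ :=
  ContinuousLinearMap.bilinearComp (innerSL ℝ (E := EuclideanSpace ℝ (Fin m)))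
    (ContinuousLinearMap.fst ℝ _ ℝ) (ContinuousLinearMap.fst ℝ _ ℝ)

noncomputable def gLb (m : ℕ) : XX m →L[ℝ] XX m →L[ℝ] ℝ :=
  ContinuousLinearMap.bilinearComp (innerSL ℝ (E := ℝ))
    (ContinuousLinearMap.snd ℝ _ ℝ) (ContinuousLinearMap.snd ℝ _ ℝ)

/-- Euclidean inner product on `ℝ^m × ℝ`, up to the factor `-1/2`. -/
noncomputable def gL (m : ℕ) : XX m →L[ℝ] XX m →L[ℝ] ℝ :=
  (-(1 / 2 : ℝ)) • (gLa m + gLb m)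

lemma gL_apply (m : ℕ) (z u : XX m) : gL m z u = -(1 / 2) * (inner ℝ z.1 u.1 + z.2 * u.2) := by
  have h1 : gLa m z u = inner ℝ z.1 u.1 := rfl
  have h2 : gLb m z u = z.2 * u.2 := by
    show inner ℝ z.2 u.2 = _
    simp [mul_comm]
  rw [gL, ContinuousLinearMap.smul_apply, ContinuousLinearMap.smul_apply,
    ContinuousLinearMap.add_apply, ContinuousLinearMap.add_apply, h1, h2, smul_eq_mul]

noncomputable def gauss0 (m : ℕ) (z : XX m) : ℝ := Real.exp (1 / 2 * gL m z z)

lemma gauss0_eq (m : ℕ) (z : XX m) : gauss0 m z = Real.exp (-(‖z.1‖ ^ 2 + z.2 ^ 2) / 4) := by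
  rw [gauss0, gL_apply, real_inner_self_eq_norm_sq]; congr 1; ring

lemma gL_symm (m : ℕ) (z u : XX m) : gL m z u = gL m u z := by
  rw [gL_apply, gL_apply, real_inner_comm]; ring

lemma gauss0_hasFDerivAt (m : ℕ) (z : XX m) :
    HasFDerivAt (gauss0 m) (gauss0 m z • gL m z) z := by
  have h1 : HasFDerivAt (fun z => gL m z z) ((gL m z).comp (ContinuousLinearMap.id ℝ _) + (gL m).flip z) z := by
    have := (gL m).hasFDerivAt (x := z) |>.clm_apply (hasFDerivAt_id z)
    exact this
  have h2 := (h1.const_mul (1 / 2)).exp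
  refine h2.congr_fderiv ?_
  ext u <;>
  simp [gauss0, gL_symm m _ z] <;> ring_nf <;> simp

lemma gauss0_contDiff (m : ℕ) : ContDiff ℝ (⊤ : ℕ∞) (gauss0 m) := by
  unfold gauss0
  refine Real.contDiff_exp.comp (contDiff_const.mul ?_)
  exact (gL m).contDiff.clm_apply contDiff_id

lemma gauss0_decay (m k : ℕ) : ∃ C : ℝ, ∀ z, (1 + ‖z‖) ^ k * ‖gauss0 m z‖ ≤ C := by
  refine ⟨k.factorial * Real.exp 2, fun z => ?_⟩
  have h1 : (1 + ‖z‖) ^ k ≤ k.factorial * Real.exp (1 + ‖z‖) := by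
    have := Real.pow_div_factorial_le_exp (x := 1 + ‖z‖) (by positivity) k
    rw [div_le_iff₀ (by positivity)] at this
    linarith
  have h2 : gauss0 m z ≤ Real.exp (1 - ‖z‖) := by
    rw [gauss0_eq]
    apply Real.exp_le_exp.2
    have : ‖z‖ ^ 2 ≤ ‖z.1‖ ^ 2 + z.2 ^ 2 := by
      rcases max_choice ‖z.1‖ ‖z.2‖ with h | h
      · rw [Prod.norm_def, h]; nlinarith [sq_nonneg z.2]
      · rw [Prod.norm_def, h, Real.norm_eq_abs, sq_abs]; nlinarith [sq_nonneg ‖z.1‖]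
    nlinarith [sq_nonneg (‖z‖ - 2)]
  rw [Real.norm_of_nonneg (by rw [gauss0]; positivity)]
  calc _ ≤ (k.factorial * Real.exp (1 + ‖z‖)) * Real.exp (1 - ‖z‖) := by
        gcongr
        rw [gauss0]; positivity
    _ = _ := by rw [mul_assoc, ← Real.exp_add]; congr 2; ring

noncomputable def gaussS0 (m : ℕ) : 𝓢(XX m, ℝ) where
  toFun := gauss0 m
  smooth' := gauss0_contDiff m
  decay' k n := by
    obtain ⟨C, hC⟩ := schwartz_of_log_deriv (gauss0 m) (gL m) (gauss0_contDiff m)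
      (fun z => (gauss0_hasFDerivAt m z).fderiv) (gauss0_decay m) n k
    refine ⟨C, fun z => le_trans ?_ (hC z)⟩
    gcongr
    linarith [norm_nonneg z]

/-- Normalized Gaussian. -/
noncomputable def gaussS (m : ℕ) : 𝓢(XX m, ℝ) := (∫ z, gauss0 m z)⁻¹ • gaussS0 m

lemma gaussS_apply (m : ℕ) (z : XX m) : gaussS m z = (∫ z, gauss0 m z)⁻¹ * gauss0 m z := rfl

lemma gauss0_pos (m : ℕ) (z : XX m) : 0 < gauss0 m z := Real.exp_pos _

lemma gauss0_int_pos (m : ℕ) : 0 < ∫ z, gauss0 m z := by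
  have hi : Integrable (gauss0 m) := (gaussS0 m).integrable
  rw [integral_pos_iff_support_of_nonneg (fun z => (gauss0_pos m z).le) hi]
  have : Function.support (gauss0 m) = univ := by
    ext z; simp [(gauss0_pos m z).ne']
  rw [this]
  exact isOpen_univ.measure_pos _ univ_nonempty

lemma gaussS_nonneg (m : ℕ) (z : XX m) : 0 ≤ gaussS m z := by
  rw [gaussS_apply]
  exact mul_nonneg (inv_nonneg.2 (gauss0_int_pos m).le) (gauss0_pos m z).le

lemma gaussS_integral (m : ℕ) : ∫ z, gaussS m z = 1 := by
  simp_rw [gaussS_apply]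
  rw [integral_const_mul, inv_mul_cancel₀ (gauss0_int_pos m).ne']

lemma gaussS_fderiv (m : ℕ) (z : XX m) : HasFDerivAt (gaussS m) (gaussS m z • gL m z) z := by
  have := (gauss0_hasFDerivAt m z).const_mul (∫ z, gauss0 m z)⁻¹
  refine this.congr_fderiv ?_
  rw [smul_smul]; rfl

/-- Trace of a bilinear form on `ℝ^m × ℝ`. -/
noncomputable def trX (m : ℕ) : (XX m →L[ℝ] XX m →L[ℝ] ℝ) →L[ℝ] ℝ :=
  (∑ i : Fin m, (ContinuousLinearMap.apply ℝ ℝ ((EuclideanSpace.single i (1:ℝ), 0) : XX m)).comp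
    (ContinuousLinearMap.apply ℝ (XX m →L[ℝ] ℝ) ((EuclideanSpace.single i (1:ℝ), 0) : XX m))) +
  (ContinuousLinearMap.apply ℝ ℝ ((0, 1) : XX m)).comp
    (ContinuousLinearMap.apply ℝ (XX m →L[ℝ] ℝ) ((0, 1) : XX m))

lemma trX_apply (m : ℕ) (A : XX m →L[ℝ] XX m →L[ℝ] ℝ) :
    trX m A = (∑ i : Fin m, A (EuclideanSpace.single i (1:ℝ), 0) (EuclideanSpace.single i (1:ℝ), 0))
      + A (0, 1) (0, 1) := by
  simp [trX, ContinuousLinearMap.sum_apply]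

lemma gaussS_trace (m : ℕ) (z : XX m) :
    (finrank ℝ (XX m) : ℝ) • gaussS m z + fderiv ℝ (gaussS m) z z =
      -2 * trX m (fderivCLM ℝ _ _ (fderivCLM ℝ _ _ (gaussS m)) z) := by
  have e1 : ∀ z, fderivCLM ℝ _ _ (gaussS m) z = gaussS m z • gL m z := fun z =>
    (gaussS_fderiv m z).fderiv
  have e1' : ⇑(fderivCLM ℝ _ _ (gaussS m)) = fun z => gaussS m z • gL m z := funext e1
  have e2 : fderivCLM ℝ _ _ (fderivCLM ℝ _ _ (gaussS m)) z =
      gaussS m z • gL m + (gaussS m z • gL m z).smulRight (gL m z) := by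
    rw [fderivCLM_apply, e1']
    exact ((gaussS_fderiv m z).smul (gL m).hasFDerivAt).fderiv
  rw [e2, (gaussS_fderiv m z).fderiv, trX_apply]
  have a0 : ∀ e : XX m, (gaussS m z • gL m + (gaussS m z • gL m z).smulRight (gL m z)) e e =
      gaussS m z * (gL m e e + gL m z e ^ 2) := by
    intro e
    simp only [ContinuousLinearMap.add_apply, ContinuousLinearMap.smul_apply,
      ContinuousLinearMap.smulRight_apply, smul_eq_mul]
    ring
  simp only [a0]
  have a1 : ∀ i : Fin m, gL m (EuclideanSpace.single i (1:ℝ), 0) (EuclideanSpace.single i (1:ℝ), 0) = -(1/2) := by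
    intro i; rw [gL_apply]; simp
  have a2 : gL m (0, 1) (0, 1) = -(1/2) := by rw [gL_apply]; simp
  have a3 : ∀ i : Fin m, gL m z (EuclideanSpace.single i (1:ℝ), 0) = -(1/2) * z.1 i := by
    intro i; rw [gL_apply]; simp [EuclideanSpace.inner_single_right]
  have a4 : gL m z (0, 1) = -(1/2) * z.2 := by rw [gL_apply]; simp
  have a5 : (gaussS m z • gL m z) z = gaussS m z * (-(1/2) * (∑ i, z.1 i ^ 2 + z.2 ^ 2)) := by
    rw [ContinuousLinearMap.smul_apply, gL_apply, real_inner_self_eq_norm_sq,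
      EuclideanSpace.norm_sq_eq, smul_eq_mul]
    simp [sq]
  have a6 : (finrank ℝ (XX m) : ℝ) = m + 1 := by simp [Module.finrank_prod]
  simp only [a1, a2, a3, a4, a5, a6, ← Finset.mul_sum, Finset.sum_add_distrib, mul_pow]
  simp
  ring

end Gauss


section Resolvent
open MeasureTheory Topology SchwartzMap Module

variable {E : Type*} [NormedAddCommGroup E] [NormedSpace ℝ E] [FiniteDimensional ℝ E]
  [MeasureSpace E] [BorelSpace E] [(volume : Measure E).IsAddHaarMeasure]
  {F : Type*} [NormedAddCommGroup F] [NormedSpace ℝ F] [CompleteSpace F]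

noncomputable def c0 (μ r : ℝ) : ℝ := 2 * r * Real.exp (-μ * r ^ 2)
noncomputable def c1 (μ r : ℝ) : ℝ := -(c0 μ r * r⁻¹)
noncomputable def c2 (μ r : ℝ) : ℝ := -(c1 μ r * r⁻¹)

noncomputable def R0 (μ : ℝ) (γ : 𝓢(E, F)) (h : E → ℝ) (x : E) : F :=
  ∫ r in Ioi 0, c0 μ r • kA γ h x r
noncomputable def R1 (μ : ℝ) (γ : 𝓢(E, F)) (h : E → ℝ) (x : E) : E →L[ℝ] F :=
  ∫ r in Ioi 0, c1 μ r • kA (fderivCLM ℝ E F γ) h x r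
noncomputable def R2 (μ : ℝ) (γ : 𝓢(E, F)) (h : E → ℝ) (x : E) : E →L[ℝ] E →L[ℝ] F :=
  ∫ r in Ioi 0, c2 μ r • kA (fderivCLM ℝ E _ (fderivCLM ℝ E F γ)) h x r

lemma c0_abs (μ : ℝ) {r : ℝ} (hr : 0 < r) : |c0 μ r| = 2 * (r ^ (1:ℝ) * Real.exp (-μ * r ^ 2)) := by
  rw [c0, abs_of_nonneg (by positivity), Real.rpow_one]; ring
lemma c1_abs (μ : ℝ) {r : ℝ} (hr : 0 < r) : |c1 μ r| = 2 * (r ^ (0:ℝ) * Real.exp (-μ * r ^ 2)) := by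
  rw [c1, abs_neg, abs_mul, c0_abs μ hr, abs_of_pos (inv_pos.2 hr), Real.rpow_one, Real.rpow_zero]
  field_simp
lemma c2_abs (μ : ℝ) {r : ℝ} (hr : 0 < r) : |c2 μ r| = 2 * (r ^ (-1:ℝ) * Real.exp (-μ * r ^ 2)) := by
  rw [c2, abs_neg, abs_mul, c1_abs μ hr, abs_of_pos (inv_pos.2 hr), Real.rpow_neg_one, Real.rpow_zero]
  ring
lemma c0_cont (μ : ℝ) : ContinuousOn (c0 μ) (Ioi 0) := by
  unfold c0; fun_prop
lemma c1_cont (μ : ℝ) : ContinuousOn (c1 μ) (Ioi 0) :=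
  ((c0_cont μ).mul (continuousOn_inv₀.mono fun r hr => ne_of_gt hr)).neg
lemma c2_cont (μ : ℝ) : ContinuousOn (c2 μ) (Ioi 0) :=
  ((c1_cont μ).mul (continuousOn_inv₀.mono fun r hr => ne_of_gt hr)).neg

lemma wt_int {μ : ℝ} (hμ : 0 < μ) {s : ℝ} (hs : -1 < s) (A : ℝ) :
    IntegrableOn (fun r : ℝ => A * (r ^ s * Real.exp (-μ * r ^ 2))) (Ioi 0) :=
  (integrableOn_rpow_mul_exp_neg_mul_sq hμ hs).const_mul A

lemma kJ_integrable (θ : 𝓢(E, F)) {h : E → ℝ} (hc : Continuous h) {M : ℝ}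
    (hM : ∀ x, |h x| ≤ M) {c b : ℝ → ℝ} (hcc : ContinuousOn c (Ioi 0)) (x : E)
    (hb : ∀ r > 0, |c r| * ‖kA θ h x r‖ ≤ b r) (hbi : IntegrableOn b (Ioi 0)) :
    IntegrableOn (fun r => c r • kA θ h x r) (Ioi 0) := by
  refine Integrable.mono' hbi ?_ ?_
  · exact (hcc.smul (kA_continuousOn θ hc hM x)).aestronglyMeasurable measurableSet_Ioi
  · refine (ae_restrict_mem measurableSet_Ioi).mono fun r hr => ?_
    rw [norm_smul, Real.norm_eq_abs]; exact hb r hr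

/-- bounded case bound for weights -/
lemma R0_bd (γ : 𝓢(E, F)) (μ : ℝ) {h : E → ℝ} {M : ℝ}
    (hM : ∀ x, |h x| ≤ M) (x : E) (r : ℝ) (hr : 0 < r) :
    |c0 μ r| * ‖kA γ h x r‖ ≤ (2 * (M * ∫ z, ‖γ z‖)) * (r ^ (1:ℝ) * Real.exp (-μ * r ^ 2)) := by
  rw [c0_abs μ hr]
  calc _ ≤ 2 * (r ^ (1:ℝ) * Real.exp (-μ * r ^ 2)) * (M * ∫ z, ‖γ z‖) := by
        gcongr; exact kA_bound γ.integrable hM x r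
    _ = _ := by ring

lemma R0_integrable (γ : 𝓢(E, F)) {μ : ℝ} (hμ : 0 < μ) {h : E → ℝ} (hc : Continuous h) {M : ℝ}
    (hM : ∀ x, |h x| ≤ M) (x : E) : IntegrableOn (fun r => c0 μ r • kA γ h x r) (Ioi 0) :=
  kJ_integrable γ hc hM (c0_cont μ) x (R0_bd γ μ hM x) (wt_int hμ (by norm_num) _)

lemma R1_bd (θ : 𝓢(E, F)) (μ : ℝ) {h : E → ℝ} {M : ℝ}
    (hM : ∀ x, |h x| ≤ M) (x : E) (r : ℝ) (hr : 0 < r) :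
    |c1 μ r| * ‖kA θ h x r‖ ≤ (2 * (M * ∫ z, ‖θ z‖)) * (r ^ (0:ℝ) * Real.exp (-μ * r ^ 2)) := by
  rw [c1_abs μ hr]
  calc _ ≤ 2 * (r ^ (0:ℝ) * Real.exp (-μ * r ^ 2)) * (M * ∫ z, ‖θ z‖) := by
        gcongr; exact kA_bound θ.integrable hM x r
    _ = _ := by ring

lemma R1_integrable (θ : 𝓢(E, F)) {μ : ℝ} (hμ : 0 < μ) {h : E → ℝ} (hc : Continuous h) {M : ℝ}
    (hM : ∀ x, |h x| ≤ M) (x : E) : IntegrableOn (fun r => c1 μ r • kA θ h x r) (Ioi 0) :=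
  kJ_integrable θ hc hM (c1_cont μ) x (R1_bd θ μ hM x) (wt_int hμ (by norm_num) _)

lemma norm_setIntegral_le {G : ℝ → F} {b : ℝ → ℝ} (hbi : IntegrableOn b (Ioi 0))
    (hb : ∀ r > 0, ‖G r‖ ≤ b r) : ‖∫ r in Ioi 0, G r‖ ≤ ∫ r in Ioi 0, b r :=
  norm_integral_le_of_norm_le hbi ((ae_restrict_mem measurableSet_Ioi).mono fun r hr => hb r hr)

lemma R0_bound (γ : 𝓢(E, F)) {μ : ℝ} (hμ : 0 < μ) : ∃ C ≥ 0, ∀ (h : E → ℝ) (M : ℝ), 0 ≤ M →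
    (∀ x, |h x| ≤ M) → ∀ x, ‖R0 μ γ h x‖ ≤ C * M := by
  refine ⟨2 * (∫ z, ‖γ z‖) * ∫ r in Ioi 0, (r ^ (1:ℝ) * Real.exp (-μ * r ^ 2)), ?_, fun h M h0 hM x => ?_⟩
  · have : 0 ≤ ∫ r in Ioi (0:ℝ), (r ^ (1:ℝ) * Real.exp (-μ * r ^ 2)) :=
      setIntegral_nonneg measurableSet_Ioi fun r hr => by
        have : (0:ℝ) < r := hr
        positivity
    have h2 : 0 ≤ ∫ z, ‖γ z‖ := integral_nonneg fun _ => norm_nonneg _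
    positivity
  · have := norm_setIntegral_le (G := fun r => c0 μ r • kA γ h x r) (wt_int hμ (s := 1) (by norm_num) _)
      fun r hr => by rw [norm_smul]; exact R0_bd γ μ hM x r hr
    refine this.trans (le_of_eq ?_)
    rw [integral_const_mul]; ring

lemma R1_bound (γ : 𝓢(E, F)) {μ : ℝ} (hμ : 0 < μ) : ∃ C ≥ 0, ∀ (h : E → ℝ) (M : ℝ), 0 ≤ M →
    (∀ x, |h x| ≤ M) → ∀ x, ‖R1 μ γ h x‖ ≤ C * M := by
  refine ⟨2 * (∫ z, ‖fderivCLM ℝ E F γ z‖) * ∫ r in Ioi 0, (r ^ (0:ℝ) * Real.exp (-μ * r ^ 2)), ?_,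
    fun h M h0 hM x => ?_⟩
  · have : 0 ≤ ∫ r in Ioi (0:ℝ), (r ^ (0:ℝ) * Real.exp (-μ * r ^ 2)) :=
      setIntegral_nonneg measurableSet_Ioi fun r hr => by
        have : (0:ℝ) < r := hr
        positivity
    have h2 : 0 ≤ ∫ z, ‖fderivCLM ℝ E F γ z‖ := integral_nonneg fun _ => norm_nonneg _
    positivity
  · have := norm_setIntegral_le (G := fun r => c1 μ r • kA (fderivCLM ℝ E F γ) h x r)
      (wt_int hμ (s := 0) (by norm_num) _)
      fun r hr => by rw [norm_smul]; exact R1_bd (fderivCLM ℝ E F γ) μ hM x r hr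
    refine this.trans (le_of_eq ?_)
    rw [integral_const_mul]; ring

lemma R0_hasFDerivAt (γ : 𝓢(E, F)) {μ : ℝ} (hμ : 0 < μ) {h : E → ℝ} (hc : Continuous h) {M : ℝ}
    (hM : ∀ x, |h x| ≤ M) (x : E) : HasFDerivAt (R0 μ γ h) (R1 μ γ h x) x := by
  refine kJ_hasFDerivAt γ hc hM (c0_cont μ) (b := fun _ => M * ∫ z, ‖fderivCLM ℝ E F γ z‖)
    (fun x r hr => kA_bound (fderivCLM ℝ E F γ).integrable hM x r) ?_ x (R0_integrable γ hμ hc hM x)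
  refine (wt_int hμ (s := 0) (by norm_num) (2 * (M * ∫ z, ‖fderivCLM ℝ E F γ z‖))).congr_fun
    (fun r hr => ?_) measurableSet_Ioi
  have hr : (0:ℝ) < r := hr
  simp only [c0_abs μ hr, Real.rpow_one, Real.rpow_zero]
  field_simp

lemma R2_bd (θ : 𝓢(E, F)) (μ : ℝ) {σ : ℝ} (s0 : 0 < σ) (s1 : σ < 1) (hz : ∫ z, θ z = 0) {h : E → ℝ} {K : ℝ}
    (hK : 0 ≤ K) (H : HolderLe σ univ h K) (x : E) (r : ℝ) (hr : 0 < r) :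
    |c2 μ r| * ‖kA θ h x r‖ ≤
      (2 * (K * ∫ z, (1 + ‖z‖) * ‖θ z‖)) * (r ^ (σ - 1) * Real.exp (-μ * r ^ 2)) := by
  rw [c2_abs μ hr]
  calc _ ≤ 2 * (r ^ (-1:ℝ) * Real.exp (-μ * r ^ 2)) * ((K * ∫ z, (1 + ‖z‖) * ‖θ z‖) * r ^ σ) := by
        gcongr; exact kA_cancel s0 s1 θ.integrable (schwartz_integrable_one_add θ) hz hK H x hr.le
    _ = _ := by
      rw [show σ - 1 = -1 + σ by ring, Real.rpow_add hr]; ring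

lemma R2_integrable (θ : 𝓢(E, F)) {μ : ℝ} (hμ : 0 < μ) {σ : ℝ} (s0 : 0 < σ) (s1 : σ < 1)
    (hz : ∫ z, θ z = 0) {h : E → ℝ} {K : ℝ}
    (hK : 0 ≤ K) (H : HolderLe σ univ h K) (x : E) :
    IntegrableOn (fun r => c2 μ r • kA θ h x r) (Ioi 0) :=
  kJ_integrable θ (H.continuous' s0) (fun x => H.1 x trivial) (c2_cont μ) x
    (R2_bd θ μ s0 s1 hz hK H x) (wt_int hμ (by linarith) _)

lemma R1_hasFDerivAt (γ : 𝓢(E, F)) {μ : ℝ} (hμ : 0 < μ) {σ : ℝ} (s0 : 0 < σ) (s1 : σ < 1)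
    {h : E → ℝ} {K : ℝ} (hK : 0 ≤ K) (H : HolderLe σ univ h K) (x : E) :
    HasFDerivAt (R1 μ γ h) (R2 μ γ h x) x := by
  set θ := fderivCLM ℝ E _ (fderivCLM ℝ E F γ) with hθ
  refine kJ_hasFDerivAt (fderivCLM ℝ E F γ) (H.continuous' s0) (fun x => H.1 x trivial) (c1_cont μ)
    (b := fun r => (K * ∫ z, (1 + ‖z‖) * ‖θ z‖) * r ^ σ)
    (fun x r hr => kA_cancel s0 s1 θ.integrable (schwartz_integrable_one_add θ)
      (integral_fderiv_zero _) hK H x hr.le) ?_ x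
      (R1_integrable _ hμ (H.continuous' s0) (fun x => H.1 x trivial) x)
  refine (wt_int hμ (s := σ - 1) (by linarith) (2 * (K * ∫ z, (1 + ‖z‖) * ‖θ z‖))).congr_fun
    (fun r hr => ?_) measurableSet_Ioi
  have hr : (0:ℝ) < r := hr
  simp only [c1_abs μ hr, Real.rpow_zero]
  rw [show σ - 1 = -1 + σ by ring, Real.rpow_add hr, Real.rpow_neg_one]; ring

lemma R2_bound (γ : 𝓢(E, F)) {μ : ℝ} (hμ : 0 < μ) {σ : ℝ} (s0 : 0 < σ) (s1 : σ < 1) :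
    ∃ C ≥ 0, ∀ (h : E → ℝ) (K : ℝ), 0 ≤ K → HolderLe σ univ h K → ∀ x, ‖R2 μ γ h x‖ ≤ C * K := by
  set θ := fderivCLM ℝ E _ (fderivCLM ℝ E F γ) with hθ
  refine ⟨2 * (∫ z, (1 + ‖z‖) * ‖θ z‖) * ∫ r in Ioi 0, (r ^ (σ - 1) * Real.exp (-μ * r ^ 2)), ?_,
    fun h M h0 H x => ?_⟩
  · have : 0 ≤ ∫ r in Ioi (0:ℝ), (r ^ (σ - 1) * Real.exp (-μ * r ^ 2)) :=
      setIntegral_nonneg measurableSet_Ioi fun r hr => by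
        have : (0:ℝ) < r := hr
        positivity
    have h2 : 0 ≤ ∫ z, (1 + ‖z‖) * ‖θ z‖ := integral_nonneg fun _ => by positivity
    positivity
  · have := norm_setIntegral_le (G := fun r => c2 μ r • kA θ h x r)
      (wt_int hμ (s := σ - 1) (by linarith) _)
      fun r hr => by rw [norm_smul]; exact R2_bd θ μ s0 s1 (integral_fderiv_zero _) h0 H x r hr
    refine this.trans (le_of_eq ?_)
    rw [integral_const_mul]; ring

lemma split_bound {σ : ℝ} (s0 : 0 < σ) (s1 : σ < 1) {G : ℝ → F} (hG : IntegrableOn G (Ioi 0))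
    {A d : ℝ} (hd : 0 < d) (h1 : ∀ r > 0, ‖G r‖ ≤ A * r ^ (σ - 1))
    (h2 : ∀ r > 0, ‖G r‖ ≤ A * d * r ^ (σ - 2)) :
    ‖∫ r in Ioi 0, G r‖ ≤ A * (1 / σ + 1 / (1 - σ)) * d ^ σ := by
  have hA : 0 ≤ A := by
    have := (norm_nonneg _).trans (h1 1 one_pos)
    simpa using this
  rw [← Ioc_union_Ioi_eq_Ioi hd.le, setIntegral_union (Ioc_disjoint_Ioi le_rfl) measurableSet_Ioi
    (hG.mono_set Ioc_subset_Ioi_self) (hG.mono_set (Ioi_subset_Ioi hd.le))]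
  have b1 : ‖∫ r in Ioc 0 d, G r‖ ≤ ∫ r in Ioc 0 d, A * r ^ (σ - 1) := by
    refine norm_integral_le_of_norm_le ?_ ((ae_restrict_mem measurableSet_Ioc).mono fun r hr => h1 r hr.1)
    refine Integrable.const_mul ?_ A
    have := intervalIntegral.intervalIntegrable_rpow' (a := 0) (b := d) (r := σ - 1) (by linarith)
    rwa [intervalIntegrable_iff_integrableOn_Ioc_of_le hd.le] at this
  have b2 : ‖∫ r in Ioi d, G r‖ ≤ ∫ r in Ioi d, A * d * r ^ (σ - 2) := by
    refine norm_integral_le_of_norm_le ?_ ((ae_restrict_mem measurableSet_Ioi).mono fun r hr => h2 r (hd.trans hr))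
    exact Integrable.const_mul (integrableOn_Ioi_rpow_of_lt (by linarith) hd) _
  rw [integral_const_mul, ← intervalIntegral.integral_of_le (f := fun r : ℝ => r ^ (σ - 1)) hd.le,
    integral_rpow (Or.inl (by linarith))] at b1
  rw [integral_const_mul, integral_Ioi_rpow_of_lt (by linarith) hd] at b2
  have e1 : σ - 1 + 1 = σ := by ring
  have e2 : σ - 2 + 1 = σ - 1 := by ring
  rw [e1, Real.zero_rpow s0.ne', sub_zero] at b1
  rw [e2] at b2
  have e3 : A * d * (-d ^ (σ - 1) / (σ - 1)) = A * (1 / (1 - σ)) * d ^ σ := by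
    have : d ^ σ = d * d ^ (σ - 1) := by
      rw [mul_comm, ← Real.rpow_add_one hd.ne']; simp
    rw [this]
    have h3 : σ - 1 ≠ 0 := by linarith
    have h4 : 1 - σ ≠ 0 := by linarith
    field_simp
    ring
  rw [e3] at b2
  calc _ ≤ _ := norm_add_le _ _
    _ ≤ _ := add_le_add b1 b2
    _ = _ := by ring

set_option maxHeartbeats 800000 in
lemma R2_holder (γ : 𝓢(E, F)) {μ : ℝ} (hμ : 0 < μ) {σ : ℝ} (s0 : 0 < σ) (s1 : σ < 1) :
    ∃ C ≥ 0, ∀ (h : E → ℝ) (K : ℝ), 0 ≤ K → HolderLe σ univ h K → ∀ x x',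
      ‖R2 μ γ h x - R2 μ γ h x'‖ ≤ C * K * dist x x' ^ σ := by
  set θ := fderivCLM ℝ E _ (fderivCLM ℝ E F γ) with hθ
  set I1 := ∫ z, (1 + ‖z‖) * ‖θ z‖ with hI1
  set I2 := ∫ z, (1 + ‖z‖) * ‖fderivCLM ℝ E _ θ z‖ with hI2
  have p1 : 0 ≤ I1 := integral_nonneg fun _ => by positivity
  have p2 : 0 ≤ I2 := integral_nonneg fun _ => by positivity
  have p3 : 0 ≤ 1 / σ + 1 / (1 - σ) := by
    have : 0 < 1 - σ := by linarith
    positivity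
  refine ⟨(4 * I1 + 2 * I2) * (1 / σ + 1 / (1 - σ)), by positivity, fun h K hK H x x' => ?_⟩
  rcases eq_or_ne x x' with rfl | hne
  · have e0 : ‖R2 μ γ h x - R2 μ γ h x‖ = 0 := by
      rw [sub_self]; exact ContinuousLinearMap.opNorm_zero
    rw [e0, dist_self, Real.zero_rpow s0.ne', mul_zero]
  have hd : 0 < dist x x' := dist_pos.2 hne
  have ib := fun x => R2_integrable θ hμ s0 s1 (integral_fderiv_zero _) hK H x
  have hc := H.continuous' s0
  have hM : ∀ x, |h x| ≤ K := fun x => H.1 x trivial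
  have hexp : ∀ r, Real.exp (-μ * r ^ 2) ≤ 1 := fun r => by
    rw [Real.exp_le_one_iff]; nlinarith [sq_nonneg r]
  rw [R2, R2, ← integral_sub (ib x) (ib x')]
  refine (split_bound s0 s1 ((ib x).sub (ib x')) (A := (4 * I1 + 2 * I2) * K) hd ?_ ?_).trans (le_of_eq (by ring))
  · intro r hr
    have a : ∀ x, ‖c2 μ r • kA θ h x r‖ ≤ (2 * (K * I1)) * r ^ (σ - 1) := fun x => by
      rw [norm_smul]
      refine (R2_bd θ μ s0 s1 (integral_fderiv_zero _) hK H x r hr).trans ?_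
      have : r ^ (σ - 1) * Real.exp (-μ * r ^ 2) ≤ r ^ (σ - 1) :=
        mul_le_of_le_one_right (by positivity) (hexp r)
      gcongr
    calc _ ≤ _ := norm_sub_le _ _
      _ ≤ _ := add_le_add (a x) (a x')
      _ = (4 * I1) * K * r ^ (σ - 1) := by ring
      _ ≤ _ := by gcongr; linarith
  · intro r hr
    have e := Convex.norm_image_sub_le_of_norm_hasFDerivWithin_le (𝕜 := ℝ) (s := univ) (x := x') (y := x)
      (C := r⁻¹ * ((K * I2) * r ^ σ))
      (f := fun x => kA θ h x r) (fun x _ => (kA_fderiv_x θ hc hM x hr).hasFDerivWithinAt)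
      (fun x _ => by
        rw [norm_smul, norm_neg, Real.norm_of_nonneg (inv_nonneg.2 hr.le)]
        gcongr
        exact kA_cancel s0 s1 (fderivCLM ℝ E _ θ).integrable (schwartz_integrable_one_add _)
          (integral_fderiv_zero _) hK H x hr.le) convex_univ trivial trivial
    rw [Pi.sub_apply, ← smul_sub, norm_smul, Real.norm_eq_abs, c2_abs μ hr]
    calc _ ≤ 2 * (r ^ (-1:ℝ) * 1) * (r⁻¹ * ((K * I2) * r ^ σ) * ‖x - x'‖) := by
          gcongr
          exact hexp r
      _ = (2 * I2) * K * dist x x' * r ^ (σ - 2) := by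
        rw [show σ - 2 = -1 + (-1 + σ) by ring, Real.rpow_add hr, Real.rpow_add hr, Real.rpow_neg_one,
          dist_eq_norm]
        ring
      _ ≤ _ := by gcongr; linarith

end Resolvent


section Resolvent2
open MeasureTheory Topology SchwartzMap Module

lemma HolderLe.mono {X Y : Type*} [PseudoMetricSpace X] [NormedAddCommGroup Y]
    {σ : ℝ} {s : Set X} {h : X → Y} {K K' : ℝ} (H : HolderLe σ s h K) (hK : K ≤ K') : HolderLe σ s h K' :=
  ⟨fun x hx => (H.1 x hx).trans hK, fun x hx y hy => (H.2 x hx y hy).trans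
    (mul_le_mul_of_nonneg_right hK (Real.rpow_nonneg dist_nonneg _))⟩

lemma holder_of_lip {X Y : Type*} [PseudoMetricSpace X] [NormedAddCommGroup Y]
    {σ : ℝ} (s0 : 0 < σ) (s1 : σ < 1) {s : Set X} {u : X → Y} {A B : ℝ} (hB : 0 ≤ B)
    (hA : ∀ x ∈ s, ‖u x‖ ≤ A) (hL : ∀ x ∈ s, ∀ y ∈ s, ‖u x - u y‖ ≤ B * dist x y) :
    HolderLe σ s u (2 * A + B) := by
  refine ⟨fun x hx => ?_, fun x hx y hy => ?_⟩
  · have := hA x hx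
    have := norm_nonneg (u x)
    linarith
  · have a0 : 0 ≤ A := (norm_nonneg _).trans (hA x hx)
    rcases le_total (dist x y) 1 with h | h
    · have : dist x y ≤ dist x y ^ σ := by
        rcases eq_or_lt_of_le (dist_nonneg (x := x) (y := y)) with h0 | h0
        · rw [← h0, Real.zero_rpow s0.ne']
        · calc dist x y = dist x y ^ (1:ℝ) := (Real.rpow_one _).symm
            _ ≤ _ := Real.rpow_le_rpow_of_exponent_ge h0 h s1.le
      calc _ ≤ B * dist x y := hL x hx y hy
        _ ≤ B * dist x y ^ σ := by gcongr
        _ ≤ _ := by gcongr; linarith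
    · have : 1 ≤ dist x y ^ σ := Real.one_le_rpow h s0.le
      calc _ ≤ ‖u x‖ + ‖u y‖ := norm_sub_le _ _
        _ ≤ (2 * A + B) * 1 := by linarith [hA x hx, hA y hy]
        _ ≤ _ := by gcongr

lemma holder_of_fderiv {X Y : Type*} [NormedAddCommGroup X] [NormedSpace ℝ X] [NormedAddCommGroup Y]
    [NormedSpace ℝ Y]
    {σ : ℝ} (s0 : 0 < σ) (s1 : σ < 1) {u : X → Y} {u' : X → X →L[ℝ] Y} {A B : ℝ}
    (hA : ∀ x, ‖u x‖ ≤ A) (hd : ∀ x, HasFDerivAt u (u' x) x) (hB : ∀ x, ‖u' x‖ ≤ B) :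
    HolderLe σ univ u (2 * A + B) := by
  have hB0 : 0 ≤ B := (norm_nonneg _).trans (hB 0)
  refine holder_of_lip s0 s1 hB0 (fun x _ => hA x) fun x _ y _ => ?_
  rw [dist_eq_norm]
  exact Convex.norm_image_sub_le_of_norm_hasFDerivWithin_le (𝕜 := ℝ) (s := univ) (x := y) (y := x)
    (fun x _ => (hd x).hasFDerivWithinAt) (fun x _ => hB x) convex_univ trivial trivial

variable {m : ℕ}

noncomputable def Rg (m : ℕ) (μ : ℝ) (h : XX m → ℝ) : XX m → ℝ := R0 μ (gaussS m) h
noncomputable def Rg1 (m : ℕ) (μ : ℝ) (h : XX m → ℝ) : XX m → XX m →L[ℝ] ℝ := R1 μ (gaussS m) h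
noncomputable def Rg2 (m : ℕ) (μ : ℝ) (h : XX m → ℝ) : XX m → XX m →L[ℝ] XX m →L[ℝ] ℝ :=
  R2 μ (gaussS m) h

lemma Rg_hasFDerivAt {μ : ℝ} (hμ : 0 < μ) {h : XX m → ℝ} (hc : Continuous h) {M : ℝ}
    (hM : ∀ x, |h x| ≤ M) (x : XX m) : HasFDerivAt (Rg m μ h) (Rg1 m μ h x) x :=
  R0_hasFDerivAt _ hμ hc hM x

lemma Rg1_hasFDerivAt {μ : ℝ} (hμ : 0 < μ) {σ : ℝ} (s0 : 0 < σ) (s1 : σ < 1)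
    {h : XX m → ℝ} {K : ℝ} (hK : 0 ≤ K) (H : HolderLe σ univ h K) (x : XX m) :
    HasFDerivAt (Rg1 m μ h) (Rg2 m μ h x) x := R1_hasFDerivAt _ hμ s0 s1 hK H x

lemma Rg_bd_holder (m : ℕ) {μ : ℝ} (hμ : 0 < μ) {σ : ℝ} (s0 : 0 < σ) (s1 : σ < 1) :
    ∃ C ≥ 0, ∀ (h : XX m → ℝ) (M : ℝ), 0 ≤ M → Continuous h → (∀ x, |h x| ≤ M) →
      HolderLe σ univ (Rg m μ h) (C * M) := by
  obtain ⟨A, hA, hA'⟩ := R0_bound (gaussS m) hμ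
  obtain ⟨B, hB, hB'⟩ := R1_bound (gaussS m) hμ
  refine ⟨2 * A + B, by positivity, fun h M h0 hc hM => ?_⟩
  have := holder_of_fderiv s0 s1 (hA' h M h0 hM) (Rg_hasFDerivAt hμ hc hM) (hB' h M h0 hM)
  exact this.mono (le_of_eq (by ring))

lemma Rg_holder (m : ℕ) {μ : ℝ} (hμ : 0 < μ) {σ : ℝ} (s0 : 0 < σ) (s1 : σ < 1) :
    ∃ C ≥ 0, ∀ (h : XX m → ℝ) (K : ℝ), 0 ≤ K → HolderLe σ univ h K →
      HolderLe σ univ (Rg m μ h) (C * K) ∧ HolderLe σ univ (Rg1 m μ h) (C * K) ∧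
      HolderLe σ univ (Rg2 m μ h) (C * K) := by
  obtain ⟨A, hA, hA'⟩ := Rg_bd_holder m hμ s0 s1
  obtain ⟨B, hB, hB'⟩ := R1_bound (gaussS m) hμ
  obtain ⟨D, hD, hD'⟩ := R2_bound (gaussS m) hμ s0 s1
  obtain ⟨G, hG, hG'⟩ := R2_holder (gaussS m) hμ s0 s1
  refine ⟨A + (2 * B + D) + (D + G), by positivity, fun h K hK H => ⟨?_, ?_, ?_, ?_⟩⟩
  · refine (hA' h K hK (H.continuous' s0) (fun x => H.1 x trivial)).mono ?_
    gcongr; linarith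
  · have := holder_of_fderiv s0 s1 (hB' h K hK (fun x => H.1 x trivial)) (Rg1_hasFDerivAt hμ s0 s1 hK H)
      (hD' h K hK H)
    refine this.mono ?_
    nlinarith [mul_nonneg hA hK, mul_nonneg hD hK, mul_nonneg hG hK]
  · intro x _
    refine (hD' h K hK H x).trans ?_
    gcongr; linarith
  · intro x _ y _
    refine (hG' h K hK H x y).trans ?_
    gcongr; linarith

lemma Rg_eq {μ : ℝ} (hμ : 0 < μ) {σ : ℝ} (s0 : 0 < σ) (s1 : σ < 1)
    {h : XX m → ℝ} {K : ℝ} (hK : 0 ≤ K) (H : HolderLe σ univ h K) (x : XX m) :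
    μ * Rg m μ h x - trX m (Rg2 m μ h x) = h x := by
  have hc := H.continuous' s0
  have hM : ∀ x, |h x| ≤ K := fun x => H.1 x trivial
  set γ := gaussS m
  set θ := fderivCLM ℝ (XX m) _ (fderivCLM ℝ (XX m) ℝ γ) with hθ
  have i2 := R2_integrable θ hμ s0 s1 (integral_fderiv_zero _) hK H x
  have i0 := R0_integrable γ hμ hc hM x
  have e2 : trX m (Rg2 m μ h x) = ∫ r in Ioi 0, c2 μ r * kA (fun z => trX m (θ z)) h x r := by
    rw [Rg2, R2, ← (trX m).integral_comp_comm i2]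
    refine integral_congr_ae (ae_of_all _ fun r => ?_)
    show trX m (c2 μ r • kA θ h x r) = c2 μ r * kA (fun z => trX m (θ z)) h x r
    rw [map_smul, kA_clm (trX m) θ.integrable hc hM x r, smul_eq_mul]
  have i2' : IntegrableOn (fun r => c2 μ r * kA (fun z => trX m (θ z)) h x r) (Ioi 0) := by
    refine ((trX m).integrable_comp i2).congr (ae_of_all _ fun r => ?_)
    show trX m (c2 μ r • kA θ h x r) = c2 μ r * kA (fun z => trX m (θ z)) h x r
    rw [map_smul, kA_clm (trX m) θ.integrable hc hM x r, smul_eq_mul]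
  have hd : ∀ r ∈ Ioi (0:ℝ), HasDerivAt (fun r => Real.exp (-μ * r ^ 2) * kA γ h x r)
      (c2 μ r * kA (fun z => trX m (θ z)) h x r - μ * (c0 μ r • kA γ h x r)) r := by
    intro r hr
    have hr : 0 < r := hr
    have a1 := kA_deriv_r γ hc hM x hr
    have a2 : (fun z => (finrank ℝ (XX m) : ℝ) • γ z + fderiv ℝ γ z z) =
      fun z => (-2 : ℝ) • trX m (θ z) := funext fun z => gaussS_trace m z
    have a3 : kA (fun z => (-2 : ℝ) • trX m (θ z)) h x r = -2 * kA (fun z => trX m (θ z)) h x r := by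
      simp only [kA]
      rw [← integral_const_mul]
      congr 1; funext z; simp only [smul_eq_mul]; ring
    rw [a2, a3] at a1
    have a4 : HasDerivAt (fun r => Real.exp (-μ * r ^ 2)) (Real.exp (-μ * r ^ 2) * (-μ * (2 * r))) r := by
      have := ((hasDerivAt_pow 2 r).const_mul (-μ)).exp
      simpa using this
    refine (a4.mul a1).congr_deriv ?_
    simp only [c2, c1, c0, smul_eq_mul]
    field_simp
    ring
  have hint : IntegrableOn (fun r => c2 μ r * kA (fun z => trX m (θ z)) h x r - μ * (c0 μ r • kA γ h x r)) (Ioi 0) :=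
    i2'.sub (i0.const_mul μ)
  have hcont : ContinuousWithinAt (fun r => Real.exp (-μ * r ^ 2) * kA γ h x r) (Ici 0) 0 := by
    have : Continuous (fun r => Real.exp (-μ * r ^ 2) * kA γ h x r) :=
      (by fun_prop : Continuous fun r : ℝ => Real.exp (-μ * r ^ 2)).mul (kA_cont_zero γ.integrable hc hM x)
    exact this.continuousWithinAt
  have hlim : Tendsto (fun r => Real.exp (-μ * r ^ 2) * kA γ h x r) atTop (𝓝 0) := by
    have b1 : Tendsto (fun r : ℝ => Real.exp (-μ * r ^ 2)) atTop (𝓝 0) := by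
      refine Real.tendsto_exp_atBot.comp ?_
      exact (tendsto_pow_atTop (two_ne_zero)).const_mul_atTop_of_neg (by linarith)
    refine squeeze_zero_norm (a := fun r => Real.exp (-μ * r ^ 2) * (K * ∫ z, ‖γ z‖)) (fun r => ?_) (by simpa using b1.mul_const _)
    rw [norm_mul, Real.norm_of_nonneg (Real.exp_nonneg _)]
    gcongr
    exact kA_bound γ.integrable hM x r
  have key := integral_Ioi_of_hasDerivAt_of_tendsto hcont hd hint hlim
  have e3 : ∫ r in Ioi 0, (c2 μ r * kA (fun z => trX m (θ z)) h x r - μ * (c0 μ r • kA γ h x r)) =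
     trX m (Rg2 m μ h x) - μ * Rg m μ h x := by
    rw [e2, integral_sub i2' (i0.const_mul μ), integral_const_mul]; rfl
  rw [e3] at key
  have e4 : kA γ h x 0 = h x := by
    simp only [kA, zero_smul, add_zero]
    rw [integral_smul, gaussS_integral, smul_eq_mul, mul_one]
  rw [e4] at key
  simp at key
  linarith

lemma Rg_nonneg {μ : ℝ} {h : XX m → ℝ} (hh : ∀ x, 0 ≤ h x) (x : XX m) : 0 ≤ Rg m μ h x := by
  refine setIntegral_nonneg measurableSet_Ioi fun r hr => ?_
  have hr : (0:ℝ) < r := hr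
  refine mul_nonneg (by unfold c0; positivity) (integral_nonneg fun z => ?_)
  exact mul_nonneg (hh _) (gaussS_nonneg m z)

lemma kA_add {E F : Type*} [NormedAddCommGroup E] [NormedSpace ℝ E] [FiniteDimensional ℝ E]
    [MeasureSpace E] [BorelSpace E] [(volume : Measure E).IsAddHaarMeasure]
    [NormedAddCommGroup F] [NormedSpace ℝ F] {θ : E → F} (hθ : Integrable θ) {h h' : E → ℝ} (hc : Continuous h) {M : ℝ}
    (hM : ∀ x, |h x| ≤ M) (hc' : Continuous h') {M' : ℝ}
    (hM' : ∀ x, |h' x| ≤ M') (x : E) (r : ℝ) :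
    kA θ (fun x => h x + h' x) x r = kA θ h x r + kA θ h' x r := by
  simp only [kA, add_smul]
  exact integral_add (kA_integrable hθ hc hM x r) (kA_integrable hθ hc' hM' x r)

lemma kA_smul {E F : Type*} [NormedAddCommGroup E] [NormedSpace ℝ E]
    [MeasureSpace E]
    [NormedAddCommGroup F] [NormedSpace ℝ F] {θ : E → F} {h : E → ℝ} (a : ℝ) (x : E) (r : ℝ) :
    kA θ (fun x => a * h x) x r = a • kA θ h x r := by
  simp only [kA, mul_smul]
  exact integral_smul _ _

lemma Rg_add {μ : ℝ} (hμ : 0 < μ) {h h' : XX m → ℝ} (hc : Continuous h) {M : ℝ}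
    (hM : ∀ x, |h x| ≤ M) (hc' : Continuous h') {M' : ℝ}
    (hM' : ∀ x, |h' x| ≤ M') (x : XX m) :
    Rg m μ (fun x => h x + h' x) x = Rg m μ h x + Rg m μ h' x := by
  simp only [Rg, R0, kA_add (gaussS m).integrable hc hM hc' hM', smul_add]
  exact integral_add (R0_integrable _ hμ hc hM x) (R0_integrable _ hμ hc' hM' x)

lemma Rg_smul {μ : ℝ} (h : XX m → ℝ) (a : ℝ) (x : XX m) :
    Rg m μ (fun x => a * h x) x = a * Rg m μ h x := by
  simp only [Rg, R0, kA_smul, ← integral_const_mul]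
  congr 1; funext r; simp only [smul_eq_mul]; ring

lemma Rg_one {μ : ℝ} (hμ : 0 < μ) (x : XX m) : Rg m μ (fun _ => 1) x = 1 / μ := by
  have H : HolderLe (1/2) univ (fun _ : XX m => (1:ℝ)) 1 :=
    ⟨fun _ _ => by simp, fun x _ y _ => by simp; positivity⟩
  have h1 := Rg_eq hμ (by norm_num) (by norm_num) zero_le_one H x
  have h2 : Rg2 m μ (fun _ => 1) x = 0 := by
    rw [Rg2, R2]
    have : ∀ r, kA (fderivCLM ℝ (XX m) _ (fderivCLM ℝ (XX m) ℝ (gaussS m))) (fun _ => 1) x r = 0 := by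
      intro r
      simp only [kA, one_smul]
      exact integral_fderiv_zero _
    simp only [this, smul_zero]
    exact integral_zero _ _
  rw [h2, map_zero, sub_zero] at h1
  field_simp
  linarith

lemma Rg_mono {μ : ℝ} (hμ : 0 < μ) {h h' : XX m → ℝ} (hc : Continuous h) {M : ℝ}
    (hM : ∀ x, |h x| ≤ M) (hc' : Continuous h') {M' : ℝ}
    (hM' : ∀ x, |h' x| ≤ M') (hle : ∀ x, h x ≤ h' x) (x : XX m) : Rg m μ h x ≤ Rg m μ h' x := by
  have h1 := Rg_add hμ hc' hM' (h' := fun x => (-1) * h x) (by fun_prop) (M' := M) (by simpa using hM) x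
  rw [Rg_smul] at h1
  have h2 := Rg_nonneg (m := m) (μ := μ) (h := fun x => h' x + (-1) * h x) (fun x => by linarith [hle x]) x
  linarith

lemma Rg_reflect {μ : ℝ} {h h' : XX m → ℝ} (hh : ∀ y t, h (y, -t) = h' (y, t)) (y t) :
    Rg m μ h (y, -t) = Rg m μ h' (y, t) := by
  simp only [Rg, R0]
  congr 1; funext r; congr 1
  have mp : MeasurePreserving (Prod.map id Neg.neg : XX m → XX m) volume volume :=
    (MeasurePreserving.id volume).prod (Measure.measurePreserving_neg volume)
  have me : MeasurableEmbedding (Prod.map id Neg.neg : XX m → XX m) :=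
    ((MeasurableEquiv.refl _).prodCongr (MeasurableEquiv.neg ℝ)).measurableEmbedding
  rw [kA, ← mp.integral_comp me, kA]
  congr 1; funext z
  obtain ⟨z1, z2⟩ := z
  have e1 : ((y, -t) : XX m) + r • (Prod.map id Neg.neg (z1, z2)) = (y + r • z1, -(t + r • z2)) := by
    simp; ring
  have e2 : gaussS m (Prod.map id Neg.neg (z1, z2)) = gaussS m (z1, z2) := by
    simp [gaussS_apply, gauss0_eq]
  rw [e1, hh, e2]
  rfl

set_option maxHeartbeats 400000 in
lemma Rg_dir {μ : ℝ} (hμ : 0 < μ) {h h' : XX m → ℝ} (hc : Continuous h) {M : ℝ}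
    (hM : ∀ x, |h x| ≤ M) (hc' : Continuous h') {M' : ℝ}
    (hM' : ∀ x, |h' x| ≤ M') (e : XX m)
    (hd : ∀ x, HasDerivAt (fun s : ℝ => h (x + s • e)) (h' x) 0) (x : XX m) :
    Rg1 m μ h x e = Rg m μ h' x := by
  have hd' : ∀ x s0, HasDerivAt (fun s : ℝ => h (x + s • e)) (h' (x + s0 • e)) s0 := by
    intro x s0
    have h1 := hd (x + s0 • e)
    have h2 := HasDerivAt.comp_sub_const (x := s0) (a := s0) (f := fun s : ℝ => h (x + s0 • e + s • e))
      (f' := h' (x + s0 • e)) (by simpa using h1)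
    refine h2.congr_of_eventuallyEq (Eventually.of_forall fun s => ?_)
    show h _ = h _
    congr 1; module
  set γ := gaussS m
  have k1 : ∀ x r s0, HasDerivAt (fun s : ℝ => kA γ h (x + s • e) r) (kA γ h' (x + s0 • e) r) s0 := by
    intro x r s0
    refine (hasDerivAt_integral_of_dominated_loc_of_deriv_le (s := univ) (bound := fun z => M' * ‖γ z‖)
      (F' := fun s z => h' (x + s • e + r • z) • γ z) univ_mem
      (Eventually.of_forall fun s => (kA_integrable γ.integrable hc hM _ r).1)
      (kA_integrable γ.integrable hc hM _ r) (kA_integrable γ.integrable hc' hM' _ r).1 ?_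
      (γ.integrable.norm.const_mul _) ?_).2
    · refine ae_of_all _ fun z s _ => ?_
      rw [norm_smul]; exact mul_le_mul_of_nonneg_right (hM' _) (norm_nonneg _)
    · refine ae_of_all _ fun z s _ => ?_
      have := (hd' (x + r • z) s).smul_const (γ z)
      simp only [show ∀ s : ℝ, x + s • e + r • z = x + r • z + s • e from fun s => by abel]
      exact this
  have k2 : HasDerivAt (fun s : ℝ => Rg m μ h (x + s • e)) (Rg m μ h' (x + (0:ℝ) • e)) 0 := by
    refine (hasDerivAt_integral_of_dominated_loc_of_deriv_le (s := univ)
      (bound := fun r => (2 * (M' * ∫ z, ‖γ z‖)) * (r ^ (1:ℝ) * Real.exp (-μ * r ^ 2)))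
      (μ := volume.restrict (Ioi 0)) (F := fun s r => c0 μ r • kA γ h (x + s • e) r)
      (F' := fun s r => c0 μ r • kA γ h' (x + s • e) r) univ_mem
      (Eventually.of_forall fun s => (R0_integrable γ hμ hc hM (x + s • e)).1)
      (R0_integrable γ hμ hc hM (x + (0:ℝ) • e)) (R0_integrable γ hμ hc' hM' (x + (0:ℝ) • e)).1 ?_
      (wt_int hμ (by norm_num) (2 * (M' * ∫ z, ‖γ z‖))) ?_).2
    · refine (ae_restrict_mem measurableSet_Ioi).mono fun r hr s _ => ?_
      rw [norm_smul]; exact R0_bd γ μ hM' _ r hr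
    · refine ae_of_all _ fun r s _ => ?_
      exact (k1 x r s).const_smul (c0 μ r)
  have k3 : HasDerivAt (fun s : ℝ => Rg m μ h (x + s • e)) (Rg1 m μ h x e) 0 := by
    have h1 : HasDerivAt (fun s : ℝ => x + s • e) e 0 := by
      simpa using ((hasDerivAt_id (0:ℝ)).smul_const e).const_add x
    have h2 : HasFDerivAt (Rg m μ h) (Rg1 m μ h x) (x + (0:ℝ) • e) := by
      simpa using Rg_hasFDerivAt hμ hc hM x
    exact h2.comp_hasDerivAt (0:ℝ) h1
  have := k3.unique k2
  simpa using this

/-- a function of `t` only is reproduced by the resolvent -/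
lemma Rg_repr {μ : ℝ} (hμ : 0 < μ) {p p1 p2 : ℝ → ℝ} {M : ℝ}
    (hd : ∀ t, HasDerivAt p (p1 t) t) (hd1 : ∀ t, HasDerivAt p1 (p2 t) t) (hc2 : Continuous p2)
    (hp : ∀ t, |p t| ≤ M) (hp1 : ∀ t, |p1 t| ≤ M) (hp2 : ∀ t, |p2 t| ≤ M) (x : XX m) :
    Rg m μ (fun x => μ * p x.2 - p2 x.2) x = p x.2 := by
  have hM : 0 ≤ M := (abs_nonneg _).trans (hp 0)
  have hc : Continuous p := continuous_iff_continuousAt.2 fun t => (hd t).continuousAt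
  have hc1 : Continuous p1 := continuous_iff_continuousAt.2 fun t => (hd1 t).continuousAt
  have lip : ∀ {q q1 : ℝ → ℝ}, (∀ t, HasDerivAt q (q1 t) t) → (∀ t, |q t| ≤ M) → (∀ t, |q1 t| ≤ M) →
      HolderLe (1/2) univ (fun x : XX m => q x.2) (2 * M + M) := by
    intro q q1 h1 h2 h3
    refine holder_of_lip (by norm_num) (by norm_num) hM (fun x _ => h2 _) fun x _ y _ => ?_
    have := Convex.norm_image_sub_le_of_norm_hasDerivWithin_le (s := univ) (x := y.2) (y := x.2)
      (fun t _ => (h1 t).hasDerivWithinAt) (fun t _ => h3 t) convex_univ trivial trivial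
    refine this.trans ?_
    gcongr
    rw [dist_eq_norm]
    exact norm_snd_le (x - y)
  have H := lip hd hp hp1
  have H1 := lip hd1 hp1 hp2
  have hdir : ∀ {q q1 : ℝ → ℝ}, (∀ t, HasDerivAt q (q1 t) t) → ∀ (e x : XX m),
      HasDerivAt (fun s : ℝ => q (x + s • e).2) (e.2 * q1 x.2) 0 := by
    intro q q1 h1 e x
    have a1 : HasDerivAt (fun s : ℝ => x.2 + s * e.2) e.2 0 := by
      simpa using ((hasDerivAt_id (0:ℝ)).mul_const e.2).const_add x.2
    have a2 : HasDerivAt q (q1 x.2) (x.2 + 0 * e.2) := by simpa using h1 x.2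
    have a3 := a2.comp (0:ℝ) a1
    rw [mul_comm] at a3
    exact a3
  have cc : ∀ {q : ℝ → ℝ}, Continuous q → Continuous (fun x : XX m => q x.2) := fun h => h.comp continuous_snd
  have r1 : ∀ e x, Rg1 m μ (fun x => p x.2) x e = e.2 * Rg m μ (fun x => p1 x.2) x := by
    intro e x
    rw [← Rg_smul]
    refine Rg_dir hμ (cc hc) (fun x => hp _) (M' := |e.2| * M) (by fun_prop) (fun x => ?_) e (hdir hd e) x
    rw [abs_mul]; gcongr; exact hp1 _
  have r2 : ∀ e x, Rg1 m μ (fun x => p1 x.2) x e = e.2 * Rg m μ (fun x => p2 x.2) x := by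
    intro e x
    rw [← Rg_smul]
    refine Rg_dir hμ (cc hc1) (fun x => hp1 _) (M' := |e.2| * M) (by fun_prop) (fun x => ?_) e (hdir hd1 e) x
    rw [abs_mul]; gcongr; exact hp2 _
  have r3 : ∀ e' e, Rg2 m μ (fun x => p x.2) x e' e = e.2 * (e'.2 * Rg m μ (fun x => p2 x.2) x) := by
    intro e' e
    have a1 := (Rg1_hasFDerivAt hμ (by norm_num) (by norm_num) (by positivity) H x).clm_apply (hasFDerivAt_const e x)
    have a2 : (fun x => Rg1 m μ (fun x => p x.2) x e) = fun x => e.2 * Rg m μ (fun x => p1 x.2) x :=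
      funext fun x => r1 e x
    rw [a2] at a1
    have a3 := (Rg_hasFDerivAt hμ (cc hc1) (fun x => hp1 _) x).const_mul e.2
    have a4 := congrArg (fun L => L e') (a1.unique a3)
    simp at a4
    rw [a4, r2]
  have key := Rg_eq hμ (by norm_num) (by norm_num) (by positivity) H x
  rw [trX_apply] at key
  simp only [r3] at key
  simp at key
  have e : (fun x : XX m => μ * p x.2 - p2 x.2) = fun x => μ * p x.2 + (-1) * p2 x.2 := by
    funext x; ring
  rw [e, Rg_add hμ (M := |μ| * M) (M' := M) (by fun_prop) (fun x => by rw [abs_mul]; gcongr; exact hp _) (by fun_prop)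
    (fun x => by simpa using hp2 _), Rg_smul, Rg_smul]
  linarith

end Resolvent2


section Profile
open Topology

/-- Everything used about the heteroclinic, extended to the whole line. -/
structure Prof where
  W : ℝ → ℝ
  om : ℝ → ℝ
  Fo : ℝ → ℝ
  v : ℝ → ℝ
  dv : ℝ → ℝ
  c : ℝ
  ε : ℝ
  hW : ∀ t, HasDerivAt W (om t) t
  hom : ∀ t, HasDerivAt om (-Fo t) t
  hFo : ∀ t, HasDerivAt Fo (v t * om t) t
  om_pos : ∀ t, 0 < om t
  om_even : ∀ t, om (-t) = om t
  W_odd : ∀ t, W (-t) = -W t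
  Fo_odd : ∀ t, Fo (-t) = -Fo t
  v_even : ∀ t, v (-t) = v t
  dv_even : ∀ t, dv (-t) = dv t
  hv : ∀ t, 0 ≤ t → HasDerivWithinAt v (dv t) (Ici 0) t
  v_lip : ∀ s t, |v s - v t| ≤ c * |s - t|
  dv_lip : ∀ s t, |dv s - dv t| ≤ c * |s - t|
  v_bd : ∀ t, |v t| ≤ c
  dv_bd : ∀ t, |dv t| ≤ c
  om_bd : ∀ t, om t ≤ c
  Fo_bd : ∀ t, |Fo t| ≤ c * om t
  W_bd : ∀ t, |W t| < 1
  W_om : ∀ t, 1 - |W t| ≤ c * om t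
  W_lim : Tendsto W atTop (𝓝 1)
  eps_pos : 0 < ε
  eps_le : ∀ t, ε ≤ om t + W t * Fo t / om t

noncomputable def oddExt (a : ℝ → ℝ) (t : ℝ) : ℝ := if 0 ≤ t then a t else -a (-t)
def evenExt (a : ℝ → ℝ) (t : ℝ) : ℝ := a |t|

lemma oddExt_nonneg (a : ℝ → ℝ) {t : ℝ} (h : 0 ≤ t) : oddExt a t = a t := if_pos h
lemma oddExt_nonpos {a : ℝ → ℝ} (h0 : a 0 = 0) {t : ℝ} (h : t ≤ 0) : oddExt a t = -a (-t) := by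
  rcases eq_or_lt_of_le h with rfl | h
  · simp [oddExt, h0]
  · exact if_neg (not_le.2 h)
lemma oddExt_odd {a : ℝ → ℝ} (h0 : a 0 = 0) (t : ℝ) : oddExt a (-t) = -oddExt a t := by
  rcases le_total 0 t with h | h
  · rw [oddExt_nonneg a h, oddExt_nonpos h0 (by linarith), neg_neg]
  · rw [oddExt_nonneg a (by linarith : 0 ≤ -t), oddExt_nonpos h0 h, neg_neg]

lemma glue {a : ℝ → ℝ} {a' t : ℝ} (h1 : 0 ≤ t → HasDerivWithinAt a a' (Ici 0) t)
    (h2 : t ≤ 0 → HasDerivWithinAt a a' (Iic 0) t) : HasDerivAt a a' t := by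
  rcases lt_trichotomy t 0 with h | h | h
  · exact (h2 h.le).hasDerivAt (Iic_mem_nhds h)
  · have := (h2 h.le).union (h1 h.ge)
    rwa [Iic_union_Ici, hasDerivWithinAt_univ] at this
  · exact (h1 h.le).hasDerivAt (Ici_mem_nhds h)

lemma refl_deriv {a a1 : ℝ → ℝ} (h : ∀ t, 0 ≤ t → HasDerivWithinAt a (a1 t) (Ici 0) t) {t : ℝ} (ht : t ≤ 0) :
    HasDerivWithinAt (fun s => a (-s)) (-a1 (-t)) (Iic 0) t := by
  have := HasDerivWithinAt.comp (h₂ := a) (h := fun s : ℝ => -s) t (h (-t) (by linarith))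
    ((hasDerivAt_neg t).hasDerivWithinAt (s := Iic 0)) (fun s hs => by simpa using hs)
  exact this.congr_deriv (by ring)

lemma oddExt_deriv {a a1 : ℝ → ℝ} (h0 : a 0 = 0)
    (h : ∀ t, 0 ≤ t → HasDerivWithinAt a (a1 t) (Ici 0) t) (t : ℝ) :
    HasDerivAt (oddExt a) (evenExt a1 t) t := by
  refine glue (fun ht => ?_) (fun ht => ?_)
  · rw [evenExt, abs_of_nonneg ht]
    exact (h t ht).congr (fun s hs => oddExt_nonneg a hs) (oddExt_nonneg a ht)
  · rw [evenExt, abs_of_nonpos ht]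
    have := (refl_deriv h ht).neg
    rw [neg_neg] at this
    exact this.congr (fun s hs => oddExt_nonpos h0 hs) (oddExt_nonpos h0 ht)

lemma evenExt_deriv {a a1 : ℝ → ℝ} (h0 : a1 0 = 0)
    (h : ∀ t, 0 ≤ t → HasDerivWithinAt a (a1 t) (Ici 0) t) (t : ℝ) :
    HasDerivAt (evenExt a) (oddExt a1 t) t := by
  refine glue (fun ht => ?_) (fun ht => ?_)
  · rw [oddExt_nonneg a1 ht]
    exact (h t ht).congr (fun s hs => by rw [evenExt, abs_of_nonneg hs]) (by rw [evenExt, abs_of_nonneg ht])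
  · rw [oddExt_nonpos h0 ht]
    exact (refl_deriv h ht).congr (fun s hs => by rw [evenExt, abs_of_nonpos hs]) (by rw [evenExt, abs_of_nonpos ht])

lemma evenExt_lip {a a1 : ℝ → ℝ} {c : ℝ}
    (h : ∀ t, 0 ≤ t → HasDerivWithinAt a (a1 t) (Ici 0) t) (hb : ∀ t, 0 ≤ t → |a1 t| ≤ c) (s t : ℝ) :
    |evenExt a s - evenExt a t| ≤ c * |s - t| := by
  have := Convex.norm_image_sub_le_of_norm_hasDerivWithin_le (s := Ici (0:ℝ)) (x := |t|) (y := |s|)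
      (fun t ht => h t ht) (fun t ht => hb t ht) (convex_Ici 0) (mem_Ici.2 (abs_nonneg t)) (mem_Ici.2 (abs_nonneg s))
  refine this.trans ?_
  have hc : 0 ≤ c := (abs_nonneg _).trans (hb 0 le_rfl)
  gcongr
  exact abs_abs_sub_abs_le _ _

lemma bound_unit {g : ℝ → ℝ} (hg : Continuous g) : ∃ M ≥ 0, ∀ s ∈ Icc (0:ℝ) 1, |g s| ≤ M := by
  obtain ⟨M, hM⟩ := isCompact_Icc.exists_bound_of_continuousOn (s := Icc (0:ℝ) 1) hg.continuousOn
  exact ⟨|M|, abs_nonneg _, fun s hs => (hM s hs).trans (le_abs_self _)⟩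

lemma prof_basic {f w : ℝ → ℝ} (hf : Monostable f) (hw : IsHeteroclinic f w) :
    (∀ t, 0 ≤ t → HasDerivWithinAt w (derivWithin w (Ici 0) t) (Ici 0) t) ∧
    (∀ t, 0 ≤ t → HasDerivWithinAt (derivWithin w (Ici 0)) (-f (w t)) (Ici 0) t) ∧
    (∀ t, 0 ≤ t → 0 ≤ w t ∧ w t < 1) := by
  obtain ⟨hc, heq, hw0, hlim, hpos, hmono, hder⟩ := hw
  have hu := uniqueDiffOn_Ici (0:ℝ)
  have hd : ∀ t, 0 ≤ t → HasDerivWithinAt w (derivWithin w (Ici 0) t) (Ici 0) t := fun t ht =>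
    ((hc.differentiableOn (by norm_num)) t ht).hasDerivWithinAt
  have hc1 : ContDiffOn ℝ 1 (derivWithin w (Ici 0)) (Ici 0) :=
    ((contDiffOn_succ_iff_derivWithin (n := 1) hu).1 (by rw [show (1:WithTop ℕ∞) + 1 = 2 from one_add_one_eq_two]; exact hc)).2.2
  have hc2 : ContinuousOn (derivWithin (derivWithin w (Ici 0)) (Ici 0)) (Ici 0) :=
    hc1.continuousOn_derivWithin hu le_rfl
  have hwc : ContinuousOn w (Ici 0) := hc.continuousOn
  have hfc : ContinuousOn (fun t => -f (w t)) (Ici 0) := (hf.1.continuous.comp_continuousOn hwc).neg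
  have heq' : EqOn (derivWithin (derivWithin w (Ici 0)) (Ici 0)) (fun t => -f (w t)) (Ici 0) := by
    have h1 : EqOn (derivWithin (derivWithin w (Ici 0)) (Ici 0)) (fun t => -f (w t)) (Ioi 0) :=
      fun t ht => by have := heq t ht; simp only; linarith
    refine h1.of_subset_closure hc2 hfc Ioi_subset_Ici_self ?_
    rw [closure_Ioi]
  refine ⟨hd, fun t ht => ?_, fun t ht => ⟨?_, ?_⟩⟩
  · have := ((hc1.differentiableOn (by norm_num)) t ht).hasDerivWithinAt
    rwa [heq' ht] at this
  · rcases eq_or_lt_of_le ht with rfl | h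
    · exact hw0.ge
    · exact (hpos t h).le
  · have h1 : w t < w (t + 1) := hmono ht (by simp; linarith) (by linarith)
    have h2 : w (t + 1) ≤ 1 := by
      refine ge_of_tendsto hlim ?_
      filter_upwards [eventually_ge_atTop (t + 1)] with s hs
      exact hmono.monotoneOn (by simp; linarith) (by simp; linarith) hs
    linarith

end Profile


section Profile2
open Topology

lemma mono_of {a a1 : ℝ → ℝ} {t0 : ℝ} (h0 : 0 ≤ t0)
    (h : ∀ t, 0 ≤ t → HasDerivWithinAt a (a1 t) (Ici 0) t) (hs : ∀ t, t0 ≤ t → 0 ≤ a1 t) :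
    MonotoneOn a (Ici t0) := by
  refine monotoneOn_of_deriv_nonneg (convex_Ici t0) (fun t ht => ?_) (fun t ht => ?_) (fun t ht => ?_)
  · exact (h t (h0.trans ht)).continuousWithinAt.mono (Ici_subset_Ici.2 h0)
  · rw [interior_Ici] at ht
    have : 0 < t := h0.trans_lt ht
    exact ((h t this.le).hasDerivAt (Ici_mem_nhds this)).differentiableAt.differentiableWithinAt
  · rw [interior_Ici] at ht
    have : 0 < t := h0.trans_lt ht
    rw [((h t this.le).hasDerivAt (Ici_mem_nhds this)).deriv]
    exact hs t (le_of_lt ht)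

lemma mono_lim {a : ℝ → ℝ} {t0 l : ℝ} (h : MonotoneOn a (Ici t0)) (hl : Tendsto a atTop (𝓝 l)) (t : ℝ) (ht : t0 ≤ t) :
    a t ≤ l := by
  refine ge_of_tendsto hl ?_
  filter_upwards [eventually_ge_atTop t] with s hs
  exact h ht (ht.trans hs) hs

lemma prof_decay {f w : ℝ → ℝ} (hf : Monostable f) (hw : IsHeteroclinic f w) :
    ∃ c ε : ℝ, 0 ≤ c ∧ 0 < ε ∧ (∀ t, 0 ≤ t → derivWithin w (Ici 0) t ≤ c) ∧
      (∀ t, 0 ≤ t → 0 ≤ f (w t) ∧ f (w t) ≤ c * derivWithin w (Ici 0) t) ∧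
      (∀ t, 0 ≤ t → 1 - w t ≤ c * derivWithin w (Ici 0) t) ∧
      (∀ t, 0 ≤ t → ε ≤ derivWithin w (Ici 0) t + w t * f (w t) / derivWithin w (Ici 0) t) := by
  obtain ⟨hd, hd2, hb⟩ := prof_basic hf hw
  obtain ⟨hc, heq, hw0, hlim, hpos, hmono, hder⟩ := hw
  obtain ⟨hfs, hf0, hf1, hfp, hf'⟩ := hf
  set o := derivWithin w (Ici 0) with ho
  have hF : ∀ t, 0 ≤ t → 0 ≤ f (w t) := by
    intro t ht
    rcases eq_or_lt_of_le (hb t ht).1 with h | h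
    · rw [← h, hf0]
    · exact (hfp _ ⟨h, (hb t ht).2⟩).le
  have hop : ∀ t, 0 ≤ t → 0 < o t := fun t ht => hder t ht
  have hanti : ∀ s t, 0 ≤ s → s ≤ t → o t ≤ o s := by
    intro s t hs hst
    have := mono_of (a := fun t => - o t) (a1 := fun t => f (w t)) le_rfl
      (fun t ht => by simpa using (hd2 t ht).fun_neg) hF hs (hs.trans hst) hst
    simpa using this
  have ho0 : Tendsto o atTop (𝓝 0) := by
    have h1 : Tendsto (fun t => w t - w (t - 1)) atTop (𝓝 0) := by
      have := hlim.sub (hlim.comp (tendsto_atTop_add_const_right atTop (-1:ℝ) tendsto_id))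
      simpa [Function.comp_def, sub_eq_add_neg] using this
    refine squeeze_zero' (f := o) ?_ ?_ h1
    · filter_upwards [eventually_ge_atTop 0] with t ht using (hop t ht).le
    · filter_upwards [eventually_ge_atTop 2] with t ht
      obtain ⟨ξ, hξ, he⟩ := exists_hasDerivAt_eq_slope w o (a := t - 1) (b := t) (by linarith)
        (fun x hx => (hc.continuousOn x (by simp; linarith [hx.1])).mono (fun y hy => by simp; linarith [hy.1]))
        (fun x hx => (hd x (by linarith [hx.1])).hasDerivAt (Ici_mem_nhds (by linarith [hx.1])))
      have := hanti ξ t (by linarith [hξ.1]) hξ.2.le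
      rw [he] at this
      simpa using this
  obtain ⟨M, hM0, hM⟩ := bound_unit (hfs.continuous_deriv (by norm_num))
  have hdf : Differentiable ℝ f := hfs.differentiable (by norm_num)
  have hfM : ∀ s ∈ Icc (0:ℝ) 1, f s ≤ M * (1 - s) := by
    intro s hs
    have := Convex.norm_image_sub_le_of_norm_deriv_le (f := f) (s := Icc (0:ℝ) 1) (x := 1) (y := s) (C := M)
      (fun x _ => hdf x) hM (convex_Icc 0 1) (by simp) hs
    rw [hf1, sub_zero, Real.norm_eq_abs, Real.norm_eq_abs, abs_sub_comm s, abs_of_nonneg (by linarith [hs.2] : 0 ≤ 1 - s)] at this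
    exact (le_abs_self _).trans this
  set m0 := -deriv f 1 / 2 with hm0
  have hm0p : 0 < m0 := by rw [hm0]; linarith
  have hev : ∀ᶠ s in 𝓝 (1:ℝ), s ≤ 1 → m0 * (1 - s) ≤ f s := by
    have h1 := (hdf 1).hasDerivAt.isLittleO.def hm0p
    filter_upwards [h1] with s hs hs1
    rw [hf1, Real.norm_eq_abs, Real.norm_eq_abs, abs_sub_comm s, abs_of_nonneg (by linarith : 0 ≤ 1 - s), smul_eq_mul] at hs
    have := (abs_le.1 hs).1
    rw [hm0] at this ⊢
    nlinarith
  have hev2 := hlim.eventually hev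
  have hev3 := hlim.eventually (eventually_ge_nhds (show (1/2:ℝ) < 1 by norm_num))
  obtain ⟨t1, ht1⟩ := eventually_atTop.1 (hev2.and hev3)
  set t0 := max t1 0
  have ht0 : 0 ≤ t0 := le_max_right _ _
  have hbig : ∀ t, t0 ≤ t → m0 * (1 - w t) ≤ f (w t) ∧ 1/2 ≤ w t := fun t ht =>
    ⟨(ht1 t ((le_max_left _ _).trans ht)).1 (hb t (ht0.trans ht)).2.le, (ht1 t ((le_max_left _ _).trans ht)).2⟩
  have hED : ∀ A t, 0 ≤ t → HasDerivWithinAt (fun t => o t ^ 2 - A * (1 - w t) ^ 2) (2 * o t * (A * (1 - w t) - f (w t))) (Ici 0) t := by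
    intro A t ht
    have := ((hd2 t ht).fun_pow 2).fun_sub ((((hd t ht).const_sub 1).fun_pow 2).const_mul A)
    refine this.congr_deriv ?_
    push_cast; ring
  have hEL : ∀ A : ℝ, Tendsto (fun t => o t ^ 2 - A * (1 - w t) ^ 2) atTop (𝓝 0) := by
    intro A
    have := (ho0.pow 2).sub (((hlim.const_sub 1).pow 2).const_mul A)
    simpa using this
  have hup : ∀ t, 0 ≤ t → o t ≤ (M + 1) * (1 - w t) := by
    intro t ht
    have := mono_lim (mono_of le_rfl (hED ((M+1)^2)) (fun t ht => by
      have h1 := hfM (w t) ⟨(hb t ht).1, (hb t ht).2.le⟩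
      have h2 := (hb t ht).2
      have : 0 ≤ (M+1)^2 * (1 - w t) - f (w t) := by
        have := mul_nonneg (show 0 ≤ M^2 + M + 1 by positivity) (sub_nonneg.2 h2.le)
        nlinarith
      have := hop t ht
      positivity)) (hEL _) t ht
    refine abs_le_of_sq_le_sq' (by nlinarith) (by nlinarith [(hb t ht).2]) |>.2
  set a := min 1 m0
  have ha0 : 0 < a := lt_min one_pos hm0p
  have haa : a ^ 2 ≤ m0 := by
    have := min_le_left 1 m0; have := min_le_right 1 m0
    change a ≤ _ at this
    nlinarith
  have hlo : ∀ t, t0 ≤ t → a * (1 - w t) ≤ o t := by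
    intro t ht
    have := mono_lim (mono_of ht0 (fun t ht => (hED (a^2) t ht).fun_neg) (fun t ht => by
      have h1 := (hbig t ht).1
      have h2 := (hb t (ht0.trans ht)).2
      have : 0 ≤ f (w t) - a^2 * (1 - w t) := by nlinarith
      have h3 := hop t (ht0.trans ht)
      nlinarith [mul_nonneg h3.le this])) (by simpa using (hEL (a^2)).neg) t ht
    refine abs_le_of_sq_le_sq' (by nlinarith) (hop t (ht0.trans ht)).le |>.2
  have hot := hop t0 ht0
  set c1 := 1 / a + 1 / o t0
  have hc1 : 0 ≤ c1 := by positivity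
  have h1w : ∀ t, 0 ≤ t → 1 - w t ≤ c1 * o t := by
    intro t ht
    have h3 := hop t ht
    rcases le_total t t0 with h | h
    · have h2 := hanti t t0 ht h
      have : 1 ≤ 1 / o t0 * o t := by rw [one_div_mul_eq_div, le_div_iff₀ hot]; linarith
      have : 0 ≤ 1 / a * o t := by positivity
      have := (hb t ht).1
      simp only [c1, add_mul]; linarith
    · have h2 := hlo t h
      have : 1 - w t ≤ 1 / a * o t := by rw [one_div_mul_eq_div, le_div_iff₀ ha0]; linarith
      have : 0 ≤ 1 / o t0 * o t := by positivity
      simp only [c1, add_mul]; linarith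
  refine ⟨max (max (o 0) c1) (M * c1), min (o t0) (m0 / (2 * (M + 1))), ?_, ?_, ?_, ?_, ?_, ?_⟩
  · exact hc1.trans ((le_max_right _ _).trans (le_max_left _ _))
  · positivity
  · intro t ht
    exact (hanti 0 t le_rfl ht).trans ((le_max_left _ _).trans (le_max_left _ _))
  · intro t ht
    refine ⟨hF t ht, ?_⟩
    calc f (w t) ≤ M * (1 - w t) := hfM _ ⟨(hb t ht).1, (hb t ht).2.le⟩
      _ ≤ M * (c1 * o t) := by gcongr; exact h1w t ht
      _ = M * c1 * o t := by ring
      _ ≤ _ := by have := hop t ht; gcongr; exact le_max_right _ _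
  · intro t ht
    refine (h1w t ht).trans ?_
    have := hop t ht; gcongr; exact (le_max_right _ _).trans (le_max_left _ _)
  · intro t ht
    have h3 := hop t ht
    have h4 := hF t ht
    have h5 := (hb t ht).1
    rcases le_total t t0 with h | h
    · have : 0 ≤ w t * f (w t) / o t := by positivity
      have := hanti t t0 ht h
      refine (min_le_left _ _).trans (by linarith)
    · refine (min_le_right _ _).trans ?_
      have : m0 / (2 * (M + 1)) ≤ w t * f (w t) / o t := by
        rw [div_le_div_iff₀ (by positivity) h3]
        have h6 := hup t ht
        have h7 := hbig t h
        have h8 := (hb t ht).2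
        calc m0 * o t ≤ m0 * ((M + 1) * (1 - w t)) := by gcongr
          _ = (1/2) * (m0 * (1 - w t)) * (2 * (M + 1)) := by ring
          _ ≤ w t * f (w t) * (2 * (M + 1)) := by
            have : 0 ≤ m0 * (1 - w t) := mul_nonneg hm0p.le (by linarith)
            gcongr
            · exact h7.2
            · exact h7.1
      linarith

lemma prof_exists {f w : ℝ → ℝ} (hf : Monostable f) (hw : IsHeteroclinic f w) :
    ∃ P : Prof, ∀ t, 0 ≤ t → P.om t = derivWithin w (Ici 0) t ∧ P.v t = deriv f (w t) := by
  obtain ⟨c, ε, hc0, hε, hoc, hFc, hWc, hεc⟩ := prof_decay hf hw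
  obtain ⟨hd, hd2, hb⟩ := prof_basic hf hw
  obtain ⟨hc, heq, hw0, hlim, hpos, hmono, hder⟩ := hw
  obtain ⟨hfs, hf0, hf1, hfp, hf'⟩ := hf
  set o := derivWithin w (Ici 0) with ho
  have hs1 : ContDiff ℝ (⊤ : ℕ∞) (deriv f) := (contDiff_infty_iff_deriv.1 hfs).2
  have hs2 : ContDiff ℝ (⊤ : ℕ∞) (deriv (deriv f)) := (contDiff_infty_iff_deriv.1 hs1).2
  have hs3 : ContDiff ℝ (⊤ : ℕ∞) (deriv (deriv (deriv f))) := (contDiff_infty_iff_deriv.1 hs2).2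
  have D : ∀ {g : ℝ → ℝ}, ContDiff ℝ (⊤ : ℕ∞) g → ∀ x, HasDerivAt g (deriv g x) x :=
    fun hg x => (hg.differentiable (by norm_num) x).hasDerivAt
  obtain ⟨M1, h10, hM1⟩ := bound_unit hs1.continuous
  obtain ⟨M2, h20, hM2⟩ := bound_unit hs2.continuous
  obtain ⟨M3, h30, hM3⟩ := bound_unit hs3.continuous
  have hI : ∀ t, 0 ≤ t → w t ∈ Icc (0:ℝ) 1 := fun t ht => ⟨(hb t ht).1, (hb t ht).2.le⟩
  have hop : ∀ t, 0 ≤ t → 0 < o t := fun t ht => hder t ht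
  have hdv1 : ∀ t, 0 ≤ t → HasDerivWithinAt (fun t => deriv f (w t)) (deriv (deriv f) (w t) * o t) (Ici 0) t :=
    fun t ht => (D hs1 (w t)).comp_hasDerivWithinAt t (hd t ht)
  have hdv2 : ∀ t, 0 ≤ t → HasDerivWithinAt (fun t => deriv (deriv f) (w t) * o t)
      (deriv (deriv (deriv f)) (w t) * o t * o t + deriv (deriv f) (w t) * (-f (w t))) (Ici 0) t :=
    fun t ht => ((D hs2 (w t)).comp_hasDerivWithinAt t (hd t ht)).mul (hd2 t ht)
  have hF1 : ∀ t, 0 ≤ t → HasDerivWithinAt (fun t => f (w t)) (deriv f (w t) * o t) (Ici 0) t :=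
    fun t ht => (D hfs (w t)).comp_hasDerivWithinAt t (hd t ht)
  have b1 : ∀ t, 0 ≤ t → |deriv (deriv f) (w t) * o t| ≤ M2 * c := by
    intro t ht
    rw [abs_mul, abs_of_pos (hop t ht)]
    exact mul_le_mul (hM2 _ (hI t ht)) (hoc t ht) (hop t ht).le h20
  have b2 : ∀ t, 0 ≤ t → |deriv (deriv (deriv f)) (w t) * o t * o t + deriv (deriv f) (w t) * (-f (w t))| ≤ M3 * c * c + M2 * (c * c) := by
    intro t ht
    refine (abs_add_le _ _).trans ?_
    rw [abs_mul, abs_mul, abs_mul, abs_neg, abs_of_pos (hop t ht), abs_of_nonneg (hFc t ht).1]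
    have := hop t ht
    have := hoc t ht
    have := hM3 _ (hI t ht)
    have := hM2 _ (hI t ht)
    have : f (w t) ≤ c * c := (hFc t ht).2.trans (by gcongr)
    have := (hFc t ht).1
    gcongr
  set Cc := c + M1 + M2 * c + (M3 * c * c + M2 * (c * c)) with hCc
  have e1 : c ≤ Cc := by have : 0 ≤ M2 * c := by positivity
                         have : 0 ≤ (M3 * c * c + M2 * (c * c)) := by positivity
                         linarith
  have e2 : M1 ≤ Cc := by have : 0 ≤ M2 * c := by positivity
                          have : 0 ≤ (M3 * c * c + M2 * (c * c)) := by positivity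
                          linarith
  have e3 : M2 * c ≤ Cc := by have : 0 ≤ (M3 * c * c + M2 * (c * c)) := by positivity
                              linarith
  have e4 : M3 * c * c + M2 * (c * c) ≤ Cc := by have : 0 ≤ M2 * c := by positivity
                                                 linarith
  have hfw0 : f (w 0) = 0 := by rw [hw0, hf0]
  have key : ∀ t : ℝ, |oddExt w t| = w |t| := by
    intro t
    rcases le_total 0 t with h | h
    · rw [oddExt_nonneg w h, abs_of_nonneg h, abs_of_nonneg (hb t h).1]
    · rw [oddExt_nonpos hw0 h, abs_of_nonpos h, abs_neg, abs_of_nonneg (hb (-t) (by linarith)).1]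
  refine ⟨⟨oddExt w, evenExt o, oddExt (fun t => f (w t)), evenExt (fun t => deriv f (w t)),
    evenExt (fun t => deriv (deriv f) (w t) * o t), Cc, ε, ?_, ?_, ?_, ?_, ?_, ?_, ?_, ?_, ?_, ?_, ?_, ?_, ?_, ?_, ?_, ?_, ?_, ?_, ?_, hε, ?_⟩, ?_⟩
  · exact oddExt_deriv hw0 hd
  · intro t
    have := evenExt_deriv (a := o) (a1 := fun t => -f (w t)) (by simp [hfw0]) hd2 t
    refine this.congr_deriv ?_
    simp only [oddExt]; split_ifs <;> ring
  · exact oddExt_deriv hfw0 hF1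
  · intro t; exact hop _ (abs_nonneg t)
  · intro t; simp [evenExt]
  · exact oddExt_odd hw0
  · exact oddExt_odd hfw0
  · intro t; simp [evenExt]
  · intro t; simp [evenExt]
  · intro t ht
    have := (hdv1 t ht).congr (f₁ := evenExt (fun t => deriv f (w t))) (fun s hs => by rw [evenExt, abs_of_nonneg hs]) (by rw [evenExt, abs_of_nonneg ht])
    exact this.congr_deriv (by rw [evenExt, abs_of_nonneg ht])
  · exact evenExt_lip hdv1 (fun t ht => (b1 t ht).trans e3)
  · exact evenExt_lip hdv2 (fun t ht => (b2 t ht).trans e4)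
  · intro t; exact (hM1 _ (hI _ (abs_nonneg t))).trans e2
  · intro t; exact (b1 _ (abs_nonneg t)).trans e3
  · intro t; exact (hoc _ (abs_nonneg t)).trans e1
  · intro t
    have : |oddExt (fun t => f (w t)) t| = f (w |t|) := by
      rcases le_total 0 t with h | h
      · rw [oddExt_nonneg _ h, abs_of_nonneg h, abs_of_nonneg (hFc t h).1]
      · rw [oddExt_nonpos hfw0 h, abs_of_nonpos h, abs_neg, abs_of_nonneg (hFc (-t) (by linarith)).1]
    rw [this]
    refine (hFc _ (abs_nonneg t)).2.trans ?_
    exact mul_le_mul_of_nonneg_right e1 (hop _ (abs_nonneg t)).le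
  · intro t; rw [key]; exact (hb _ (abs_nonneg t)).2
  · intro t; rw [key]
    exact (hWc _ (abs_nonneg t)).trans (mul_le_mul_of_nonneg_right e1 (hop _ (abs_nonneg t)).le)
  · refine hlim.congr' ?_
    filter_upwards [eventually_ge_atTop 0] with t ht using (oddExt_nonneg w ht).symm
  · intro t
    have := hεc |t| (abs_nonneg t)
    have h2 : oddExt w t * oddExt (fun t => f (w t)) t = w |t| * f (w |t|) := by
      rcases le_total 0 t with h | h
      · rw [oddExt_nonneg _ h, oddExt_nonneg _ h, abs_of_nonneg h]
      · rw [oddExt_nonpos hw0 h, oddExt_nonpos hfw0 h, abs_of_nonpos h]; ring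
    rw [h2]; exact this
  · intro t ht
    simp only [evenExt]; rw [abs_of_nonneg ht]; exact ⟨rfl, rfl⟩

end Profile2


namespace Prof
open Topology
variable (P : Prof)

lemma c_pos : 0 < P.c := (P.om_pos 0).trans_le (P.om_bd 0)
noncomputable def q (t : ℝ) : ℝ := -P.Fo t / P.om t
noncomputable def q1 (t : ℝ) : ℝ := -P.v t - P.q t ^ 2
noncomputable def b (t : ℝ) : ℝ := 2 * P.q t ^ 2 + P.v t
noncomputable def p (t : ℝ) : ℝ := (1 - P.W t ^ 2) / P.om t
noncomputable def p1 (t : ℝ) : ℝ := -2 * P.W t - P.q t * P.p t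
noncomputable def p2 (t : ℝ) : ℝ := -2 * P.om t - (P.q1 t * P.p t + P.q t * P.p1 t)

lemma hq (t : ℝ) : HasDerivAt P.q (P.q1 t) t := by
  have := (P.hFo t).fun_neg.fun_div (P.hom t) (P.om_pos t).ne'
  refine this.congr_deriv ?_
  have := (P.om_pos t).ne'
  simp only [q1, q]; field_simp
lemma q_odd (t : ℝ) : P.q (-t) = -P.q t := by
  simp only [q]; rw [P.Fo_odd, P.om_even]; ring
lemma q_zero : P.q 0 = 0 := by have := P.q_odd 0; rw [neg_zero] at this; linarith
lemma W_zero : P.W 0 = 0 := by have := P.W_odd 0; rw [neg_zero] at this; linarith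
lemma q_bd (t : ℝ) : |P.q t| ≤ P.c := by
  have := P.om_pos t
  rw [q, abs_div, abs_neg, abs_of_pos this, div_le_iff₀ this]
  exact P.Fo_bd t
lemma q1_bd (t : ℝ) : |P.q1 t| ≤ P.c + P.c ^ 2 := by
  rw [q1]
  refine (abs_sub _ _).trans ?_
  rw [abs_neg, abs_pow]
  have := P.q_bd t
  have := P.v_bd t
  gcongr
lemma q_lip (s t : ℝ) : |P.q s - P.q t| ≤ (P.c + P.c ^ 2) * |s - t| := by
  exact Convex.norm_image_sub_le_of_norm_hasDerivWithin_le (s := univ) (x := t) (y := s)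
      (fun t _ => (P.hq t).hasDerivWithinAt) (fun t _ => P.q1_bd t) convex_univ trivial trivial
lemma q_cont : Continuous P.q := continuous_iff_continuousAt.2 fun t => (P.hq t).continuousAt
lemma om_cont : Continuous P.om := continuous_iff_continuousAt.2 fun t => (P.hom t).continuousAt
lemma W_cont : Continuous P.W := continuous_iff_continuousAt.2 fun t => (P.hW t).continuousAt
lemma lip_cont {u : ℝ → ℝ} {c : ℝ} (h : ∀ s t, |u s - u t| ≤ c * |s - t|) : Continuous u := by
  refine continuous_iff_continuousAt.2 fun t => ?_
  refine tendsto_iff_dist_tendsto_zero.2 ?_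
  refine squeeze_zero (fun _ => dist_nonneg) (fun s => h s t) ?_
  have : Continuous (fun s : ℝ => c * |s - t|) := by fun_prop
  simpa using this.tendsto t
lemma v_cont : Continuous P.v := lip_cont P.v_lip
lemma dv_cont : Continuous P.dv := lip_cont P.dv_lip
lemma q1_cont : Continuous P.q1 := by
  unfold q1; have := P.v_cont; have := P.q_cont; fun_prop
lemma b_cont : Continuous P.b := by
  unfold b; have := P.v_cont; have := P.q_cont; fun_prop
lemma b_even (t : ℝ) : P.b (-t) = P.b t := by
  simp only [b]; rw [P.q_odd, P.v_even]; ring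
noncomputable def B : ℝ := 2 * P.c ^ 2 + P.c
lemma B_pos : 0 < P.B := by have := P.c_pos; unfold B; positivity
lemma b_bd (t : ℝ) : |P.b t| ≤ P.B := by
  unfold b B
  refine (abs_add_le _ _).trans ?_
  rw [abs_mul, abs_pow, abs_two]
  have := P.q_bd t
  have := P.v_bd t
  gcongr
lemma p_pos (t : ℝ) : 0 < P.p t := by
  refine div_pos ?_ (P.om_pos t)
  have := P.W_bd t
  have h := sq_abs (P.W t)
  nlinarith [abs_nonneg (P.W t)]
lemma p_le (t : ℝ) : P.p t ≤ 2 * P.c := by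
  rw [p, div_le_iff₀ (P.om_pos t)]
  have := P.W_bd t
  have h := sq_abs (P.W t)
  have := P.W_om t
  nlinarith [abs_nonneg (P.W t)]
lemma hp (t : ℝ) : HasDerivAt P.p (P.p1 t) t := by
  have := (((P.hW t).fun_pow 2).const_sub 1).fun_div (P.hom t) (P.om_pos t).ne'
  refine this.congr_deriv ?_
  have := (P.om_pos t).ne'
  simp only [p1, p, q]; field_simp; push_cast; ring
lemma hp1 (t : ℝ) : HasDerivAt P.p1 (P.p2 t) t := by
  exact ((P.hW t).const_mul (-2)).fun_sub ((P.hq t).fun_mul (P.hp t))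
lemma p_cont : Continuous P.p := continuous_iff_continuousAt.2 fun t => (P.hp t).continuousAt
lemma p1_cont : Continuous P.p1 := continuous_iff_continuousAt.2 fun t => (P.hp1 t).continuousAt
lemma p2_cont : Continuous P.p2 := by
  unfold p2; have := P.om_cont; have := P.q_cont; have := P.p_cont; have := P.p1_cont; have := P.q1_cont; fun_prop
lemma p_bd (t : ℝ) : |P.p t| ≤ 2 * P.c := by rw [abs_of_pos (P.p_pos t)]; exact P.p_le t
lemma p1_bd (t : ℝ) : |P.p1 t| ≤ 2 + P.c * (2 * P.c) := by
  unfold p1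
  refine (abs_sub _ _).trans ?_
  rw [abs_mul, abs_mul]
  have h1 := (P.W_bd t).le
  have h2 := P.q_bd t
  have h3 := P.p_bd t
  have h4 := P.c_pos
  have : |(-2:ℝ)| * |P.W t| ≤ 2 := by rw [abs_neg, abs_two]; linarith
  gcongr
lemma p2_bd (t : ℝ) : |P.p2 t| ≤ 2 * P.c + ((P.c + P.c^2) * (2 * P.c) + P.c * (2 + P.c * (2 * P.c))) := by
  unfold p2
  refine (abs_sub _ _).trans ?_
  have h0 : |-2 * P.om t| ≤ 2 * P.c := by
    rw [abs_mul, abs_neg, abs_two, abs_of_pos (P.om_pos t)]; have := P.om_bd t; linarith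
  have h1 : |P.q1 t * P.p t + P.q t * P.p1 t| ≤ ((P.c + P.c^2) * (2 * P.c) + P.c * (2 + P.c * (2 * P.c))) := by
    refine (abs_add_le _ _).trans ?_
    rw [abs_mul, abs_mul]
    have h4 := P.c_pos
    have := P.q1_bd t
    have := P.q_bd t
    have := P.p_bd t
    have := P.p1_bd t
    gcongr
  linarith
lemma p_eq (t : ℝ) : -P.p2 t + P.b t * P.p t = 2 * (P.om t + P.W t * P.Fo t / P.om t) := by
  have := (P.om_pos t).ne'
  simp only [p2, b, p1, p, q1, q]; field_simp; ring

end Prof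

section Zeta
open Topology BoundedContinuousFunction
variable {m : ℕ}

lemma Rg_cont {μ : ℝ} (hμ : 0 < μ) {h : XX m → ℝ} (hc : Continuous h) {M : ℝ} (hM : ∀ x, |h x| ≤ M) :
    Continuous (Rg m μ h) :=
  continuous_iff_continuousAt.2 fun x => (Rg_hasFDerivAt hμ hc hM x).continuousAt

lemma Rg_const {μ : ℝ} (hμ : 0 < μ) (a : ℝ) (x : XX m) : Rg m μ (fun _ => a) x = a / μ := by
  have := Rg_smul (m := m) (μ := μ) (fun _ => 1) a x
  rw [Rg_one hμ] at this
  simpa [div_eq_mul_inv] using this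

/-- domination -/
lemma Rg_abs_le {μ : ℝ} (hμ : 0 < μ) {h h' : XX m → ℝ} (hc : Continuous h) (hc' : Continuous h') {M' : ℝ}
    (hM' : ∀ x, |h' x| ≤ M') (hle : ∀ x, |h x| ≤ h' x) (x : XX m) : |Rg m μ h x| ≤ Rg m μ h' x := by
  have hb : ∀ x, |h x| ≤ M' := fun x => (hle x).trans ((le_abs_self _).trans (hM' x))
  rw [abs_le]
  constructor
  · have h1 := Rg_mono hμ (h := fun x => (-1) * h' x) (h' := h) (by fun_prop) (M := M') (fun x => by simpa using hM' x) hc hb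
      (fun x => by have := (abs_le.1 (hle x)).1; linarith) x
    rw [Rg_smul] at h1; linarith
  · exact Rg_mono hμ hc hb hc' hM' (fun x => (abs_le.1 (hle x)).2) x

lemma Rg_sup_le {μ : ℝ} (hμ : 0 < μ) {h : XX m → ℝ} (hc : Continuous h) {M : ℝ}
    (hM : ∀ x, |h x| ≤ M) (x : XX m) : |Rg m μ h x| ≤ M / μ := by
  rw [← Rg_const hμ M x]
  exact Rg_abs_le hμ hc continuous_const (M' := |M|) (fun _ => le_rfl) hM x

variable (P : Prof)

/-- contraction estimate -/
lemma zeta_contr (m : ℕ) : ∃ δ > (0:ℝ), δ < 1 ∧ (∀ t, P.ε / P.B ≤ P.p t) ∧ ∀ (d : XX m → ℝ) (S : ℝ), Continuous d → (∀ x, |d x| ≤ S * P.p x.2) →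
    ∀ x, |Rg m P.B (fun x => (P.B - P.b x.2) * d x) x| ≤ (1 - δ) * S * P.p x.2 := by
  have hB := P.B_pos
  have hcp := P.c_pos
  have hε := P.eps_pos
  have hbb : ∀ t, 0 ≤ P.B - P.b t ∧ P.B - P.b t ≤ 2 * P.B := fun t => by
    have := abs_le.1 (P.b_bd t); constructor <;> linarith
  have hpc := P.p_cont
  have hbc := P.b_cont
  have key : ∀ x : XX m, Rg m P.B (fun x => (P.B - P.b x.2) * P.p x.2) x ≤ P.p x.2 - 2 * P.ε / P.B := by
    intro x
    have h1 := Rg_repr (m := m) hB (M := max (2 * P.c) (max (2 + P.c * (2 * P.c)) (2 * P.c + ((P.c + P.c^2) * (2 * P.c) + P.c * (2 + P.c * (2 * P.c))))))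
      P.hp P.hp1 P.p2_cont (fun t => (P.p_bd t).trans (le_max_left _ _)) (fun t => (P.p1_bd t).trans ((le_max_left _ _).trans (le_max_right _ _)))
      (fun t => (P.p2_bd t).trans ((le_max_right _ _).trans (le_max_right _ _))) x
    rw [← h1, ← Rg_const (m := m) hB (2 * P.ε) x]
    rw [le_sub_iff_add_le]
    have hb1 : ∀ x : XX m, |(P.B - P.b x.2) * P.p x.2| ≤ 2 * P.B * (2 * P.c) := fun x => by
      rw [abs_mul, abs_of_nonneg (hbb x.2).1]
      exact mul_le_mul (hbb x.2).2 (P.p_bd _) (abs_nonneg _) (by positivity)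
    rw [← Rg_add hB (by fun_prop) hb1 continuous_const (M' := |2 * P.ε|) (fun _ => le_rfl)]
    have hp2 := P.p2_cont
    refine Rg_mono hB (by fun_prop) (M := 2 * P.B * (2 * P.c) + |2 * P.ε|) (fun x => (abs_add_le _ _).trans (by gcongr; exact hb1 x))
      (by fun_prop) (M' := P.B * (2 * P.c) + (2 * P.c + ((P.c + P.c^2) * (2 * P.c) + P.c * (2 + P.c * (2 * P.c))))) (fun x => (abs_sub _ _).trans ?_) (fun x => ?_) x
    · rw [abs_mul, abs_of_pos hB]
      have := P.p_bd x.2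
      have := P.p2_bd x.2
      gcongr
    · have h2 := P.p_eq x.2
      have h3 := P.eps_le x.2
      linarith
  set δ := P.ε / (P.B * (2 * P.c)) with hδ
  have hδp : 0 < δ := by positivity
  have hδe : δ * (2 * P.c) = P.ε / P.B := by rw [hδ]; field_simp
  have key2 : ∀ x : XX m, Rg m P.B (fun x => (P.B - P.b x.2) * P.p x.2) x ≤ (1 - δ) * P.p x.2 := by
    intro x
    have h1 := key x
    have h2 : δ * P.p x.2 ≤ P.ε / P.B := by rw [← hδe]; exact mul_le_mul_of_nonneg_left (P.p_le _) hδp.le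
    have h3 : 0 < P.ε / P.B := by positivity
    have h4 : 2 * P.ε / P.B = P.ε / P.B + P.ε / P.B := by ring
    linarith
  refine ⟨δ, hδp, ?_, fun t => ?_, fun d S hd hS x => ?_⟩
  · have h0 : (0:ℝ) ≤ Rg m P.B (fun x => (P.B - P.b x.2) * P.p x.2) 0 :=
      Rg_nonneg (fun x => mul_nonneg (hbb _).1 (P.p_pos _).le) 0
    have h1 := key 0
    have h2 : δ * P.p (0 : XX m).2 ≤ P.ε / P.B := by rw [← hδe]; exact mul_le_mul_of_nonneg_left (P.p_le _) hδp.le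
    have h3 : 0 < P.ε / P.B := by positivity
    have h4 : 2 * P.ε / P.B = P.ε / P.B + P.ε / P.B := by ring
    have h5 : δ * P.p (0 : XX m).2 < 1 * P.p (0 : XX m).2 := by linarith
    exact lt_of_mul_lt_mul_right h5 (P.p_pos _).le
  · have h0 : (0:ℝ) ≤ Rg m P.B (fun x => (P.B - P.b x.2) * P.p x.2) (0, t) :=
      Rg_nonneg (fun x => mul_nonneg (hbb _).1 (P.p_pos _).le) _
    have h1 := key (0, t)
    have h3 : 0 < P.ε / P.B := by positivity
    have h4 : 2 * P.ε / P.B = P.ε / P.B + P.ε / P.B := by ring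
    simp only at h1
    linarith
  · have hS0 : 0 ≤ S := by
      have := (abs_nonneg _).trans (hS 0)
      exact nonneg_of_mul_nonneg_left this (P.p_pos _)
    have h1 := Rg_abs_le hB (h := fun x => (P.B - P.b x.2) * d x) (h' := fun x : XX m => S * ((P.B - P.b x.2) * P.p x.2))
      (by fun_prop) (by fun_prop) (M' := S * (2 * P.B * (2 * P.c))) (fun x => by
        rw [abs_mul, abs_mul, abs_of_nonneg hS0, abs_of_nonneg (hbb x.2).1]
        have := (hbb x.2).1
        have := (hbb x.2).2
        have := P.p_bd x.2
        gcongr)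
      (fun x => by
        rw [abs_mul, abs_of_nonneg (hbb x.2).1]
        have := mul_le_mul_of_nonneg_left (hS x) (hbb x.2).1
        linarith) x
    refine h1.trans ?_
    rw [Rg_smul]
    have := mul_le_mul_of_nonneg_left (key2 x) hS0
    linarith


lemma zeta_unique (m : ℕ) {k ζ ζ' : XX m → ℝ} {M A A' : ℝ} (hk : Continuous k) (hkM : ∀ x, |k x| ≤ M)
    (hζ : Continuous ζ) (hA : ∀ x, |ζ x| ≤ A) (hζ' : Continuous ζ') (hA' : ∀ x, |ζ' x| ≤ A')
    (e : ∀ x, ζ x = Rg m P.B (fun x => -k x + (P.B - P.b x.2) * ζ x) x)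
    (e' : ∀ x, ζ' x = Rg m P.B (fun x => -k x + (P.B - P.b x.2) * ζ' x) x) (x : XX m) : ζ x = ζ' x := by
  obtain ⟨δ, hδ, hδ1, hpl, hcon⟩ := zeta_contr P m
  have hB := P.B_pos
  have hε := P.eps_pos
  have hbc := P.b_cont
  have hbb : ∀ t, |P.B - P.b t| ≤ 2 * P.B := fun t => by
    have := abs_le.1 (P.b_bd t); rw [abs_le]; constructor <;> linarith
  have hd : ∀ x, ζ x - ζ' x = Rg m P.B (fun x => (P.B - P.b x.2) * (ζ x - ζ' x)) x := by
    intro x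
    have h1 := Rg_add hB (h := fun x : XX m => -k x + (P.B - P.b x.2) * ζ' x) (h' := fun x => (P.B - P.b x.2) * (ζ x - ζ' x))
      (by fun_prop) (M := M + 2 * P.B * A') (fun x => (abs_add_le _ _).trans (by
        rw [abs_neg, abs_mul]; exact add_le_add (hkM x) (mul_le_mul (hbb _) (hA' x) (abs_nonneg _) (by positivity))))
      (by fun_prop) (M' := 2 * P.B * (A + A')) (fun x => by
        rw [abs_mul]
        exact mul_le_mul (hbb _) ((abs_sub _ _).trans (add_le_add (hA x) (hA' x))) (abs_nonneg _) (by positivity)) x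
    rw [← e' x] at h1
    have h2 : Rg m P.B (fun x => -k x + (P.B - P.b x.2) * ζ x) x = ζ' x + Rg m P.B (fun x => (P.B - P.b x.2) * (ζ x - ζ' x)) x := by
      rw [← h1]; congr 1; funext x; ring
    rw [← e x] at h2
    linarith
  set a := P.ε / P.B
  have ha : 0 < a := by positivity
  set S := (A + A') / a
  have hn : ∀ (n : ℕ) x, |ζ x - ζ' x| ≤ (1 - δ) ^ n * S * P.p x.2 := by
    intro n
    induction n with
    | zero =>
      intro x
      have h1 : |ζ x - ζ' x| ≤ A + A' := (abs_sub _ _).trans (add_le_add (hA x) (hA' x))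
      have h2 : 0 ≤ A + A' := (abs_nonneg _).trans h1
      have h3 : A + A' = S * a := by simp only [S]; field_simp
      rw [pow_zero, one_mul]
      refine h1.trans (h3.le.trans ?_)
      exact mul_le_mul_of_nonneg_left (hpl _) (by positivity)
    | succ n ih =>
      intro x
      rw [hd x]
      refine (hcon (fun x => ζ x - ζ' x) ((1 - δ)^n * S) (by fun_prop) ih x).trans (le_of_eq ?_)
      ring
  have hlim : Tendsto (fun n : ℕ => (1 - δ) ^ n * S * P.p x.2) atTop (𝓝 0) := by
    have := ((tendsto_pow_atTop_nhds_zero_of_lt_one (r := 1 - δ) (by linarith) (by linarith)).mul_const S).mul_const (P.p x.2)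
    simpa using this
  have := ge_of_tendsto' hlim (fun n => hn n x)
  exact sub_eq_zero.1 (abs_nonpos_iff.1 this)

lemma zeta_ex (m : ℕ) : ∃ C ≥ (0:ℝ), ∀ (k : XX m → ℝ) (M : ℝ), Continuous k → (∀ x, |k x| ≤ M) →
    ∃ ζ : XX m → ℝ, Continuous ζ ∧ (∀ x, |ζ x| ≤ C * M) ∧ 
      (∀ x, ζ x = Rg m P.B (fun x => -k x + (P.B - P.b x.2) * ζ x) x) := by
  obtain ⟨δ, hδ, hδ1, hpl, hcon⟩ := zeta_contr P m
  have hB := P.B_pos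
  have hε := P.eps_pos
  have hc := P.c_pos
  have hbc := P.b_cont
  have hpc := P.p_cont
  have hbb : ∀ t, |P.B - P.b t| ≤ 2 * P.B := fun t => by
    have := abs_le.1 (P.b_bd t); rw [abs_le]; constructor <;> linarith
  set a := P.ε / P.B with ha_def
  have ha : 0 < a := by positivity
  refine ⟨2 * P.c * (1 / (P.B * a * δ)), by positivity, fun k M hk hkM => ?_⟩
  have hM0 : 0 ≤ M := (abs_nonneg _).trans (hkM 0)
  have hRk : ∀ x, |Rg m P.B (fun x => -k x) x| ≤ M / P.B := Rg_sup_le hB (by fun_prop) (fun x => by rw [abs_neg]; exact hkM x)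
  have hpη : ∀ (η : XX m →ᵇ ℝ) x, |P.p x.2 * η x| ≤ ‖η‖ * P.p x.2 := by
    intro η x
    rw [abs_mul, abs_of_pos (P.p_pos _), mul_comm]
    exact mul_le_mul_of_nonneg_right (η.norm_coe_le_norm x) (P.p_pos _).le
  have hc1 : ∀ η : XX m →ᵇ ℝ, Continuous (fun x : XX m => (P.B - P.b x.2) * (P.p x.2 * η x)) := by
    intro η; have := η.continuous; fun_prop
  have hb1 : ∀ (η : XX m →ᵇ ℝ) (x : XX m), |(P.B - P.b x.2) * (P.p x.2 * η x)| ≤ 2 * P.B * (‖η‖ * (2 * P.c)) := by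
    intro η x
    rw [abs_mul]
    refine mul_le_mul (hbb _) ((hpη η x).trans ?_) (abs_nonneg _) (by positivity)
    exact mul_le_mul_of_nonneg_left (P.p_le _) (norm_nonneg _)
  have hsplit : ∀ (η : XX m →ᵇ ℝ) x, Rg m P.B (fun x => -k x + (P.B - P.b x.2) * (P.p x.2 * η x)) x
      = Rg m P.B (fun x => -k x) x + Rg m P.B (fun x => (P.B - P.b x.2) * (P.p x.2 * η x)) x := fun η x =>
    Rg_add hB (h := fun x => -k x) (by fun_prop) (M := M) (fun x => by rw [abs_neg]; exact hkM x) (hc1 η) (hb1 η) x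
  have hbd : ∀ (η : XX m →ᵇ ℝ) x, |Rg m P.B (fun x => -k x + (P.B - P.b x.2) * (P.p x.2 * η x)) x / P.p x.2| ≤ M / P.B / a + (1 - δ) * ‖η‖ := by
    intro η x
    rw [hsplit, abs_div, abs_of_pos (P.p_pos _), div_le_iff₀ (P.p_pos _)]
    refine (abs_add_le _ _).trans ?_
    have h1 := hcon (fun x => P.p x.2 * η x) ‖η‖ (by have := η.continuous; fun_prop) (hpη η) x
    have h2 := hRk x
    have h3 : M / P.B ≤ M / P.B / a * P.p x.2 := by
      calc M / P.B = M / P.B / a * a := by field_simp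
        _ ≤ _ := mul_le_mul_of_nonneg_left (hpl _) (by positivity)
    rw [add_mul]
    linarith
  have hcont : ∀ η : XX m →ᵇ ℝ, Continuous (fun x => Rg m P.B (fun x => -k x + (P.B - P.b x.2) * (P.p x.2 * η x)) x / P.p x.2) := by
    intro η
    refine Continuous.div ?_ (by fun_prop) (fun x => (P.p_pos _).ne')
    refine Rg_cont hB (hk.neg.add (hc1 η)) (M := M + 2 * P.B * (‖η‖ * (2 * P.c))) (fun x => (abs_add_le _ _).trans ?_)
    rw [abs_neg]
    exact add_le_add (hkM x) (hb1 η x)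
  let Φ : (XX m →ᵇ ℝ) → (XX m →ᵇ ℝ) := fun η => BoundedContinuousFunction.ofNormedAddCommGroup _ (hcont η) _ (hbd η)
  have hΦ : ∀ η x, Φ η x = Rg m P.B (fun x => -k x + (P.B - P.b x.2) * (P.p x.2 * η x)) x / P.p x.2 := fun η x => rfl
  have hcw : ContractingWith (Real.toNNReal (1 - δ)) Φ := by
    refine ⟨by rw [← NNReal.coe_lt_coe, Real.coe_toNNReal _ (by linarith)]; simpa using hδ, LipschitzWith.of_dist_le_mul fun η η' => ?_⟩
    rw [Real.coe_toNNReal _ (by linarith)]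
    rw [BoundedContinuousFunction.dist_le (mul_nonneg (by linarith) dist_nonneg)]
    intro x
    rw [Real.dist_eq, hΦ, hΦ, ← sub_div, abs_div, abs_of_pos (P.p_pos _), div_le_iff₀ (P.p_pos _), hsplit, hsplit]
    have h1 := hcon (fun x => P.p x.2 * (η - η') x) ‖η - η'‖ (by have := (η - η').continuous; fun_prop) (hpη (η - η')) x
    have h2 := Rg_add hB (hc1 η') (hb1 η') (hc1 (η - η')) (hb1 (η - η')) x
    have h3 : (fun x : XX m => (P.B - P.b x.2) * (P.p x.2 * η' x) + (P.B - P.b x.2) * (P.p x.2 * (η - η') x)) = fun x => (P.B - P.b x.2) * (P.p x.2 * η x) := by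
      funext x; simp only [BoundedContinuousFunction.coe_sub, Pi.sub_apply]; ring
    rw [h3] at h2
    rw [h2, dist_eq_norm]
    refine le_trans (le_of_eq ?_) h1
    congr 1; ring
  haveI : Nonempty (XX m →ᵇ ℝ) := ⟨0⟩
  set η := ContractingWith.fixedPoint Φ hcw
  have hη : Φ η = η := hcw.fixedPoint_isFixedPt
  have hηn : ‖η‖ ≤ M / P.B / a / δ := by
    have h1 : ‖η‖ ≤ M / P.B / a + (1 - δ) * ‖η‖ := by
      have h0 : 0 ≤ M / P.B / a + (1 - δ) * ‖η‖ := add_nonneg (by positivity) (mul_nonneg (by linarith) (norm_nonneg _))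
      refine (BoundedContinuousFunction.norm_le h0).2 (fun x => ?_)
      have := hbd η x
      rw [← hΦ, hη] at this
      exact this
    rw [le_div_iff₀ hδ]; linarith
  refine ⟨fun x => P.p x.2 * η x, by have := η.continuous; fun_prop, fun x => ?_, fun x => ?_⟩
  · refine (hpη η x).trans ?_
    calc ‖η‖ * P.p x.2 ≤ (M / P.B / a / δ) * (2 * P.c) := mul_le_mul hηn (P.p_le _) (P.p_pos _).le (by positivity)
      _ = _ := by field_simp
  · have h1 := hΦ η x
    rw [hη, eq_div_iff (P.p_pos _).ne'] at h1
    linarith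

end Zeta


section HolderCalc
variable {X X' Y Z G : Type*} [PseudoMetricSpace X] [PseudoMetricSpace X'] [NormedAddCommGroup Y] [NormedAddCommGroup Z]
  [NormedAddCommGroup G] [NormedSpace ℝ Y] [NormedSpace ℝ Z] [NormedSpace ℝ G] {σ K K' : ℝ} {s : Set X}

lemma HolderLe.add {h h' : X → Y} (H : HolderLe σ s h K) (H' : HolderLe σ s h' K') :
    HolderLe σ s (fun x => h x + h' x) (K + K') := by
  refine ⟨fun x hx => (norm_add_le _ _).trans (add_le_add (H.1 x hx) (H'.1 x hx)), fun x hx y hy => ?_⟩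
  rw [show h x + h' x - (h y + h' y) = (h x - h y) + (h' x - h' y) by abel, add_mul]
  exact (norm_add_le _ _).trans (add_le_add (H.2 x hx y hy) (H'.2 x hx y hy))

lemma HolderLe.neg {h : X → Y} (H : HolderLe σ s h K) : HolderLe σ s (fun x => -h x) K := by
  refine ⟨fun x hx => by rw [norm_neg]; exact H.1 x hx, fun x hx y hy => ?_⟩
  rw [show -h x - -h y = -(h x - h y) by abel, norm_neg]
  exact H.2 x hx y hy

lemma HolderLe.sub {h h' : X → Y} (H : HolderLe σ s h K) (H' : HolderLe σ s h' K') :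
    HolderLe σ s (fun x => h x - h' x) (K + K') := by
  simpa only [sub_eq_add_neg] using H.add H'.neg

lemma HolderLe.clm (L : Y →L[ℝ] Z) {h : X → Y} (H : HolderLe σ s h K) : HolderLe σ s (fun x => L (h x)) (‖L‖ * K) := by
  refine ⟨fun x hx => (L.le_opNorm _).trans (mul_le_mul_of_nonneg_left (H.1 x hx) (norm_nonneg _)), fun x hx y hy => ?_⟩
  rw [← map_sub, mul_assoc]
  exact (L.le_opNorm _).trans (mul_le_mul_of_nonneg_left (H.2 x hx y hy) (norm_nonneg _))

lemma HolderLe.bilin (L : Y →L[ℝ] Z →L[ℝ] G) {h : X → Y} {h' : X → Z} (hK : 0 ≤ K) (hK' : 0 ≤ K') (H : HolderLe σ s h K)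
    (H' : HolderLe σ s h' K') : HolderLe σ s (fun x => L (h x) (h' x)) (2 * (‖L‖ * K * K')) := by
  have hL := norm_nonneg L
  refine ⟨fun x hx => ?_, fun x hx y hy => ?_⟩
  · have h1 := H.1 x hx
    have h2 := H'.1 x hx
    have : ‖L (h x) (h' x)‖ ≤ ‖L‖ * K * K' := (L.le_opNorm₂ _ _).trans (by gcongr)
    have : 0 ≤ ‖L‖ * K * K' := by positivity
    linarith
  · have e : L (h x) (h' x) - L (h y) (h' y) = L (h x) (h' x - h' y) + L (h x - h y) (h' y) := by
      rw [map_sub, map_sub, ContinuousLinearMap.sub_apply]; abel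
    rw [e]
    have h1 := H.1 x hx
    have h2 := H'.1 y hy
    have h3 := H.2 x hx y hy
    have h4 := H'.2 x hx y hy
    have hd : 0 ≤ dist x y ^ σ := Real.rpow_nonneg dist_nonneg _
    calc _ ≤ ‖L (h x) (h' x - h' y)‖ + ‖L (h x - h y) (h' y)‖ := norm_add_le _ _
      _ ≤ ‖L‖ * ‖h x‖ * ‖h' x - h' y‖ + ‖L‖ * ‖h x - h y‖ * ‖h' y‖ := add_le_add (L.le_opNorm₂ _ _) (L.le_opNorm₂ _ _)
      _ ≤ ‖L‖ * K * (K' * dist x y ^ σ) + ‖L‖ * (K * dist x y ^ σ) * K' := by gcongr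
      _ = _ := by ring

lemma HolderLe.mul {h h' : X → ℝ} (hK : 0 ≤ K) (hK' : 0 ≤ K') (H : HolderLe σ s h K)
    (H' : HolderLe σ s h' K') : HolderLe σ s (fun x => h x * h' x) (2 * (K * K')) := by
  refine (HolderLe.bilin (ContinuousLinearMap.mul ℝ ℝ) hK hK' H H').mono ?_
  have : ‖ContinuousLinearMap.mul ℝ ℝ‖ = 1 := ContinuousLinearMap.opNorm_mul ℝ ℝ
  rw [this, one_mul]

lemma HolderLe.smul {h : X → ℝ} {h' : X → Y} (hK : 0 ≤ K) (hK' : 0 ≤ K') (H : HolderLe σ s h K)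
    (H' : HolderLe σ s h' K') : HolderLe σ s (fun x => h x • h' x) (2 * (K * K')) := by
  refine (HolderLe.bilin (ContinuousLinearMap.lsmul ℝ ℝ) hK hK' H H').mono ?_
  have : ‖(ContinuousLinearMap.lsmul ℝ ℝ : ℝ →L[ℝ] Y →L[ℝ] Y)‖ ≤ 1 := ContinuousLinearMap.opNorm_lsmul_le
  have : 0 ≤ K * K' := by positivity
  nlinarith

lemma HolderLe.comp {h : X' → Y} {s' : Set X'} (σ0 : 0 ≤ σ) (hK : 0 ≤ K) (H : HolderLe σ s' h K) {φ : X → X'} (hφ : ∀ x ∈ s, φ x ∈ s')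
    (hl : ∀ x y, dist (φ x) (φ y) ≤ dist x y) : HolderLe σ s (fun x => h (φ x)) K := by
  refine ⟨fun x hx => H.1 _ (hφ x hx), fun x hx y hy => (H.2 _ (hφ x hx) _ (hφ y hy)).trans ?_⟩
  gcongr
  exact hl x y

lemma HolderLe.subset {h : X → Y} {s' : Set X} (H : HolderLe σ s' h K) (hs : s ⊆ s') : HolderLe σ s h K :=
  ⟨fun x hx => H.1 x (hs hx), fun x hx y hy => H.2 x (hs hx) y (hs hy)⟩

lemma HolderLe.congr {h h' : X → Y} (H : HolderLe σ s h K) (e : ∀ x ∈ s, h' x = h x) : HolderLe σ s h' K := by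
  refine ⟨fun x hx => by rw [e x hx]; exact H.1 x hx, fun x hx y hy => ?_⟩
  rw [e x hx, e y hy]; exact H.2 x hx y hy

lemma HolderLe.const (c : Y) : HolderLe σ s (fun _ => c) ‖c‖ :=
  ⟨fun x hx => le_rfl, fun x hx y hy => by
    rw [sub_self, norm_zero]; have := Real.rpow_nonneg (dist_nonneg (x := x) (y := y)) σ; positivity⟩

/-- bounded Lipschitz functions of `t` -/
lemma holder_fst_snd {m : ℕ} (s0 : 0 < σ) (s1 : σ < 1) {u : ℝ → ℝ} {A B : ℝ} (hB : 0 ≤ B) (hA : ∀ t, |u t| ≤ A)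
    (hL : ∀ s t, |u s - u t| ≤ B * |s - t|) (S : Set (XX m)) : HolderLe σ S (fun x => u x.2) (2 * A + B) :=
  holder_of_lip s0 s1 hB (fun x _ => hA _) (fun x _ y _ => (hL _ _).trans (by
    gcongr; rw [dist_eq_norm]; exact norm_snd_le (x - y)))

lemma holder_sep {m : ℕ} (s0 : 0 < σ) (s1 : σ < 1) {u : XX m → ℝ} {A : ℝ} (h0 : 0 ≤ A) (hA : ∀ x, |u x| ≤ A)
    (hy : ∀ y y' t, |u (y, t) - u (y', t)| ≤ A * dist y y' ^ σ)
    (ht : ∀ y t t', |u (y, t) - u (y, t')| ≤ A * |t - t'|) : HolderLe σ univ u (4 * A) := by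
  refine ⟨fun x _ => (hA x).trans (by linarith), fun x _ x' _ => ?_⟩
  obtain ⟨y, t⟩ := x
  obtain ⟨y', t'⟩ := x'
  have h1 : ‖u (y, t) - u (y', t)‖ ≤ A * dist (y, t) (y', t') ^ σ := (hy y y' t).trans (by
    gcongr; exact le_max_left _ _)
  have h2 := (holder_of_lip s0 s1 (s := univ) (u := fun t => u (y', t)) h0 (fun t _ => hA (y', t)) (fun t _ t' _ => ht y' t t')).2 t trivial t' trivial
  have h3 : (2 * A + A) * dist t t' ^ σ ≤ (2 * A + A) * dist (y, t) (y', t') ^ σ := by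
    gcongr; exact le_max_right _ _
  calc _ = ‖(u (y, t) - u (y', t)) + (u (y', t) - u (y', t'))‖ := by congr 1; ring
    _ ≤ _ := (norm_add_le _ _).trans (by linarith)

end HolderCalc

section Kop
open Topology MeasureTheory
variable (P : Prof)

lemma om_int : IntegrableOn P.om (Ioi 0) ∧ ∀ t, ∫ s in Ioi t, P.om s = 1 - P.W t := by
  have h1 : IntegrableOn P.om (Ioi 0) := integrableOn_Ioi_deriv_of_nonneg P.W_cont.continuousWithinAt
    (fun t _ => P.hW t) (fun t _ => (P.om_pos t).le) P.W_lim
  refine ⟨h1, fun t => ?_⟩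
  exact integral_Ioi_of_hasDerivAt_of_nonneg P.W_cont.continuousWithinAt (fun t _ => P.hW t) (fun t _ => (P.om_pos t).le) P.W_lim

lemma om_int' (t : ℝ) : IntegrableOn P.om (Ioi t) := 
  integrableOn_Ioi_deriv_of_nonneg P.W_cont.continuousWithinAt
    (fun t _ => P.hW t) (fun t _ => (P.om_pos t).le) P.W_lim

lemma mul_om_int {G : ℝ → ℝ} {M : ℝ} (hG : Continuous G) (hM : ∀ t, |G t| ≤ M) (t : ℝ) :
    IntegrableOn (fun s => G s * P.om s) (Ioi t) :=
  Integrable.bdd_mul (om_int' P t) hG.aestronglyMeasurable (ae_of_all _ hM)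

lemma mul_om_bd {G : ℝ → ℝ} {M : ℝ} (hG : Continuous G) (hM : ∀ t, |G t| ≤ M) (t : ℝ) :
    |∫ s in Ioi t, G s * P.om s| ≤ M * (1 - P.W t) := by
  rw [← (om_int P).2 t, ← integral_const_mul]
  refine norm_integral_le_of_norm_le (f := fun s => G s * P.om s) ((om_int' P t).const_mul M) (ae_of_all _ fun s => ?_)
  rw [Real.norm_eq_abs, abs_mul, abs_of_pos (P.om_pos s)]
  exact mul_le_mul_of_nonneg_right (hM s) (P.om_pos s).le

noncomputable def I2 : ℝ := ∫ s in Ioi 0, P.om s * P.om s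
lemma I2_pos : 0 < I2 P := by
  have hi := mul_om_int P P.om_cont (fun t => by rw [abs_of_pos (P.om_pos t)]; exact P.om_bd t) 0
  rw [I2, setIntegral_pos_iff_support_of_nonneg_ae (ae_of_all _ fun s => mul_self_nonneg _) hi]
  have : Function.support (fun s => P.om s * P.om s) = univ := by
    ext s; simp [(P.om_pos s).ne']
  rw [this, univ_inter]; simp

noncomputable def cc (G : ℝ → ℝ) : ℝ := (∫ s in Ioi 0, G s * P.om s) / I2 P
noncomputable def Gp (G : ℝ → ℝ) (t : ℝ) : ℝ := G t - cc P G * P.om t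
noncomputable def kk (G : ℝ → ℝ) (t : ℝ) : ℝ := (∫ s in (0:ℝ)..t, Gp P G s * P.om s) / P.om t

lemma cc_bd {G : ℝ → ℝ} {M : ℝ} (hG : Continuous G) (hM : ∀ t, |G t| ≤ M) : |cc P G| ≤ (1 / I2 P) * M := by
  have := mul_om_bd P hG hM 0
  rw [P.W_zero, sub_zero, mul_one] at this
  rw [cc, abs_div, abs_of_pos (I2_pos P), one_div_mul_eq_div]
  exact div_le_div_of_nonneg_right this (I2_pos P).le

lemma Gp_cont {G : ℝ → ℝ} (hG : Continuous G) : Continuous (Gp P G) := by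
  have := P.om_cont; unfold Gp; fun_prop

lemma Gp_bd {G : ℝ → ℝ} {M : ℝ} (hG : Continuous G) (hM : ∀ t, |G t| ≤ M) (t : ℝ) :
    |Gp P G t| ≤ (1 + 1 / I2 P * P.c) * M := by
  have h1 := cc_bd P hG hM
  have h2 := I2_pos P
  have h0 : 0 ≤ M := (abs_nonneg _).trans (hM 0)
  calc |Gp P G t| ≤ |G t| + |cc P G * P.om t| := abs_sub _ _
    _ ≤ M + ((1 / I2 P) * M) * P.c := by
      rw [abs_mul, abs_of_pos (P.om_pos t)]
      have := P.om_bd t; have := P.om_pos t; have := hM t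
      gcongr
    _ = _ := by ring

lemma Gp_int {G : ℝ → ℝ} {M : ℝ} (hG : Continuous G) (hM : ∀ t, |G t| ≤ M) : ∫ s in Ioi 0, Gp P G s * P.om s = 0 := by
  have e : ∀ s, Gp P G s * P.om s = G s * P.om s - cc P G * (P.om s * P.om s) := fun s => by rw [Gp]; ring
  simp_rw [e]
  rw [integral_sub (mul_om_int P hG hM 0), integral_const_mul]
  · change _ - _ * I2 P = 0
    rw [cc, div_mul_cancel₀ _ (I2_pos P).ne', sub_self]
  · exact (mul_om_int P P.om_cont (fun t => by rw [abs_of_pos (P.om_pos t)]; exact P.om_bd t) 0).const_mul _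

lemma kk_odd {G : ℝ → ℝ} (he : ∀ t, G (-t) = G t) (t : ℝ) : kk P G (-t) = -kk P G t := by
  have h1 : ∫ s in (0:ℝ)..(-t), Gp P G s * P.om s = - ∫ s in (0:ℝ)..t, Gp P G s * P.om s := by
    have := intervalIntegral.integral_comp_neg (a := 0) (b := t) (fun s => Gp P G s * P.om s)
    rw [neg_zero] at this
    rw [intervalIntegral.integral_symm, ← this]
    congr 1
    refine intervalIntegral.integral_congr fun s _ => ?_
    simp only [Gp]; rw [he, P.om_even]
  rw [kk, h1, P.om_even, kk, neg_div]

lemma kk_deriv {G : ℝ → ℝ} (hG : Continuous G) (t : ℝ) : HasDerivAt (kk P G) (Gp P G t - P.q t * kk P G t) t := by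
  have hc : Continuous (fun s => Gp P G s * P.om s) := (Gp_cont P hG).mul P.om_cont
  have h1 := (hc.integral_hasStrictDerivAt 0 t).hasDerivAt
  have := h1.fun_div (P.hom t) (P.om_pos t).ne'
  refine this.congr_deriv ?_
  have := (P.om_pos t).ne'
  simp only [kk, Prof.q]; field_simp

lemma kk_bd {G : ℝ → ℝ} {M : ℝ} (hG : Continuous G) (he : ∀ t, G (-t) = G t) (hM : ∀ t, |G t| ≤ M) (t : ℝ) :
    |kk P G t| ≤ P.c * ((1 + 1 / I2 P * P.c) * M) := by
  have key : ∀ t, 0 ≤ t → |kk P G t| ≤ P.c * ((1 + 1 / I2 P * P.c) * M) := by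
    intro t ht
    have h2 := Gp_bd P hG hM
    have h3 := mul_om_bd P (Gp_cont P hG) h2 t
    have h1 : ∫ s in (0:ℝ)..t, Gp P G s * P.om s = - ∫ s in Ioi t, Gp P G s * P.om s := by
      have := intervalIntegral.integral_Ioi_sub_Ioi (mul_om_int P (Gp_cont P hG) h2 0) ht
      rw [Gp_int P hG hM] at this
      linarith
    rw [kk, h1, abs_div, abs_neg, abs_of_pos (P.om_pos t), div_le_iff₀ (P.om_pos t)]
    refine h3.trans ?_
    have h4 : 1 - P.W t ≤ P.c * P.om t := by
      refine le_trans ?_ (P.W_om t)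
      have hWn : 0 ≤ P.W t := by
        have := (monotone_of_hasDerivAt_nonneg P.hW (fun t => (P.om_pos t).le)) ht
        rwa [P.W_zero] at this
      rw [abs_of_nonneg hWn]
    have h5 : 0 ≤ ((1 + 1 / I2 P * P.c) * M) := (abs_nonneg _).trans (h2 0)
    nlinarith [mul_le_mul_of_nonneg_left h4 h5]
  rcases le_total 0 t with h | h
  · exact key t h
  · have := key (-t) (by linarith)
    rwa [kk_odd P he, abs_neg] at this

lemma cc_lin {G G' : ℝ → ℝ} {M M' : ℝ} (hG : Continuous G) (hM : ∀ t, |G t| ≤ M) (hG' : Continuous G') (hM' : ∀ t, |G' t| ≤ M') (a : ℝ) :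
    cc P (fun t => a * G t + G' t) = a * cc P G + cc P G' := by
  rw [cc, cc, cc, mul_div_assoc', ← add_div]
  congr 1
  rw [← integral_const_mul, ← integral_add ((mul_om_int P hG hM 0).const_mul a) (mul_om_int P hG' hM' 0)]
  congr 1; funext s; ring

lemma kk_lin {G G' : ℝ → ℝ} {M M' : ℝ} (hG : Continuous G) (hM : ∀ t, |G t| ≤ M) (hG' : Continuous G') (hM' : ∀ t, |G' t| ≤ M') (a : ℝ) (t : ℝ) :
    kk P (fun t => a * G t + G' t) t = a * kk P G t + kk P G' t := by
  rw [kk, kk, kk, mul_div_assoc', ← add_div]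
  congr 1
  rw [← intervalIntegral.integral_const_mul, ← intervalIntegral.integral_add]
  · congr 1; funext s; simp only [Gp]; rw [cc_lin P hG hM hG' hM']; ring
  · exact (((Gp_cont P hG).mul P.om_cont).const_mul a).intervalIntegrable _ _
  · exact ((Gp_cont P hG').mul P.om_cont).intervalIntegrable _ _

end Kop


section KG
open Topology MeasureTheory
variable (P : Prof) {m : ℕ} {σ : ℝ}

noncomputable def cG (g : XX m → ℝ) (y : EuclideanSpace ℝ (Fin m)) : ℝ := cc P (fun s => g (y, s))
noncomputable def kG (g : XX m → ℝ) (x : XX m) : ℝ := kk P (fun s => g (x.1, s)) x.2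
noncomputable def gperp (g : XX m → ℝ) (x : XX m) : ℝ := g x - cG P g x.1 * P.om x.2
noncomputable def ktG (g : XX m → ℝ) (x : XX m) : ℝ := gperp P g x - P.q x.2 * kG P g x

lemma Prof.om_lip (s t : ℝ) : |P.om s - P.om t| ≤ (P.c * P.c) * |s - t| := by
  refine Convex.norm_image_sub_le_of_norm_hasDerivWithin_le (s := univ) (x := t) (y := s)
      (fun t _ => (P.hom t).hasDerivWithinAt) (fun t _ => ?_) convex_univ trivial trivial
  rw [norm_neg]
  exact (P.Fo_bd t).trans (mul_le_mul_of_nonneg_left (P.om_bd t) P.c_pos.le)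
lemma Prof.om_abs (t : ℝ) : |P.om t| ≤ P.c := by rw [abs_of_pos (P.om_pos t)]; exact P.om_bd t

lemma kG_deriv {g : XX m → ℝ} (hg : Continuous g) (x : XX m) :
    HasDerivAt (fun t => kG P g (x.1, t)) (ktG P g x) x.2 :=
  kk_deriv P (G := fun s => g (x.1, s)) (by fun_prop) x.2

lemma kG_odd {g : XX m → ℝ} (he : ∀ y t, g (y, -t) = g (y, t)) (y : EuclideanSpace ℝ (Fin m)) (t : ℝ) :
    kG P g (y, -t) = -kG P g (y, t) := kk_odd P (fun t => he y t) t

lemma gperp_even {g : XX m → ℝ} (he : ∀ y t, g (y, -t) = g (y, t)) (y : EuclideanSpace ℝ (Fin m)) (t : ℝ) :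
    gperp P g (y, -t) = gperp P g (y, t) := by simp only [gperp]; rw [he, P.om_even]

lemma ktG_even {g : XX m → ℝ} (he : ∀ y t, g (y, -t) = g (y, t)) (y : EuclideanSpace ℝ (Fin m)) (t : ℝ) :
    ktG P g (y, -t) = ktG P g (y, t) := by
  simp only [ktG]; rw [gperp_even P he, kG_odd P he, P.q_odd]; ring

lemma cG_lin {g g' : XX m → ℝ} {M M' : ℝ} (hG : Continuous g) (hM : ∀ x, |g x| ≤ M) (hG' : Continuous g') (hM' : ∀ x, |g' x| ≤ M') (a : ℝ)
    (y : EuclideanSpace ℝ (Fin m)) : cG P (fun x => a * g x + g' x) y = a * cG P g y + cG P g' y :=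
  cc_lin P (G := fun s => g (y, s)) (G' := fun s => g' (y, s)) (by fun_prop) (fun t => hM _) (by fun_prop) (fun t => hM' _) a

lemma kG_lin {g g' : XX m → ℝ} {M M' : ℝ} (hG : Continuous g) (hM : ∀ x, |g x| ≤ M) (hG' : Continuous g') (hM' : ∀ x, |g' x| ≤ M') (a : ℝ)
    (x : XX m) : kG P (fun x => a * g x + g' x) x = a * kG P g x + kG P g' x :=
  kk_lin P (G := fun s => g (x.1, s)) (G' := fun s => g' (x.1, s)) (by fun_prop) (fun t => hM _) (by fun_prop) (fun t => hM' _) a _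

lemma kG_holder (m : ℕ) (s0 : 0 < σ) (s1 : σ < 1) : ∃ C ≥ (0:ℝ), ∀ (g : XX m → ℝ) (K : ℝ), 0 ≤ K → HolderLe σ univ g K →
    (∀ y t, g (y, -t) = g (y, t)) →
    HolderLe σ univ (cG P g) (C * K) ∧ HolderLe σ univ (gperp P g) (C * K) ∧ HolderLe σ univ (kG P g) (C * K) ∧
    HolderLe σ univ (ktG P g) (C * K) := by
  have hc := P.c_pos
  have hI := I2_pos P
  set A1 := 1 / I2 P
  have hA1 : 0 < A1 := by positivity
  set A2 := P.c * (1 + A1 * P.c) with hA2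
  have hA2p : 0 < A2 := by positivity
  set D := 2 * P.c + P.c * P.c
  have hD : 0 < D := by positivity
  set C2 := 1 + 2 * (A1 * D) with hC2
  have hC2p : 0 < C2 := by positivity
  set A3 := (1 + A1 * P.c) + P.c * A2
  have hA3 : 0 < A3 := by positivity
  set C3 := 4 * (A2 + A3)
  have hC3 : 0 < C3 := by positivity
  set Dq := 2 * P.c + (P.c + P.c ^ 2)
  have hDq : 0 < Dq := by positivity
  set C4 := C2 + 2 * (Dq * C3)
  have hC4 : 0 < C4 := by positivity
  have main : ∀ (g : XX m → ℝ) (K : ℝ), 0 ≤ K → HolderLe σ univ g K → (∀ y t, g (y, -t) = g (y, t)) →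
    HolderLe σ univ (cG P g) (A1 * K) ∧ HolderLe σ univ (gperp P g) (C2 * K) ∧ HolderLe σ univ (kG P g) (C3 * K) ∧
    HolderLe σ univ (ktG P g) (C4 * K) := by
    intro g K hK H he
    have hgc : Continuous g := H.continuous' s0
    have hb : ∀ x, |g x| ≤ K := fun x => H.1 x trivial
    have hdiff : ∀ y y' s, |(-1) * g (y', s) + g (y, s)| ≤ K * dist y y' ^ σ := by
      intro y y' s
      have := H.2 (y, s) trivial (y', s) trivial
      rw [Prod.dist_eq, dist_self, max_eq_left dist_nonneg] at this
      rw [show (-1) * g (y', s) + g (y, s) = g (y, s) - g (y', s) by ring]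
      exact this
    have hcG : HolderLe σ univ (cG P g) (A1 * K) := by
      refine ⟨fun y _ => cc_bd P (by fun_prop) (fun t => hb _), fun y _ y' _ => ?_⟩
      have h1 := cc_lin P (G := fun s => g (y', s)) (G' := fun s => g (y, s)) (by fun_prop) (fun t => hb _) (by fun_prop) (fun t => hb _) (-1)
      have h2 := cc_bd P (G := fun s => (-1) * g (y', s) + g (y, s)) (by fun_prop) (hdiff y y')
      rw [h1] at h2
      rw [mul_assoc]
      refine le_trans (le_of_eq ?_) h2
      rw [Real.norm_eq_abs]; congr 1; simp only [cG]; ring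
    have hgp : HolderLe σ univ (gperp P g) (C2 * K) := by
      have h1 := hcG.comp (s := (univ : Set (XX m))) s0.le (by positivity) (φ := fun x : XX m => x.1) (fun _ _ => trivial) (fun x y => le_max_left _ _)
      have h2 := holder_fst_snd (m := m) s0 s1 (by positivity) P.om_abs P.om_lip univ
      refine (H.sub (h1.mul (by positivity) (by positivity) h2)).mono (le_of_eq ?_)
      simp only [hC2, D]; ring
    have hkb : ∀ x, |kG P g x| ≤ A2 * K := fun x => (kk_bd P (G := fun s => g (x.1, s)) (by fun_prop) (fun t => he _ t) (fun t => hb _) _).trans (le_of_eq (by rw [hA2]; ring))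
    have hk : HolderLe σ univ (kG P g) (C3 * K) := by
      have hkt : ∀ x, |ktG P g x| ≤ A3 * K := by
        intro x
        have h1 : |gperp P g x| ≤ (1 + A1 * P.c) * K := Gp_bd P (G := fun s => g (x.1, s)) (by fun_prop) (fun t => hb _) x.2
        calc |ktG P g x| ≤ |gperp P g x| + |P.q x.2 * kG P g x| := abs_sub _ _
          _ ≤ (1 + A1 * P.c) * K + P.c * (A2 * K) := by
            rw [abs_mul]; have := P.q_bd x.2; have := hkb x; gcongr
          _ = _ := by ring
      refine (holder_sep s0 s1 (A := (A2 + A3) * K) (by positivity) (fun x => (hkb x).trans ?_) (fun y y' t => ?_) (fun y t t' => ?_)).mono (le_of_eq (by ring))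
      · gcongr; linarith
      · have h1 := kk_lin P (G := fun s => g (y', s)) (G' := fun s => g (y, s)) (by fun_prop) (fun t => hb _) (by fun_prop) (fun t => hb _) (-1) t
        have h2 := kk_bd P (G := fun s => (-1) * g (y', s) + g (y, s)) (by fun_prop) (fun t => by rw [he, he]) (hdiff y y') t
        rw [h1] at h2
        have e : kG P g (y, t) - kG P g (y', t) = -1 * kk P (fun s => g (y', s)) t + kk P (fun s => g (y, s)) t := by simp only [kG]; ring
        rw [e]
        refine h2.trans ?_
        have : 0 ≤ K * dist y y' ^ σ := mul_nonneg hK (Real.rpow_nonneg dist_nonneg _)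
        calc _ = A2 * (K * dist y y' ^ σ) := by rw [hA2]; ring
          _ ≤ (A2 + A3) * (K * dist y y' ^ σ) := by gcongr; linarith
          _ = _ := by ring
      · have := Convex.norm_image_sub_le_of_norm_hasDerivWithin_le (s := univ) (x := t') (y := t) (f := fun t => kG P g (y, t))
          (fun t _ => (kG_deriv P hgc (y, t)).hasDerivWithinAt) (fun t _ => hkt (y, t)) convex_univ trivial trivial
        refine this.trans ?_
        rw [Real.norm_eq_abs]
        gcongr; linarith
    refine ⟨hcG, hgp, hk, ?_⟩
    have h2 := holder_fst_snd (m := m) s0 s1 (by positivity) P.q_bd P.q_lip univ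
    refine (hgp.sub (h2.mul (by positivity) (by positivity) hk)).mono (le_of_eq ?_)
    simp only [C4, Dq]; ring
  refine ⟨A1 + C2 + C3 + C4, by positivity, fun g K hK H he => ?_⟩
  obtain ⟨a, b, c, d⟩ := main g K hK H he
  exact ⟨a.mono (by gcongr; linarith), b.mono (by gcongr; linarith), c.mono (by gcongr; linarith), d.mono (by gcongr; linarith)⟩
end KG


section ZReg
open Topology MeasureTheory
variable (P : Prof) {m : ℕ} {σ : ℝ}

def ZSol (k ζ : XX m → ℝ) : Prop := Continuous ζ ∧ (∃ A, ∀ x, |ζ x| ≤ A) ∧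
  ∀ x, ζ x = Rg m P.B (fun x => -k x + (P.B - P.b x.2) * ζ x) x

open Classical in
noncomputable def Zt (k : XX m → ℝ) : XX m → ℝ := if h : ∃ ζ, ZSol P k ζ then h.choose else 0

lemma Zt_eq {k ζ : XX m → ℝ} {M : ℝ} (hk : Continuous k) (hM : ∀ x, |k x| ≤ M) (h : ZSol P k ζ) : Zt P k = ζ := by
  have hex : ∃ ζ, ZSol P k ζ := ⟨ζ, h⟩
  have h1 : ZSol P k (Zt P k) := by rw [Zt, dif_pos hex]; exact hex.choose_spec
  obtain ⟨c, ⟨A, hA⟩, e⟩ := h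
  obtain ⟨c', ⟨A', hA'⟩, e'⟩ := h1
  funext x
  exact zeta_unique P m hk hM c' hA' c hA e' e x

lemma Zt_spec (m : ℕ) : ∃ C ≥ (0:ℝ), ∀ (k : XX m → ℝ) (M : ℝ), Continuous k → (∀ x, |k x| ≤ M) →
    ZSol P k (Zt P k) ∧ ∀ x, |Zt P k x| ≤ C * M := by
  obtain ⟨C, hC, h⟩ := zeta_ex P m
  refine ⟨C, hC, fun k M hk hM => ?_⟩
  obtain ⟨ζ, h1, h2, h3⟩ := h k M hk hM
  have : Zt P k = ζ := Zt_eq P hk hM ⟨h1, ⟨_, h2⟩, h3⟩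
  rw [this]
  exact ⟨⟨h1, ⟨_, h2⟩, h3⟩, h2⟩

lemma bb_bd (t : ℝ) : |P.B - P.b t| ≤ 2 * P.B := by
  have := abs_le.1 (P.b_bd t); rw [abs_le]; have := P.B_pos; constructor <;> linarith

lemma HH_bd {k ζ : XX m → ℝ} {M A : ℝ} (hM : ∀ x, |k x| ≤ M) (hA : ∀ x, |ζ x| ≤ A) (x : XX m) :
    |-k x + (P.B - P.b x.2) * ζ x| ≤ M + 2 * P.B * A := by
  refine (abs_add_le _ _).trans ?_
  rw [abs_neg, abs_mul]
  exact add_le_add (hM x) (mul_le_mul (bb_bd P _) (hA x) (abs_nonneg _) (by have := P.B_pos; positivity))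

lemma Zt_lin {k k' : XX m → ℝ} {M M' : ℝ} (hk : Continuous k) (hM : ∀ x, |k x| ≤ M) (hk' : Continuous k') (hM' : ∀ x, |k' x| ≤ M') (a : ℝ) :
    Zt P (fun x => a * k x + k' x) = fun x => a * Zt P k x + Zt P k' x := by
  obtain ⟨C, hC, h⟩ := Zt_spec P m
  obtain ⟨⟨c, ⟨A, hA⟩, e⟩, -⟩ := h k M hk hM
  obtain ⟨⟨c', ⟨A', hA'⟩, e'⟩, -⟩ := h k' M' hk' hM'
  have hbc := P.b_cont
  have hB := P.B_pos
  refine Zt_eq P (M := |a| * M + M') (by fun_prop) (fun x => ?_) ⟨by fun_prop, ⟨|a| * A + A', fun x => ?_⟩, fun x => ?_⟩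
  · refine (abs_add_le _ _).trans ?_
    rw [abs_mul]; have := hM x; have := hM' x; gcongr
  · refine (abs_add_le _ _).trans ?_
    rw [abs_mul]; have := hA x; have := hA' x; gcongr
  · have h1 := Rg_add hB (h := fun x => a * (-k x + (P.B - P.b x.2) * Zt P k x)) (h' := fun x => -k' x + (P.B - P.b x.2) * Zt P k' x)
      (by fun_prop) (M := |a| * (M + 2 * P.B * A)) (fun x => by rw [abs_mul]; exact mul_le_mul_of_nonneg_left (HH_bd P hM hA x) (abs_nonneg _))
      (by fun_prop) (HH_bd P hM' hA') x
    rw [Rg_smul, ← e x, ← e' x] at h1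
    show a * Zt P k x + Zt P k' x = Rg m P.B (fun x => -(a * k x + k' x) + (P.B - P.b x.2) * (a * Zt P k x + Zt P k' x)) x
    rw [← h1]
    congr 1; funext x; ring

lemma Zt_odd {k : XX m → ℝ} {M : ℝ} (hk : Continuous k) (hM : ∀ x, |k x| ≤ M) (ho : ∀ y t, k (y, -t) = -k (y, t))
    (y : EuclideanSpace ℝ (Fin m)) (t : ℝ) : Zt P k (y, -t) = -Zt P k (y, t) := by
  obtain ⟨C, hC, h⟩ := Zt_spec P m
  obtain ⟨⟨c, ⟨A, hA⟩, e⟩, -⟩ := h k M hk hM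
  have : Zt P k = fun x => -Zt P k (x.1, -x.2) := by
    refine Zt_eq P hk hM ⟨by fun_prop, ⟨A, fun x => by rw [abs_neg]; exact hA _⟩, fun x => ?_⟩
    have h1 := e (x.1, -x.2)
    have h2 := Rg_reflect (μ := P.B) (h := fun x => -k x + (P.B - P.b x.2) * Zt P k x) (h' := fun x => (-1) * (-k x + (P.B - P.b x.2) * -Zt P k (x.1, -x.2))) (fun y t => by
      simp only; rw [ho, P.b_even]; ring) x.1 x.2
    rw [Rg_smul] at h2
    show -Zt P k (x.1, -x.2) = Rg m P.B (fun x => -k x + (P.B - P.b x.2) * -Zt P k (x.1, -x.2)) x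
    rw [h1, h2]; ring
  rw [congrFun this (y, t)]; simp

lemma v_mul_deriv {z z1 : ℝ → ℝ} (hz : ∀ t, HasDerivAt z (z1 t) t) (ho : ∀ t, z (-t) = -z t) (t : ℝ) :
    HasDerivAt (fun t => P.v t * z t) (P.v t * z1 t + P.dv t * z |t|) t := by
  have he : ∀ t, z1 (-t) = z1 t := by
    intro t
    have h1 := ((hz (-t)).scomp t (hasDerivAt_neg t)).fun_neg
    have h2 : (fun x => -(z ∘ Neg.neg) x) = z := by funext s; simp [ho]
    rw [h2] at h1
    simpa using h1.unique (hz t)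
  have hp : ∀ t, 0 ≤ t → HasDerivWithinAt (fun t => P.v t * z t) (P.v t * z1 t + P.dv t * z t) (Ici 0) t := by
    intro t ht
    exact ((P.hv t ht).fun_mul (hz t).hasDerivWithinAt).congr_deriv (by ring)
  refine glue (fun ht => ?_) (fun ht => ?_)
  · rw [abs_of_nonneg ht]; exact hp t ht
  · have h1 := (refl_deriv hp ht).fun_neg
    have h2 : (fun s => -(P.v (-s) * z (-s))) = fun t => P.v t * z t := by funext s; rw [ho, P.v_even]; ring
    rw [h2] at h1
    refine h1.congr_deriv ?_
    rw [abs_of_nonpos ht, he, P.v_even, P.dv_even]; ring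

lemma Prof.b_lip (s t : ℝ) : |P.b s - P.b t| ≤ (4 * P.c * (P.c + P.c^2) + P.c) * |s - t| := by
  have h1 := P.q_lip s t
  have h2 := P.v_lip s t
  have e : P.b s - P.b t = 2 * ((P.q s + P.q t) * (P.q s - P.q t)) + (P.v s - P.v t) := by simp only [Prof.b]; ring
  have hc := P.c_pos
  rw [e]
  calc _ ≤ |2 * ((P.q s + P.q t) * (P.q s - P.q t))| + |P.v s - P.v t| := abs_add_le _ _
    _ ≤ 2 * ((P.c + P.c) * ((P.c + P.c ^ 2) * |s - t|)) + P.c * |s - t| := by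
      rw [abs_mul, abs_mul, abs_two]
      have : |P.q s + P.q t| ≤ P.c + P.c := (abs_add_le _ _).trans (add_le_add (P.q_bd _) (P.q_bd _))
      gcongr
    _ = _ := by ring

lemma Prof.q1_lip (s t : ℝ) : |P.q1 s - P.q1 t| ≤ (2 * P.c * (P.c + P.c^2) + P.c) * |s - t| := by
  have h1 := P.q_lip s t
  have h2 := P.v_lip s t
  have e : P.q1 s - P.q1 t = -((P.q s + P.q t) * (P.q s - P.q t)) - (P.v s - P.v t) := by simp only [Prof.q1]; ring
  have hc := P.c_pos
  rw [e]
  calc _ ≤ |-((P.q s + P.q t) * (P.q s - P.q t))| + |P.v s - P.v t| := abs_sub _ _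
    _ ≤ ((P.c + P.c) * ((P.c + P.c ^ 2) * |s - t|)) + P.c * |s - t| := by
      rw [abs_neg, abs_mul]
      have : |P.q s + P.q t| ≤ P.c + P.c := (abs_add_le _ _).trans (add_le_add (P.q_bd _) (P.q_bd _))
      gcongr
    _ = _ := by ring

lemma q1_even (t : ℝ) : P.q1 (-t) = P.q1 t := by simp only [Prof.q1]; rw [P.q_odd, P.v_even]; ring

/-- bundle of conclusions -/
def ZConc (P : Prof) (σ : ℝ) (g ζ : XX m → ℝ) (K : ℝ) : Prop :=
  ∃ (Z1 : XX m → XX m →L[ℝ] ℝ) (Z2 : XX m → XX m →L[ℝ] XX m →L[ℝ] ℝ) (U1 : XX m → XX m →L[ℝ] ℝ) (U2 : XX m → XX m →L[ℝ] XX m →L[ℝ] ℝ),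
    (∀ x, HasFDerivAt ζ (Z1 x) x) ∧ (∀ x, HasFDerivAt Z1 (Z2 x) x) ∧
    HolderLe σ univ ζ K ∧ HolderLe σ univ Z1 K ∧ HolderLe σ univ Z2 K ∧
    (∀ x, HasFDerivAt (fun x => Z1 x (0, 1)) (U1 x) x) ∧ (∀ x, HasFDerivAt U1 (U2 x) x) ∧
    HolderLe σ univ (fun x => Z1 x (0, 1)) K ∧ HolderLe σ univ U1 K ∧ HolderLe σ univ U2 K ∧
    (∀ y, ζ (y, 0) = 0) ∧ (∀ y, U1 (y, 0) (0, 1) = 0) ∧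
    (∀ x, trX m (Z2 x) = kG P g x + P.b x.2 * ζ x) ∧
    (∀ x : XX m, 0 ≤ x.2 → trX m (U2 x) = ktG P g x + P.b x.2 * Z1 x (0, 1) + (4 * P.q x.2 * P.q1 x.2 + P.dv x.2) * ζ x)

lemma norm01 : ‖((0 : EuclideanSpace ℝ (Fin m)), (1:ℝ))‖ ≤ 1 := by
  rw [Prod.norm_def]; simp

lemma t_deriv {u : XX m → ℝ} {u1 : XX m →L[ℝ] ℝ} {y : EuclideanSpace ℝ (Fin m)} {t : ℝ} (h : HasFDerivAt u u1 (y, t)) :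
    HasDerivAt (fun s => u (y, s)) (u1 (0, 1)) t := by
  have h2 : HasDerivAt (fun s : ℝ => ((y, s) : XX m)) ((0, 1) : XX m) t := (hasDerivAt_const t y).prodMk (hasDerivAt_id t)
  exact h.comp_hasDerivAt t h2

set_option maxHeartbeats 800000 in
lemma zeta_reg (m : ℕ) (s0 : 0 < σ) (s1 : σ < 1) : ∃ C ≥ (0:ℝ), ∀ (g : XX m → ℝ) (K : ℝ), 0 ≤ K → HolderLe σ univ g K →
    (∀ y t, g (y, -t) = g (y, t)) → ZConc P σ g (Zt P (kG P g)) (C * K) := by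
  have hc := P.c_pos
  have hB := P.B_pos
  obtain ⟨Ck, hCk, Hk⟩ := kG_holder P m s0 s1
  obtain ⟨Cz, hCz, Hz⟩ := Zt_spec P m
  obtain ⟨Cb, hCb, Hb⟩ := Rg_bd_holder m hB s0 s1
  obtain ⟨Ch, hCh, Hh⟩ := Rg_holder m hB s0 s1
  -- Hölder constants of coefficient functions
  set Lb := 4 * P.c * (P.c + P.c^2) + P.c with hLb
  have hLbp : 0 < Lb := by positivity
  set Db := 2 * (2 * P.B) + Lb with hDb
  have hDbp : 0 < Db := by positivity
  have hBb : HolderLe σ (univ : Set (XX m)) (fun x => P.B - P.b x.2) Db := by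
    refine holder_fst_snd (u := fun t => P.B - P.b t) s0 s1 hLbp.le (bb_bd P) (fun s t => ?_) univ
    rw [show P.B - P.b s - (P.B - P.b t) = -(P.b s - P.b t) by ring, abs_neg]
    exact P.b_lip s t
  set Dq := 2 * P.c + (P.c + P.c ^ 2)
  have hDq : 0 < Dq := by positivity
  have hq := holder_fst_snd (m := m) s0 s1 (by positivity) P.q_bd P.q_lip univ
  set Dq1 := 2 * (P.c + P.c ^ 2) + (2 * P.c * (P.c + P.c^2) + P.c)
  have hDq1 : 0 < Dq1 := by positivity
  have hq1 := holder_fst_snd (m := m) s0 s1 (by positivity) P.q1_bd P.q1_lip univ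
  set Dd := 2 * P.c + P.c
  have hDd : 0 < Dd := by positivity
  have hdv := holder_fst_snd (m := m) s0 s1 (by positivity) P.dv_bd P.dv_lip univ
  -- Hölder constants
  set C1 := Cb * (Ck + 2 * P.B * (Cz * Ck)) with hC1
  have hC1p : 0 ≤ C1 := by positivity
  set C2 := Ck + 2 * (Db * C1) with hC2
  have hC2p : 0 ≤ C2 := by positivity
  set C3 := Ch * C2 with hC3
  have hC3p : 0 ≤ C3 := by positivity
  set C4 := Ck + 2 * (Db * C3) + 4 * (2 * (2 * (Dq * Dq1) * C1)) + 2 * (Dd * C1) with hC4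
  have hC4p : 0 ≤ C4 := by positivity
  set C5 := Ch * C4 with hC5
  have hC5p : 0 ≤ C5 := by positivity
  refine ⟨C1 + C3 + C5, by positivity, fun g K hK H he => ?_⟩
  have hgc : Continuous g := H.continuous' s0
  obtain ⟨-, -, hk, hkt⟩ := Hk g K hK H he
  set k := kG P g with hkdef
  have hkc : Continuous k := hk.continuous' s0
  have hkb : ∀ x, |k x| ≤ Ck * K := fun x => hk.1 x trivial
  obtain ⟨⟨zc, -, ze⟩, zb⟩ := Hz k _ hkc hkb
  have zo := Zt_odd P hkc hkb (kG_odd P he)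
  set ζ := Zt P k with hζdef
  set Hf : XX m → ℝ := fun x => -k x + (P.B - P.b x.2) * ζ x with hHf
  have hHb : ∀ x, |Hf x| ≤ Ck * K + 2 * P.B * (Cz * (Ck * K)) := HH_bd P hkb zb
  have hbc := P.b_cont
  have hHc : Continuous Hf := by fun_prop
  have hζH : ζ = Rg m P.B Hf := funext ze
  have hζ1 : HolderLe σ univ ζ (C1 * K) := by
    rw [hζH]
    refine (Hb Hf _ (by positivity) hHc hHb).mono (le_of_eq ?_)
    rw [hC1]; ring
  have hHH : HolderLe σ univ Hf (C2 * K) := by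
    refine (hk.neg.add (hBb.mul hDbp.le (by positivity) hζ1)).mono (le_of_eq ?_)
    rw [hC2]; ring
  obtain ⟨r0, r1, r2⟩ := Hh Hf _ (by positivity) hHH
  set Z1 := Rg1 m P.B Hf with hZ1
  set Z2 := Rg2 m P.B Hf with hZ2
  have dζ : ∀ x, HasFDerivAt ζ (Z1 x) x := fun x => by rw [hζH]; exact Rg_hasFDerivAt hB hHc hHb x
  have dZ1 : ∀ x, HasFDerivAt Z1 (Z2 x) x := fun x => Rg1_hasFDerivAt hB s0 s1 (by positivity) hHH x
  have hU : HolderLe σ univ (fun x => Z1 x (0, 1)) (C3 * K) := by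
    refine ⟨fun x _ => ?_, fun x _ y _ => ?_⟩
    · refine ((Z1 x).le_opNorm _).trans ?_
      have h1 := r1.1 x trivial
      have h2 := norm01 (m := m)
      calc _ ≤ ‖Z1 x‖ * 1 := mul_le_mul_of_nonneg_left h2 (norm_nonneg _)
        _ ≤ _ := by rw [mul_one, hC3, mul_assoc]; exact h1
    · have e : Z1 x (0, 1) - Z1 y (0, 1) = (Z1 x - Z1 y) (0, 1) := rfl
      rw [e]
      refine ((Z1 x - Z1 y).le_opNorm _).trans ?_
      have h1 := r1.2 x trivial y trivial
      have h2 := norm01 (m := m)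
      calc _ ≤ ‖Z1 x - Z1 y‖ * 1 := mul_le_mul_of_nonneg_left h2 (norm_nonneg _)
        _ ≤ _ := by rw [mul_one, hC3, mul_assoc Ch]; exact h1
  -- t-derivative of Hf
  set Ht : XX m → ℝ := fun x => -ktG P g x + (P.B - P.b x.2) * Z1 x (0, 1) - 4 * (P.q x.2 * P.q1 x.2 * ζ x) - P.dv x.2 * ζ (x.1, |x.2|) with hHt
  have hHtH : HolderLe σ univ Ht (C4 * K) := by
    have e1 := hkt.neg.add (hBb.mul hDbp.le (by positivity) hU)
    have e2 := ((hq.mul hDq.le hDq1.le hq1).mul (by positivity) (by positivity) hζ1)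
    have e3 : HolderLe σ univ (fun x : XX m => 4 * (P.q x.2 * P.q1 x.2 * ζ x)) (4 * (2 * (2 * (Dq * Dq1) * (C1 * K)))) := by
      refine ⟨fun x hx => ?_, fun x hx y hy => ?_⟩
      · rw [norm_mul, Real.norm_of_nonneg (by norm_num : (0:ℝ) ≤ 4)]
        exact mul_le_mul_of_nonneg_left (e2.1 x hx) (by norm_num)
      · rw [← mul_sub, norm_mul, Real.norm_of_nonneg (by norm_num : (0:ℝ) ≤ 4), mul_assoc 4]
        exact mul_le_mul_of_nonneg_left (e2.2 x hx y hy) (by norm_num)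
    have e4 := hζ1.comp (s := (univ : Set (XX m))) s0.le (by positivity) (φ := fun x : XX m => (x.1, |x.2|)) (fun _ _ => trivial)
      (fun x y => max_le_max le_rfl (abs_abs_sub_abs_le _ _))
    have e5 := hdv.mul hDd.le (by positivity) e4
    refine ((e1.sub e3).sub e5).mono (le_of_eq ?_)
    rw [hC4]; ring
  have zodd : ∀ y t, HasDerivAt (fun s => ζ (y, s)) (Z1 (y, t) (0, 1)) t := fun y t => t_deriv (dζ (y, t))
  have z0 : ∀ y, ζ (y, 0) = 0 := fun y => by have := zo y 0; rw [neg_zero] at this; linarith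
  have dH : ∀ x : XX m, HasDerivAt (fun t => Hf (x.1, t)) (Ht x) x.2 := by
    intro x
    have h1 := kG_deriv P hgc x
    have h2 := v_mul_deriv P (z := fun t => ζ (x.1, t)) (zodd x.1) (zo x.1) x.2
    have h3 := zodd x.1 x.2
    have h4 := (((P.hq x.2).fun_pow 2).const_mul 2).fun_mul h3
    have h5 := (((h1.fun_neg.fun_add (h3.const_mul P.B)).fun_sub h4).fun_sub h2)
    have e : (fun t => Hf (x.1, t)) = fun t => -kG P g (x.1, t) + P.B * ζ (x.1, t) - 2 * P.q t ^ 2 * ζ (x.1, t) - P.v t * ζ (x.1, t) := by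
      funext t; simp only [hHf, Prof.b, hkdef]; ring
    rw [e]
    refine h5.congr_deriv ?_
    simp only [hHt, Prof.b]; push_cast; ring
  have dH' : ∀ x : XX m, HasDerivAt (fun s : ℝ => Hf (x + s • ((0, 1) : XX m))) (Ht x) 0 := by
    intro x
    have h1 : HasDerivAt (fun s : ℝ => x.2 + s) 1 0 := (hasDerivAt_id 0).const_add x.2
    have h2 := HasDerivAt.comp (h₂ := fun t => Hf (x.1, t)) (h := fun s : ℝ => x.2 + s) (h₂' := Ht x) 0 (by simpa using dH x) h1
    rw [mul_one] at h2
    have e : (fun s : ℝ => Hf (x + s • ((0, 1) : XX m))) = (fun t => Hf (x.1, t)) ∘ fun s : ℝ => x.2 + s := by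
      funext s
      simp only [Function.comp]
      congr 1
      ext <;> simp
    rw [e]; exact h2
  have hUR : (fun x => Z1 x (0, 1)) = Rg m P.B Ht := funext fun x =>
    Rg_dir hB hHc hHb (hHtH.continuous' s0) (fun x => hHtH.1 x trivial) (0, 1) dH' x
  obtain ⟨u0, u1, u2⟩ := Hh Ht _ (by positivity) hHtH
  have dU : ∀ x, HasFDerivAt (fun x => Z1 x (0, 1)) (Rg1 m P.B Ht x) x := fun x => by
    rw [hUR]; exact Rg_hasFDerivAt hB (hHtH.continuous' s0) (fun x => hHtH.1 x trivial) x
  have k1 : C1 * K ≤ (C1 + C3 + C5) * K := by gcongr; linarith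
  have k3 : C3 * K ≤ (C1 + C3 + C5) * K := by gcongr; linarith
  have k3' : Ch * (C2 * K) ≤ (C1 + C3 + C5) * K := by rw [← mul_assoc]; exact k3
  have k5 : Ch * (C4 * K) ≤ (C1 + C3 + C5) * K := by rw [← mul_assoc]; gcongr; linarith
  refine ⟨Z1, Z2, Rg1 m P.B Ht, Rg2 m P.B Ht, dζ, dZ1, hζ1.mono k1, r1.mono k3', r2.mono k3', dU, fun x => Rg1_hasFDerivAt hB s0 s1 (by positivity) hHtH x,
    hU.mono k3, u1.mono k5, u2.mono k5, z0, fun y => ?_, fun x => ?_, fun x hx => ?_⟩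
  · have Ue : ∀ t, Z1 (y, -t) (0, 1) = Z1 (y, t) (0, 1) := by
      intro t
      have h1 := ((zodd y (-t)).scomp t (hasDerivAt_neg t)).fun_neg
      have h2 : (fun x => -((fun s => ζ (y, s)) ∘ Neg.neg) x) = fun s => ζ (y, s) := by funext s; simp [zo]
      rw [h2] at h1
      simpa using h1.unique (zodd y t)
    have h1 : HasDerivAt (fun t => Z1 (y, t) (0, 1)) (Rg1 m P.B Ht (y, 0) (0, 1)) 0 := t_deriv (u := fun x => Z1 x (0, 1)) (dU (y, 0))
    have h2 : HasDerivAt (fun t => Z1 (y, t) (0, 1)) (Rg1 m P.B Ht (y, 0) (0, 1)) (-0) := by rw [neg_zero]; exact h1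
    have h3 := h2.scomp 0 (hasDerivAt_neg 0)
    have h4 : (fun t => Z1 (y, t) (0, 1)) ∘ Neg.neg = fun t => Z1 (y, t) (0, 1) := by funext s; simp [Ue]
    rw [h4] at h3
    have h5 := h3.unique h1
    rw [neg_one_smul] at h5
    linarith
  · have h1 := Rg_eq hB s0 s1 (by positivity) hHH x
    rw [← hζH] at h1
    have h2 : Hf x = -k x + (P.B - P.b x.2) * ζ x := rfl
    rw [h2] at h1
    linarith
  · have h1 := Rg_eq hB s0 s1 (by positivity) hHtH x
    rw [← hUR] at h1
    have h2 : Ht x = -ktG P g x + (P.B - P.b x.2) * Z1 x (0, 1) - 4 * (P.q x.2 * P.q1 x.2 * ζ x) - P.dv x.2 * ζ x := by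
      simp only [hHt]; rw [abs_of_nonneg hx]
    rw [h2] at h1
    simp only at h1
    linarith
end ZReg


section C2calc
open Topology MeasureTheory
variable {m : ℕ} {σ : ℝ}

/-- twice differentiable on the closed half-space with Hölder bounds -/
structure C2h (m : ℕ) (σ : ℝ) (u : XX m → ℝ) (u1 : XX m → XX m →L[ℝ] ℝ) (u2 : XX m → XX m →L[ℝ] XX m →L[ℝ] ℝ) (K : ℝ) : Prop where
  d1 : ∀ x ∈ halfSpace m, HasFDerivWithinAt u (u1 x) (halfSpace m) x
  d2 : ∀ x ∈ halfSpace m, HasFDerivWithinAt u1 (u2 x) (halfSpace m) x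
  h0 : HolderLe σ (halfSpace m) u K
  h1 : HolderLe σ (halfSpace m) u1 K
  h2 : HolderLe σ (halfSpace m) u2 K

lemma C2h.mono {u : XX m → ℝ} {u1 u2} {K K' : ℝ} (h : C2h m σ u u1 u2 K) (hK : K ≤ K') : C2h m σ u u1 u2 K' :=
  ⟨h.d1, h.d2, h.h0.mono hK, h.h1.mono hK, h.h2.mono hK⟩

lemma C2h.add {u v : XX m → ℝ} {u1 u2 v1 v2} {K K' : ℝ} (h : C2h m σ u u1 u2 K) (h' : C2h m σ v v1 v2 K') :
    C2h m σ (fun x => u x + v x) (fun x => u1 x + v1 x) (fun x => u2 x + v2 x) (K + K') :=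
  ⟨fun x hx => (h.d1 x hx).fun_add (h'.d1 x hx), fun x hx => (h.d2 x hx).fun_add (h'.d2 x hx), h.h0.add h'.h0, h.h1.add h'.h1, h.h2.add h'.h2⟩

lemma half_unique : UniqueDiffOn ℝ (halfSpace m) := by
  have : halfSpace m = (univ : Set (EuclideanSpace ℝ (Fin m))) ×ˢ (Ici (0:ℝ)) := by
    ext x; simp [halfSpace]
  rw [this]
  exact uniqueDiffOn_univ.prod (uniqueDiffOn_Ici 0)

lemma HolderLe.continuousOn' {X Y : Type*} [PseudoMetricSpace X] [NormedAddCommGroup Y] {s : Set X} {h : X → Y} {K : ℝ} (s0 : 0 < σ)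
    (H : HolderLe σ s h K) : ContinuousOn h s := by
  rw [continuousOn_iff_continuous_restrict]
  refine HolderLe.continuous' (K := K) s0 (⟨fun x _ => H.1 x x.2, fun x _ y _ => H.2 x x.2 y y.2⟩ : HolderLe σ univ (s.restrict h) K)

section
variable {u : XX m → ℝ} {u1 : XX m → XX m →L[ℝ] ℝ} {u2 : XX m → XX m →L[ℝ] XX m →L[ℝ] ℝ} {K : ℝ}

lemma C2h.fd1 (h : C2h m σ u u1 u2 K) : ∀ x ∈ halfSpace m, fderivWithin ℝ u (halfSpace m) x = u1 x :=
  fun x hx => (h.d1 x hx).fderivWithin (half_unique x hx)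

lemma C2h.fd2 (h : C2h m σ u u1 u2 K) : ∀ x ∈ halfSpace m, fderivWithin ℝ (fderivWithin ℝ u (halfSpace m)) (halfSpace m) x = u2 x := by
  intro x hx
  rw [fderivWithin_congr h.fd1 (h.fd1 x hx)]
  exact (h.d2 x hx).fderivWithin (half_unique x hx)

lemma C2h.contDiffOn (s0 : 0 < σ) (h : C2h m σ u u1 u2 K) : ContDiffOn ℝ 2 u (halfSpace m) := by
  have e : (2 : WithTop ℕ∞) = (0 + 1) + 1 := by norm_num
  rw [e, contDiffOn_succ_iff_fderivWithin half_unique]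
  refine ⟨fun x hx => (h.d1 x hx).differentiableWithinAt, by simp, ?_⟩
  rw [contDiffOn_succ_iff_fderivWithin half_unique]
  refine ⟨fun x hx => ((h.d2 x hx).congr h.fd1 (h.fd1 x hx)).differentiableWithinAt, by simp, ?_⟩
  rw [contDiffOn_zero]
  exact (HolderLe.continuousOn' s0 h.h2).congr h.fd2

lemma C2h.holder_iter (hK : 0 ≤ K) (h : C2h m σ u u1 u2 K) : HolderLe σ (halfSpace m) (iteratedFDerivWithin ℝ 2 u (halfSpace m)) K := by
  refine ⟨fun x hx => ?_, fun x hx y hy => ?_⟩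
  · refine ContinuousMultilinearMap.opNorm_le_bound hK fun v => ?_
    rw [iteratedFDerivWithin_two_apply u half_unique hx, h.fd2 x hx, Fin.prod_univ_two, ← mul_assoc]
    refine ((u2 x (v 0)).le_opNorm _).trans ?_
    gcongr
    exact (u2 x).le_of_opNorm_le (h.h2.1 x hx) _
  · have hd := Real.rpow_nonneg (dist_nonneg (x := x) (y := y)) σ
    refine ContinuousMultilinearMap.opNorm_le_bound (mul_nonneg hK hd) fun v => ?_
    rw [ContinuousMultilinearMap.sub_apply, iteratedFDerivWithin_two_apply u half_unique hx, iteratedFDerivWithin_two_apply u half_unique hy, h.fd2 x hx, h.fd2 y hy, Fin.prod_univ_two, ← mul_assoc]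
    have e : (u2 x (v 0)) (v 1) - (u2 y (v 0)) (v 1) = ((u2 x - u2 y) (v 0)) (v 1) := rfl
    rw [e]
    refine (((u2 x - u2 y) (v 0)).le_opNorm _).trans ?_
    gcongr
    exact (u2 x - u2 y).le_of_opNorm_le (h.h2.2 x hx y hy) _

lemma half_nhds {x : XX m} (hx : 0 < x.2) : halfSpace m ∈ 𝓝 x := by
  have : {p : XX m | 0 < p.2} ∈ 𝓝 x := (isOpen_lt continuous_const continuous_snd).mem_nhds hx
  exact mem_of_superset this fun p (hp : 0 < p.2) => (show 0 ≤ p.2 from hp.le)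

lemma C2h.lap (h : C2h m σ u u1 u2 K) {x : XX m} (hx : 0 < x.2) : lapP u x = trX m (u2 x) := by
  have key : ∀ v : XX m, fderiv ℝ (fun y => fderiv ℝ u y v) x v = u2 x v v := by
    intro v
    have h1 : (fun y => fderiv ℝ u y v) =ᶠ[𝓝 x] fun y => u1 y v := by
      have : {p : XX m | 0 < p.2} ∈ 𝓝 x := (isOpen_lt continuous_const continuous_snd).mem_nhds hx
      filter_upwards [this] with y hy
      rw [((h.d1 y (le_of_lt hy)).hasFDerivAt (half_nhds hy)).fderiv]
    rw [h1.fderiv_eq]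
    have h2 : HasFDerivAt (fun y => u1 y v) ((ContinuousLinearMap.apply ℝ ℝ v).comp (u2 x)) x :=
      (ContinuousLinearMap.apply ℝ ℝ v).hasFDerivAt.comp x ((h.d2 x hx.le).hasFDerivAt (half_nhds hx))
    rw [h2.fderiv]; rfl
  rw [lapP, trX_apply, key]
  congr 1
  exact Finset.sum_congr rfl fun i _ => key _

lemma C2h.deriv0 (h : C2h m σ u u1 u2 K) (y : EuclideanSpace ℝ (Fin m)) :
    derivWithin (fun s : ℝ => u (y, s)) (Ici 0) 0 = u1 (y, 0) (0, 1) := by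
  have h2 : HasDerivWithinAt (fun s : ℝ => ((y, s) : XX m)) ((0, 1) : XX m) (Ici 0) 0 :=
    ((hasDerivAt_const _ y).prodMk (hasDerivAt_id _)).hasDerivWithinAt
  have h3 := (h.d1 (y, 0) (le_refl (0:ℝ))).comp_hasDerivWithinAt_of_eq (0:ℝ) h2 (fun s hs => hs) rfl
  exact h3.derivWithin (uniqueDiffOn_Ici _ _ self_mem_Ici)
end

lemma C2h.congr {u u' : XX m → ℝ} {u1 u2} {K : ℝ} (h : C2h m σ u u1 u2 K) (e : ∀ x ∈ halfSpace m, u' x = u x) : C2h m σ u' u1 u2 K :=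
  ⟨fun x hx => (h.d1 x hx).congr e (e x hx), h.d2, h.h0.congr e, h.h1, h.h2⟩

lemma HolderLe.smulR {X V Y : Type*} [PseudoMetricSpace X] [NormedAddCommGroup V] [NormedSpace ℝ V] [NormedAddCommGroup Y] [NormedSpace ℝ Y]
    {s : Set X} {h : X → V →L[ℝ] ℝ} {h' : X → Y} {K K' : ℝ} (hK : 0 ≤ K) (hK' : 0 ≤ K') (H : HolderLe σ s h K) (H' : HolderLe σ s h' K') :
    HolderLe σ s (fun x => (h x).smulRight (h' x)) (2 * (K * K')) := by
  have hKK : 0 ≤ K * K' := mul_nonneg hK hK'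
  refine ⟨fun x hx => ?_, fun x hx y hy => ?_⟩
  · rw [ContinuousLinearMap.norm_smulRight_apply]
    calc _ ≤ K * K' := mul_le_mul (H.1 x hx) (H'.1 x hx) (norm_nonneg _) hK
      _ ≤ _ := by linarith
  · have e : (h x).smulRight (h' x) - (h y).smulRight (h' y) = (h x - h y).smulRight (h' x) + (h y).smulRight (h' x - h' y) := by
      ext v; simp [sub_smul, smul_sub]
    have hd := Real.rpow_nonneg (dist_nonneg (x := x) (y := y)) σ
    simp only [e]
    refine (norm_add_le _ _).trans ?_
    rw [ContinuousLinearMap.norm_smulRight_apply, ContinuousLinearMap.norm_smulRight_apply]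
    calc _ ≤ (K * dist x y ^ σ) * K' + K * (K' * dist x y ^ σ) :=
        add_le_add (mul_le_mul (H.2 x hx y hy) (H'.1 x hx) (norm_nonneg _) (by positivity)) (mul_le_mul (H.1 y hy) (H'.2 x hx y hy) (norm_nonneg _) hK)
      _ = _ := by ring

lemma HolderLe.smul_const {X Y : Type*} [PseudoMetricSpace X] [NormedAddCommGroup Y] [NormedSpace ℝ Y]
    {s : Set X} {b : X → ℝ} {L : ℝ} (S : Y) (hb : HolderLe σ s b L) : HolderLe σ s (fun x => b x • S) (‖S‖ * L) := by
  refine ⟨fun x hx => ?_, fun x hx y hy => ?_⟩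
  · rw [norm_smul, mul_comm]; exact mul_le_mul_of_nonneg_left (hb.1 x hx) (norm_nonneg _)
  · rw [← sub_smul, norm_smul, mul_comm, mul_assoc]; exact mul_le_mul_of_nonneg_left (hb.2 x hx y hy) (norm_nonneg _)

lemma HolderLe.pull {X V V' Y Y' : Type*} [PseudoMetricSpace X] [NormedAddCommGroup V] [NormedSpace ℝ V] [NormedAddCommGroup V'] [NormedSpace ℝ V']
    [NormedAddCommGroup Y] [NormedSpace ℝ Y] [NormedAddCommGroup Y'] [NormedSpace ℝ Y']
    {s : Set X} {h : X → V' →L[ℝ] Y} {K : ℝ} (R : Y →L[ℝ] Y') (p : V →L[ℝ] V') (H : HolderLe σ s h K) :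
    HolderLe σ s (fun x => R.comp ((h x).comp p)) (‖R‖ * ‖p‖ * K) := by
  have key : ∀ A : V' →L[ℝ] Y, ∀ k, ‖A‖ ≤ k → ‖R.comp (A.comp p)‖ ≤ ‖R‖ * ‖p‖ * k := by
    intro A k hk
    calc _ ≤ ‖R‖ * (‖A‖ * ‖p‖) := (R.opNorm_comp_le _).trans (mul_le_mul_of_nonneg_left (A.opNorm_comp_le p) (norm_nonneg _))
      _ ≤ ‖R‖ * (k * ‖p‖) := by gcongr
      _ = _ := by ring
  refine ⟨fun x hx => key _ _ (H.1 x hx), fun x hx y hy => ?_⟩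
  have e : R.comp ((h x).comp p) - R.comp ((h y).comp p) = R.comp ((h x - h y).comp p) := by ext v; simp
  simp only [e]
  rw [mul_assoc]
  exact key _ _ (H.2 x hx y hy)

abbrev sndL (m : ℕ) : XX m →L[ℝ] ℝ := ContinuousLinearMap.snd ℝ (EuclideanSpace ℝ (Fin m)) ℝ

lemma t_fderiv {a : ℝ → ℝ} {a' : ℝ} {x : XX m} (h : HasDerivWithinAt a a' (Ici 0) x.2) :
    HasFDerivWithinAt (fun x : XX m => a x.2) (a' • sndL m) (halfSpace m) x :=
  h.comp_hasFDerivWithinAt (f := fun x : XX m => x.2) x (sndL m).hasFDerivWithinAt (fun y hy => hy)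

set_option maxHeartbeats 1000000 in
lemma C2h_tmul (m : ℕ) {σ : ℝ} {a a1 a2 : ℝ → ℝ} {D : ℝ} (hD : 0 ≤ D)
    (ha : ∀ t, 0 ≤ t → HasDerivWithinAt a (a1 t) (Ici 0) t) (ha1 : ∀ t, 0 ≤ t → HasDerivWithinAt a1 (a2 t) (Ici 0) t)
    (H0 : HolderLe σ (halfSpace m) (fun x => a x.2) D) (H1 : HolderLe σ (halfSpace m) (fun x => a1 x.2) D)
    (H2 : HolderLe σ (halfSpace m) (fun x => a2 x.2) D) :
    ∃ C ≥ (0:ℝ), ∀ (u : XX m → ℝ) (u1 : XX m → XX m →L[ℝ] ℝ) (u2 : XX m → XX m →L[ℝ] XX m →L[ℝ] ℝ) (K : ℝ), 0 ≤ K → C2h m σ u u1 u2 K →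
      ∃ v1 v2, C2h m σ (fun x => a x.2 * u x) v1 v2 (C * K) ∧ (∀ x v, v1 x v = a x.2 * u1 x v + a1 x.2 * v.2 * u x) ∧
        ∀ x, trX m (v2 x) = a x.2 * trX m (u2 x) + 2 * (a1 x.2 * u1 x (0, 1)) + a2 x.2 * u x := by
  set S := sndL m with hS
  set n1 := ‖S‖ with hn1
  have e1 : 0 ≤ n1 := norm_nonneg _
  set Q1 := 2 * D + n1 * (2 * D) with hQ1
  have hQ1p : 0 ≤ Q1 := by positivity
  set Q2 := 2 * D + 2 * (n1 * D) + 2 * (Q1 * n1) with hQ2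
  have hQ2p : 0 ≤ Q2 := by positivity
  refine ⟨2 * D + Q1 + Q2, by positivity, fun u u1 u2 K hK h => ?_⟩
  have hSc : ∀ {b : XX m → ℝ} {L : ℝ}, HolderLe σ (halfSpace m) b L → HolderLe σ (halfSpace m) (fun x => b x • S) (n1 * L) := by
    intro b L hb
    exact hb.smul_const S
  have f1 : ∀ {b b1 : ℝ → ℝ}, HolderLe σ (halfSpace m) (fun x => b x.2) D → HolderLe σ (halfSpace m) (fun x => b1 x.2) D →
      HolderLe σ (halfSpace m) (fun x => b x.2 • u1 x + (b1 x.2 * u x) • S) (Q1 * K) := by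
    intro b b1 hb hb1
    refine ((HolderLe.smul hD hK hb h.h1).add (hSc (HolderLe.mul hD hK hb1 h.h0))).mono (le_of_eq ?_)
    rw [hQ1]; ring
  have df : ∀ {b b1 : ℝ → ℝ}, (∀ t, 0 ≤ t → HasDerivWithinAt b (b1 t) (Ici 0) t) → ∀ x ∈ halfSpace m, 
      HasFDerivWithinAt (fun x => b x.2 * u x) (b x.2 • u1 x + (b1 x.2 * u x) • S) (halfSpace m) x := by
    intro b b1 hb x hx
    refine ((t_fderiv (hb x.2 hx)).mul (h.d1 x hx)).congr_fderiv ?_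
    ext v <;> simp [hS] <;> ring
  have k0 : 0 ≤ 2 * D * K := by positivity
  have k1 : 0 ≤ Q1 * K := by positivity
  have k2 : 0 ≤ Q2 * K := by positivity
  refine ⟨fun x => a x.2 • u1 x + (a1 x.2 * u x) • S, fun x => a x.2 • u2 x + (a1 x.2 • S).smulRight (u1 x) + (a1 x.2 • u1 x + (a2 x.2 * u x) • S).smulRight S, ?_, ?_, ?_⟩
  · refine ⟨df ha, fun x hx => ?_, (HolderLe.mul hD hK H0 h.h0).mono ?_, (f1 H0 H1).mono ?_, ?_⟩
    · have g1 := (t_fderiv (ha x.2 hx)).fun_smul (h.d2 x hx)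
      have g2 := (df ha1 x hx).fun_smul (hasFDerivWithinAt_const S x (halfSpace m))
      refine (g1.fun_add g2).congr_fderiv ?_
      refine ContinuousLinearMap.ext fun v => ContinuousLinearMap.ext fun v' => ?_
      simp only [ContinuousLinearMap.add_apply, ContinuousLinearMap.smul_apply, ContinuousLinearMap.smulRight_apply, ContinuousLinearMap.zero_apply, smul_zero, zero_add]
      rfl
    · nlinarith
    · nlinarith
    · have g1 := HolderLe.smul hD hK H0 h.h2
      have g2 := HolderLe.smulR (by positivity) hK (hSc H1) h.h1
      have g3 := HolderLe.smulR k1 (norm_nonneg S) (f1 H1 H2) (HolderLe.const (σ := σ) (s := halfSpace m) S)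
      refine ((g1.add g2).add g3).mono ?_
      have : 2 * (D * K) + 2 * ((n1 * D) * K) + 2 * ((Q1 * K) * ‖S‖) = Q2 * K := by rw [hQ2, ← hn1]; ring
      rw [this]; nlinarith
  · intro x v
    show a x.2 * u1 x v + a1 x.2 * u x * v.2 = _
    ring
  · intro x
    rw [trX_apply, trX_apply]
    have e : ∀ v v' : XX m, (a x.2 • u2 x + (a1 x.2 • S).smulRight (u1 x) + (a1 x.2 • u1 x + (a2 x.2 * u x) • S).smulRight S) v v' = 
      a x.2 * u2 x v v' + (a1 x.2 * v.2) * u1 x v' + (a1 x.2 * u1 x v + a2 x.2 * u x * v.2) * v'.2 := fun v v' => rfl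
    simp only [e]
    simp only [mul_zero, zero_mul, add_zero, mul_one, Finset.mul_sum, mul_add]
    ring

/-- the projection to the boundary -/
noncomputable def piL (m : ℕ) : XX m →L[ℝ] XX m := (ContinuousLinearMap.fst ℝ (EuclideanSpace ℝ (Fin m)) ℝ).prod 0
lemma piL_apply (x : XX m) : piL m x = (x.1, 0) := rfl

set_option maxHeartbeats 1000000 in
lemma C2h_trace (m : ℕ) {σ : ℝ} (s0 : 0 < σ) :
    ∃ C ≥ (0:ℝ), ∀ (u : XX m → ℝ) (u1 : XX m → XX m →L[ℝ] ℝ) (u2 : XX m → XX m →L[ℝ] XX m →L[ℝ] ℝ) (K : ℝ), 0 ≤ K → 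
      (∀ x, HasFDerivAt u (u1 x) x) → (∀ x, HasFDerivAt u1 (u2 x) x) → HolderLe σ univ u K → HolderLe σ univ u1 K → HolderLe σ univ u2 K →
      ∃ v1 v2, C2h m σ (fun x => u (x.1, 0)) v1 v2 (C * K) ∧ (∀ x, v1 x (0, 1) = 0) ∧
        ∀ x : XX m, trX m (v2 x) = ∑ i, u2 (x.1, 0) (EuclideanSpace.single i 1, 0) (EuclideanSpace.single i 1, 0) := by
  set p := piL m with hp
  set R := (ContinuousLinearMap.compL ℝ (XX m) (XX m) ℝ).flip p with hR
  have hR0 := norm_nonneg R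
  have hp0 := norm_nonneg p
  refine ⟨1 + ‖R‖ + ‖R‖ * ‖p‖, by positivity, fun u u1 u2 K hK d1 d2 h0 h1 h2 => ?_⟩
  have k1 := mul_nonneg (norm_nonneg R) hK
  have k2 := mul_nonneg (mul_nonneg hR0 hp0) hK
  have hl : ∀ x y : XX m, dist (p x) (p y) ≤ dist x y := by
    intro x y
    rw [hp, piL_apply, piL_apply, Prod.dist_eq, Prod.dist_eq]
    simp
  refine ⟨fun x => R (u1 (p x)), fun x => R.comp ((u2 (p x)).comp p), ⟨fun x hx => ?_, fun x hx => ?_, ?_, ?_, ?_⟩, ?_, ?_⟩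
  · have := (d1 (p x)).comp x p.hasFDerivAt
    exact this.hasFDerivWithinAt
  · have := R.hasFDerivAt.comp x ((d2 (p x)).comp x p.hasFDerivAt)
    exact this.hasFDerivWithinAt
  · exact (h0.comp (s := halfSpace m) s0.le hK (φ := p) (fun _ _ => trivial) hl).mono (by nlinarith)
  · exact ((h1.comp (s := halfSpace m) s0.le hK (φ := p) (fun _ _ => trivial) hl).clm R).mono (by nlinarith)
  · exact ((h2.comp (s := halfSpace m) s0.le hK (φ := p) (fun _ _ => trivial) hl).pull R p).mono (by nlinarith)
  · intro x
    show u1 (p x) (p (0, 1)) = 0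
    rw [hp, piL_apply (0, 1)]
    exact map_zero (u1 (piL m x))
  · intro x
    rw [trX_apply]
    have e : ∀ v v', R.comp ((u2 (p x)).comp p) v v' = u2 (p x) (p v) (p v') := fun v v' => rfl
    simp only [e]
    have e0 : p ((0 : EuclideanSpace ℝ (Fin m)), (1:ℝ)) = 0 := rfl
    rw [e0, map_zero, add_zero]
    rfl
end C2calc


section BPart
open Topology MeasureTheory SchwartzMap Module
section gen
variable {E : Type*} [NormedAddCommGroup E] [NormedSpace ℝ E] [FiniteDimensional ℝ E]
  [MeasureSpace E] [BorelSpace E] [(volume : Measure E).IsAddHaarMeasure]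
  {F : Type*} [NormedAddCommGroup F] [NormedSpace ℝ F] [CompleteSpace F] {σ : ℝ}

lemma schw_aff {W : Type*} [NormedAddCommGroup W] [NormedSpace ℝ W] (ρ : 𝓢(E, ℝ)) (c : W) (G : E →L[ℝ] W) :
    ∃ θ : 𝓢(E, W), ∀ z, θ z = ρ z • (c + G z) := by
  have hg : Function.HasTemperateGrowth (fun z => c + G z) := by fun_prop
  exact ⟨bilinLeftCLM (ContinuousLinearMap.lsmul ℝ ℝ) hg ρ, fun z => rfl⟩

lemma kA_holderLe (θ : 𝓢(E, F)) (s0 : 0 < σ) (s1 : σ < 1) : ∃ C ≥ (0:ℝ), ∀ (h : E → ℝ) (K : ℝ), 0 ≤ K → HolderLe σ univ h K →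
    HolderLe σ univ (fun x : E × ℝ => kA θ h x.1 x.2) (C * K) := by
  have hi := θ.integrable (μ := volume)
  have hi' := schwartz_integrable_one_add θ
  have p1 : 0 ≤ ∫ z, ‖θ z‖ := integral_nonneg fun _ => norm_nonneg _
  have p2 : 0 ≤ ∫ z, (1 + ‖z‖) * ‖θ z‖ := integral_nonneg fun _ => by positivity
  refine ⟨(∫ z, ‖θ z‖) + ∫ z, (1 + ‖z‖) * ‖θ z‖, by positivity, fun h K hK H => ⟨fun x _ => ?_, fun x _ y _ => ?_⟩⟩
  · refine (kA_bound hi (fun x => H.1 x trivial) x.1 x.2).trans ?_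
    nlinarith
  · refine (kA_holder s0 s1 hi hi' hK H x.1 y.1 x.2 y.2).trans ?_
    have hd := Real.rpow_nonneg (dist_nonneg (x := x) (y := y)) σ
    gcongr ?_ * _
    nlinarith

lemma tkA_hasFDerivAt (θ : 𝓢(E, F)) (s0 : 0 < σ) (s1 : σ < 1) {h : E → ℝ} {K : ℝ} (hK : 0 ≤ K) (H : HolderLe σ univ h K) (x : E × ℝ) (hx : 0 ≤ x.2) :
    HasFDerivAt (fun p : E × ℝ => p.2 • kA θ h p.1 p.2)
      ((ContinuousLinearMap.snd ℝ E ℝ).smulRight (kA θ h x.1 x.2) - kA (kD θ) h x.1 x.2) x := by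
  have hc := H.continuous' s0
  have hM : ∀ x, |h x| ≤ K := fun x => H.1 x trivial
  have hsnd : HasFDerivAt (fun p : E × ℝ => p.2) (ContinuousLinearMap.snd ℝ E ℝ) x := (ContinuousLinearMap.snd ℝ E ℝ).hasFDerivAt
  rcases hx.lt_or_eq with hx | hx
  · have h1 := hsnd.fun_smul (kA_hasFDerivAt θ hc hM x.1 hx)
    refine h1.congr_fderiv ?_
    rw [smul_smul, mul_neg, mul_inv_cancel₀ hx.ne', neg_one_smul, sub_eq_neg_add]
  · have e0 : kA (kD θ) h x.1 x.2 = 0 := by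
      rw [← hx]
      simp only [kA, zero_smul, add_zero]
      rw [integral_smul, integral_kD_zero, smul_zero]
    rw [e0, sub_zero]
    obtain ⟨C, hC, HC⟩ := kA_holderLe θ s0 s1
    have hcont : Continuous (fun p : E × ℝ => kA θ h p.1 p.2) := (HC h K hK H).continuous' s0
    rw [hasFDerivAt_iff_isLittleO]
    have h1 : (fun p : E × ℝ => kA θ h p.1 p.2 - kA θ h x.1 x.2) =o[𝓝 x] fun _ => (1:ℝ) := by
      rw [Asymptotics.isLittleO_one_iff]
      have := (hcont.tendsto x).sub_const (kA θ h x.1 x.2)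
      simpa using this
    have h2 : (fun p : E × ℝ => p.2) =O[𝓝 x] fun p => ‖p - x‖ := by
      refine Asymptotics.IsBigO.of_bound 1 (Eventually.of_forall fun p => ?_)
      rw [one_mul, norm_norm]
      have := norm_snd_le (p - x)
      rwa [Prod.snd_sub, ← hx, sub_zero] at this
    have h3 := h2.smul_isLittleO h1
    have e : ∀ p : E × ℝ, p.2 • kA θ h p.1 p.2 - x.2 • kA θ h x.1 x.2 - (ContinuousLinearMap.snd ℝ E ℝ).smulRight (kA θ h x.1 x.2) (p - x) =
        p.2 • (kA θ h p.1 p.2 - kA θ h x.1 x.2) := by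
      intro p
      rw [ContinuousLinearMap.smulRight_apply, ContinuousLinearMap.coe_snd', Prod.snd_sub, ← hx, zero_smul, sub_zero, sub_zero, smul_sub]
    simp only [e]
    refine h3.trans_isBigO ?_
    refine Asymptotics.IsBigO.of_bound 1 (Eventually.of_forall fun p => ?_)
    rw [smul_eq_mul, mul_one, norm_norm, one_mul]

lemma tkA'_holder (θ : 𝓢(E, F)) (s0 : 0 < σ) (s1 : σ < 1) : ∃ C ≥ (0:ℝ), ∀ (h : E → ℝ) (K : ℝ), 0 ≤ K → HolderLe σ univ h K →
    HolderLe σ univ (fun x : E × ℝ => (ContinuousLinearMap.snd ℝ E ℝ).smulRight (kA θ h x.1 x.2) - kA (kD θ) h x.1 x.2) (C * K) := by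
  obtain ⟨C, hC, HC⟩ := kA_holderLe θ s0 s1
  obtain ⟨C', hC', HC'⟩ := kA_holderLe (kD θ) s0 s1
  set n := ‖ContinuousLinearMap.snd ℝ E ℝ‖
  have hn : 0 ≤ n := norm_nonneg _
  refine ⟨2 * (n * C) + C', by positivity, fun h K hK H => ?_⟩
  have h1 := HolderLe.smulR (hn) (by positivity) (HolderLe.const (σ := σ) (s := univ) (ContinuousLinearMap.snd ℝ E ℝ)) (HC h K hK H)
  exact (h1.sub (HC' h K hK H)).mono (le_of_eq (by ring))

lemma int_sum {W ι : Type*} [NormedAddCommGroup W] [Fintype ι] {f : ι → E → W} (hf : ∀ j, Integrable (f j)) : Integrable (fun z => ∑ j, f j z) :=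
  integrable_finsetSum _ fun j _ => hf j
lemma int_sum' {W ι : Type*} [NormedAddCommGroup W] [NormedSpace ℝ W] [Fintype ι] {f : ι → E → W} (hf : ∀ j, Integrable (f j)) :
    ∫ z, ∑ j, f j z = ∑ j, ∫ z, f j z :=
  integral_finsetSum _ fun j _ => hf j

lemma int_gen {V ι : Type*} [NormedAddCommGroup V] [NormedSpace ℝ V] [Fintype ι] {Φ : V → E → ℝ} {b : ι → V → E → ℝ} {θ : ι → E → V →L[ℝ] ℝ} {K : ℝ} (x : V)
    (hF : ∀ x, Integrable (Φ x)) (hbi : ∀ j, Integrable (fun z => b j x z • θ j z)) (hθ : ∀ j, Integrable (θ j)) (hb : ∀ j x z, |b j x z| ≤ K)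
    (hd : ∀ z x, HasFDerivAt (fun x => Φ x z) (∑ j, b j x z • θ j z) x) :
    HasFDerivAt (fun x => ∫ z, Φ x z) (∑ j, ∫ z, b j x z • θ j z) x := by
  have i1 : Integrable (fun z => ∑ j, b j x z • θ j z) := int_sum hbi
  have i2 : Integrable (fun z => ∑ j, K * ‖θ j z‖) := int_sum fun j => (hθ j).norm.const_mul K
  have hbd : ∀ z x, ‖∑ j, b j x z • θ j z‖ ≤ ∑ j, K * ‖θ j z‖ := by
    intro z x
    refine norm_sum_le_of_le _ fun j _ => ?_
    rw [norm_smul]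
    exact mul_le_mul_of_nonneg_right (hb j _ _) (norm_nonneg _)
  rw [← int_sum' hbi]
  exact hasFDerivAt_integral_of_dominated_of_fderiv_le (μ := (volume : Measure E)) (𝕜 := ℝ) (x₀ := x) (s := univ)
    (F := Φ) (F' := fun x z => ∑ j, b j x z • θ j z)
    (bound := fun z => ∑ j, K * ‖θ j z‖) univ_mem (Eventually.of_forall fun x => (hF x).1)
    (hF x) i1.1 (ae_of_all _ fun z x _ => hbd z x) i2 (ae_of_all _ fun z x _ => hd z x)
end gen
variable {m : ℕ} {σ : ℝ}
abbrev EE (m : ℕ) := EuclideanSpace ℝ (Fin m)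

lemma rho_ex (m : ℕ) : ∃ ρ : 𝓢(EE m, ℝ), ∫ z, ρ z = 1 := by
  let f : ContDiffBump (0 : EE m) := ⟨1, 2, by norm_num, by norm_num⟩
  have h1 : HasCompactSupport (f.normed volume) := f.hasCompactSupport_normed
  have h2 : ContDiff ℝ (⊤ : ℕ∞) (f.normed volume) := f.contDiff_normed
  exact ⟨h1.toSchwartzMap h2, f.integral_normed⟩

lemma fderiv_coord (L : EE m →L[ℝ] ℝ) (v : EE m) : L v = ∑ j, L (EuclideanSpace.single j 1) * v j := by
  conv_lhs => rw [← (EuclideanSpace.basisFun (Fin m) ℝ).sum_repr v]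
  rw [map_sum]
  refine Finset.sum_congr rfl fun j _ => ?_
  simp [mul_comm]

noncomputable def cj (m : ℕ) (j : Fin m) : XX m →L[ℝ] ℝ := (EuclideanSpace.proj j : EE m →L[ℝ] ℝ).comp (ContinuousLinearMap.fst ℝ (EE m) ℝ)
noncomputable def Gj (m : ℕ) (j : Fin m) : EE m →L[ℝ] (XX m →L[ℝ] ℝ) := (EuclideanSpace.proj j : EE m →L[ℝ] ℝ).smulRight (sndL m)

lemma rhoj_ex (ρ : 𝓢(EE m, ℝ)) : ∃ θ : Fin m → 𝓢(EE m, XX m →L[ℝ] ℝ), ∀ j z, θ j z = ρ z • (cj m j + Gj m j z) := by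
  choose θ hθ using fun j => schw_aff ρ (cj m j) (Gj m j)
  exact ⟨θ, hθ⟩

lemma rhoj_apply {ρ : 𝓢(EE m, ℝ)} {θ : Fin m → 𝓢(EE m, XX m →L[ℝ] ℝ)} (hθ : ∀ j z, θ j z = ρ z • (cj m j + Gj m j z)) (j : Fin m) (z : EE m) (v : XX m) :
    θ j z v = ρ z * (v.1 j + z j * v.2) := by
  rw [hθ]; rfl

set_option maxHeartbeats 1000000 in
lemma N_deriv (ρ : 𝓢(EE m, ℝ)) {θ : Fin m → 𝓢(EE m, XX m →L[ℝ] ℝ)} (hθ : ∀ j z, θ j z = ρ z • (cj m j + Gj m j z))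
    {β : EE m → ℝ} {K : ℝ} (s0 : 0 < σ) (hK : 0 ≤ K) (hd : Differentiable ℝ β) (h0 : HolderLe σ univ β K) (h1 : HolderLe σ univ (fderiv ℝ β) K) (x : XX m) :
    HasFDerivAt (fun x : XX m => kA ρ β x.1 x.2) (∑ j, kA (θ j) (fun y => fderiv ℝ β y (EuclideanSpace.single j 1)) x.1 x.2) x := by
  have hbc := h0.continuous' s0
  have hfc := h1.continuous' s0
  have hb : ∀ x, |β x| ≤ K := fun x => h0.1 x trivial
  have hfb : ∀ j x, |fderiv ℝ β x (EuclideanSpace.single j 1)| ≤ K := fun j x => by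
    have e1 := h1.1 x trivial
    have e2 := (fderiv ℝ β x).le_of_opNorm_le e1 (EuclideanSpace.single j 1)
    simpa using e2
  have hjc : ∀ j, Continuous fun x => fderiv ℝ β x (EuclideanSpace.single j 1) := fun j => by fun_prop
  have hint : ∀ j, Integrable (fun z => (fderiv ℝ β (x.1 + x.2 • z) (EuclideanSpace.single j 1)) • θ j z) := fun j =>
    kA_integrable (θ j).integrable (hjc j) (hfb j) x.1 x.2
  refine int_gen (Φ := fun (x : XX m) z => β (x.1 + x.2 • z) • ρ z) (b := fun j (x : XX m) z => fderiv ℝ β (x.1 + x.2 • z) (EuclideanSpace.single j 1))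
    (θ := fun j => θ j) (K := K) x (fun x => kA_integrable ρ.integrable hbc hb x.1 x.2) hint (fun j => (θ j).integrable) (fun j x z => hfb j _) (fun z x => ?_)
  · have g1 : HasFDerivAt (fun x : XX m => x.1 + x.2 • z) (ContinuousLinearMap.fst ℝ (EE m) ℝ + (sndL m).smulRight z) x :=
      (ContinuousLinearMap.fst ℝ (EE m) ℝ).hasFDerivAt.add ((sndL m).hasFDerivAt.smul_const z)
    have g2 := ((hd (x.1 + x.2 • z)).hasFDerivAt.comp x g1).smul_const (ρ z)
    refine g2.congr_fderiv ?_
    refine ContinuousLinearMap.ext fun v => ?_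
    rw [ContinuousLinearMap.sum_apply]
    have e : ∀ j, ((fderiv ℝ β (x.1 + x.2 • z) (EuclideanSpace.single j 1)) • θ j z) v = (fderiv ℝ β (x.1 + x.2 • z) (EuclideanSpace.single j 1)) * (ρ z * (v.1 j + z j * v.2)) := by
      intro j
      rw [← rhoj_apply hθ]; rfl
    simp only [e]
    have e2 : (((fderiv ℝ β (x.1 + x.2 • z)).comp (ContinuousLinearMap.fst ℝ (EE m) ℝ + (sndL m).smulRight z)).smulRight (ρ z)) v =
      fderiv ℝ β (x.1 + x.2 • z) (v.1 + v.2 • z) * ρ z := rfl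
    rw [e2, fderiv_coord, Finset.sum_mul]
    refine Finset.sum_congr rfl fun j _ => ?_
    have : (v.1 + v.2 • z) j = v.1 j + v.2 * z j := rfl
    rw [this]; ring
end BPart


section BPart2
open Topology MeasureTheory SchwartzMap Module
section gen
variable {V : Type*} [NormedAddCommGroup V] [NormedSpace ℝ V] {σ : ℝ}

lemma bgen {s : Set V} (S : V →L[ℝ] ℝ) {D K : ℝ} (hD : 0 ≤ D) (hK : 0 ≤ K) {a b b1 b2 N : V → ℝ} {DN R : V → V →L[ℝ] ℝ} {R1 : V → V →L[ℝ] V →L[ℝ] ℝ}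
    (da : ∀ x ∈ s, HasFDerivWithinAt a (-(a x • S)) s x) (db : ∀ x ∈ s, HasFDerivWithinAt b (b1 x • S) s x)
    (db1 : ∀ x ∈ s, HasFDerivWithinAt b1 (b2 x • S) s x) (dN : ∀ x ∈ s, HasFDerivWithinAt N (DN x) s x)
    (dR : ∀ x ∈ s, HasFDerivWithinAt R (R1 x) s x) (e : ∀ x ∈ s, b x • DN x = a x • R x)
    (ha : HolderLe σ s a D) (hb : HolderLe σ s b D) (hb1 : HolderLe σ s b1 D) (hb2 : HolderLe σ s b2 D)
    (hN : HolderLe σ s N K) (hDN : HolderLe σ s DN K) (hR : HolderLe σ s R K) (hR1 : HolderLe σ s R1 K) :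
    ∃ (u1 : V → V →L[ℝ] ℝ) (u2 : V → V →L[ℝ] V →L[ℝ] ℝ),
      (∀ x ∈ s, HasFDerivWithinAt (fun x => b x * N x) (u1 x) s x) ∧ (∀ x ∈ s, HasFDerivWithinAt u1 (u2 x) s x) ∧
      (∀ x, u1 x = (b1 x * N x) • S + a x • R x) ∧
      HolderLe σ s (fun x => b x * N x) ((6 * D + 6 * (‖S‖ * D) + 2 * (‖S.smulRight S‖ * D)) * K) ∧
      HolderLe σ s u1 ((6 * D + 6 * (‖S‖ * D) + 2 * (‖S.smulRight S‖ * D)) * K) ∧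
      HolderLe σ s u2 ((6 * D + 6 * (‖S‖ * D) + 2 * (‖S.smulRight S‖ * D)) * K) := by
  have n1 := norm_nonneg S
  have n2 := norm_nonneg (S.smulRight S)
  have p1 : 0 ≤ D * K := by positivity
  have p2 : 0 ≤ ‖S‖ * (D * K) := by positivity
  have p3 : 0 ≤ ‖S.smulRight S‖ * (D * K) := by positivity
  refine ⟨fun x => (b1 x * N x) • S + a x • R x,
    fun x => (DN x).smulRight (b1 x • S) + (b2 x * N x) • S.smulRight S + (-(a x • S).smulRight (R x) + a x • R1 x), fun x hx => ?_, fun x hx => ?_, fun x => rfl, ?_, ?_, ?_⟩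
  · refine ((db x hx).fun_mul (dN x hx)).congr_fderiv ?_
    rw [e x hx, smul_smul, add_comm, mul_comm]
  · have h1 := ((db1 x hx).fun_mul (dN x hx)).smul_const S
    have h2 := (da x hx).fun_smul (dR x hx)
    refine (h1.fun_add h2).congr_fderiv ?_
    ext v w
    simp
    ring
  · exact (hb.mul hD hK hN).mono (by linarith)
  · exact (((hb1.mul hD hK hN).smul_const S).add (ha.smul hD hK hR)).mono (by linarith)
  · have h1 := hDN.smulR hK (by positivity) (hb1.smul_const S)
    have h2 := (hb2.mul hD hK hN).smul_const (S.smulRight S)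
    have h3 := (HolderLe.smulR (by positivity) hK (ha.smul_const S) hR).neg
    have h4 := ha.smul hD hK hR1
    exact ((h1.add h2).add (h3.add h4)).mono (by linarith)

lemma holder_sum {X Y ι : Type*} [PseudoMetricSpace X] [NormedAddCommGroup Y] [Fintype ι] {s : Set X} {h : ι → X → Y} {K : ι → ℝ}
    (H : ∀ j, HolderLe σ s (h j) (K j)) : HolderLe σ s (fun x => ∑ j, h j x) (∑ j, K j) := by
  refine ⟨fun x hx => norm_sum_le_of_le _ fun j _ => (H j).1 x hx, fun x hx y hy => ?_⟩
  rw [← Finset.sum_sub_distrib, Finset.sum_mul]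
  exact norm_sum_le_of_le _ fun j _ => (H j).2 x hx y hy
lemma fderivAt_sum {V' Y ι : Type*} [NormedAddCommGroup V'] [NormedSpace ℝ V'] [NormedAddCommGroup Y] [NormedSpace ℝ Y] [Fintype ι] {h : ι → V' → Y} {h' : ι → V' →L[ℝ] Y} {x : V'}
    (H : ∀ j, HasFDerivAt (h j) (h' j) x) : HasFDerivAt (fun x => ∑ j, h j x) (∑ j, h' j) x :=
  HasFDerivAt.fun_sum fun j _ => H j
end gen
variable {m : ℕ} {σ : ℝ}

lemma wt_holder (m : ℕ) (s0 : 0 < σ) (s1 : σ < 1) {u u' : ℝ → ℝ} {A B : ℝ} (hd : ∀ t, 0 ≤ t → HasDerivWithinAt u (u' t) (Ici 0) t)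
    (hA : ∀ t, 0 ≤ t → |u t| ≤ A) (hB : ∀ t, 0 ≤ t → |u' t| ≤ B) : HolderLe σ (halfSpace m) (fun x => u x.2) (2 * A + B) := by
  have hB0 : 0 ≤ B := (abs_nonneg _).trans (hB 0 le_rfl)
  refine holder_of_lip s0 s1 hB0 (fun x hx => hA _ hx) fun x hx y hy => ?_
  have := Convex.norm_image_sub_le_of_norm_hasDerivWithin_le (s := Ici (0:ℝ)) (x := y.2) (y := x.2)
      (fun t ht => hd t ht) (fun t ht => hB t ht) (convex_Ici 0) hy hx
  refine this.trans ?_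
  gcongr
  rw [dist_eq_norm]
  exact norm_snd_le (x - y)

lemma exp_wt {t : ℝ} (ht : 0 ≤ t) : Real.exp (-t) ≤ 1 ∧ 0 < Real.exp (-t) ∧ t * Real.exp (-t) ≤ 1 := by
  have h1 := Real.exp_pos (-t)
  refine ⟨Real.exp_le_one_iff.2 (by linarith), h1, ?_⟩
  have h2 := Real.add_one_le_exp t
  have h3 : Real.exp t * Real.exp (-t) = 1 := by rw [← Real.exp_add]; simp
  nlinarith

noncomputable def Bf (ρ : 𝓢(EE m, ℝ)) (β : EE m → ℝ) (x : XX m) : ℝ := (x.2 * Real.exp (-x.2)) * kA ρ β x.1 x.2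

lemma Bf_lin (ρ : 𝓢(EE m, ℝ)) {β β' : EE m → ℝ} {M M' : ℝ} (hc : Continuous β) (hM : ∀ x, |β x| ≤ M) (hc' : Continuous β') (hM' : ∀ x, |β' x| ≤ M') (a : ℝ) (x : XX m) :
    Bf ρ (fun y => a * β y + β' y) x = a * Bf ρ β x + Bf ρ β' x := by
  rw [Bf, Bf, Bf, kA_add (h := fun y => a * β y) ρ.integrable (by fun_prop) (M := |a| * M) (fun x => by rw [abs_mul]; exact mul_le_mul_of_nonneg_left (hM x) (abs_nonneg _)) hc' hM', kA_smul, smul_eq_mul]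
  ring

set_option maxHeartbeats 2000000 in
lemma Bf_reg (ρ : 𝓢(EE m, ℝ)) (h1ρ : ∫ z, ρ z = 1) (s0 : 0 < σ) (s1 : σ < 1) :
    ∃ C ≥ (0:ℝ), ∀ (β : EE m → ℝ) (K : ℝ), 0 ≤ K → Differentiable ℝ β → HolderLe σ univ β K → HolderLe σ univ (fderiv ℝ β) K →
      ∃ u1 u2, C2h m σ (Bf ρ β) u1 u2 (C * K) ∧ (∀ y, Bf ρ β (y, 0) = 0) ∧ ∀ y, u1 (y, 0) (0, 1) = β y := by
  obtain ⟨θ, hθ⟩ := rhoj_ex ρ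
  obtain ⟨C0, hC0, H0⟩ := kA_holderLe ρ s0 s1
  obtain ⟨C1, hC1, H1⟩ := kA_holderLe (kD ρ) s0 s1
  choose C2 hC2 H2 using fun j => kA_holderLe (θ j) s0 s1
  choose C3 hC3 H3 using fun j => tkA'_holder (θ j) s0 s1
  have q2 : 0 ≤ ∑ j, C2 j := Finset.sum_nonneg fun j _ => hC2 j
  have q3 : 0 ≤ ∑ j, C3 j := Finset.sum_nonneg fun j _ => hC3 j
  set C := C0 + C1 + ∑ j, C2 j + ∑ j, C3 j with hCdef
  have hC : 0 ≤ C := by positivity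
  have n1 := norm_nonneg (sndL m)
  have n2 := norm_nonneg ((sndL m).smulRight (sndL m))
  have de : ∀ t : ℝ, HasDerivAt (fun t => Real.exp (-t)) (-Real.exp (-t)) t := fun t => by
    have := (hasDerivAt_neg t).exp
    refine this.congr_deriv (by ring)
  have db : ∀ t : ℝ, HasDerivAt (fun t => t * Real.exp (-t)) ((1 - t) * Real.exp (-t)) t := fun t =>
    ((hasDerivAt_id t).fun_mul (de t)).congr_deriv (by simp; ring)
  have db1 : ∀ t : ℝ, HasDerivAt (fun t => (1 - t) * Real.exp (-t)) ((t - 2) * Real.exp (-t)) t := fun t =>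
    (((hasDerivAt_id t).const_sub 1).fun_mul (de t)).congr_deriv (by simp; ring)
  have db2 : ∀ t : ℝ, HasDerivAt (fun t => (t - 2) * Real.exp (-t)) ((3 - t) * Real.exp (-t)) t := fun t =>
    (((hasDerivAt_id t).sub_const 2).fun_mul (de t)).congr_deriv (by simp; ring)
  have ba : ∀ t : ℝ, 0 ≤ t → |Real.exp (-t)| ≤ 3 := fun t ht => by
    obtain ⟨e1, e2, e3⟩ := exp_wt ht
    rw [abs_of_pos e2]; linarith
  have ba' : ∀ t : ℝ, 0 ≤ t → |-Real.exp (-t)| ≤ 3 := fun t ht => by rw [abs_neg]; exact ba t ht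
  have bb : ∀ t : ℝ, 0 ≤ t → |t * Real.exp (-t)| ≤ 3 := fun t ht => by
    obtain ⟨e1, e2, e3⟩ := exp_wt ht
    rw [abs_le]; constructor <;> nlinarith
  have bb1 : ∀ t : ℝ, 0 ≤ t → |(1 - t) * Real.exp (-t)| ≤ 3 := fun t ht => by
    obtain ⟨e1, e2, e3⟩ := exp_wt ht
    rw [abs_le]; constructor <;> nlinarith
  have bb2 : ∀ t : ℝ, 0 ≤ t → |(t - 2) * Real.exp (-t)| ≤ 3 := fun t ht => by
    obtain ⟨e1, e2, e3⟩ := exp_wt ht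
    rw [abs_le]; constructor <;> nlinarith
  have bb3 : ∀ t : ℝ, 0 ≤ t → |(3 - t) * Real.exp (-t)| ≤ 3 := fun t ht => by
    obtain ⟨e1, e2, e3⟩ := exp_wt ht
    rw [abs_le]; constructor <;> nlinarith
  have Wa := wt_holder m s0 s1 (fun t _ => (de t).hasDerivWithinAt) ba ba'
  have Wb := wt_holder m s0 s1 (fun t _ => (db t).hasDerivWithinAt) bb bb1
  have Wb1 := wt_holder m s0 s1 (fun t _ => (db1 t).hasDerivWithinAt) bb1 bb2
  have Wb2 := wt_holder m s0 s1 (fun t _ => (db2 t).hasDerivWithinAt) bb2 bb3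
  norm_num only at Wa Wb Wb1 Wb2
  refine ⟨(6 * 9 + 6 * (‖sndL m‖ * 9) + 2 * (‖(sndL m).smulRight (sndL m)‖ * 9)) * C, by positivity, fun β K hK hd h0 h1 => ?_⟩
  have hh : ∀ j, HolderLe σ univ (fun y => fderiv ℝ β y (EuclideanSpace.single j 1)) K := fun j => by
    refine ⟨fun y _ => ?_, fun y _ y' _ => ?_⟩
    · simpa using (fderiv ℝ β y).le_of_opNorm_le (h1.1 y trivial) (EuclideanSpace.single j 1)
    · simpa using (fderiv ℝ β y - fderiv ℝ β y').le_of_opNorm_le (h1.2 y trivial y' trivial) (EuclideanSpace.single j 1)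
  have dN := N_deriv ρ hθ s0 hK hd h0 h1
  have dR := fun (x : XX m) (hx : 0 ≤ x.2) => fderivAt_sum fun j => tkA_hasFDerivAt (θ j) s0 s1 hK (hh j) x hx
  have eR : ∀ x : XX m, 0 ≤ x.2 → (∑ j, x.2 • kA (θ j) (fun y => fderiv ℝ β y (EuclideanSpace.single j 1)) x.1 x.2) = -kA (kD ρ) β x.1 x.2 := by
    intro x hx
    have g1 := tkA_hasFDerivAt ρ s0 s1 hK h0 x hx
    have g2 := HasFDerivAt.fun_smul (sndL m).hasFDerivAt (dN x)
    have g3 := g1.unique g2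
    rw [← Finset.smul_sum]
    rw [sub_eq_iff_eq_add] at g3
    have g4 : (sndL m).smulRight (kA ρ β x.1 x.2) = (sndL m x • ∑ j, kA (θ j) (fun y => fderiv ℝ β y (EuclideanSpace.single j 1)) x.1 x.2 + (sndL m).smulRight (kA ρ β x.1 x.2)) + kA (kD ρ) β x.1 x.2 := g3
    have g5 : sndL m x = x.2 := rfl
    rw [g5, add_right_comm, right_eq_add] at g4
    exact eq_neg_of_add_eq_zero_left g4
  have KN : HolderLe σ (halfSpace m) (fun x : XX m => kA ρ β x.1 x.2) (C * K) :=
    ((H0 β K hK h0).subset (subset_univ _)).mono (mul_le_mul_of_nonneg_right (by rw [hCdef]; linarith) hK)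
  have KDN : HolderLe σ (halfSpace m) (fun x : XX m => ∑ j, kA (θ j) (fun y => fderiv ℝ β y (EuclideanSpace.single j 1)) x.1 x.2) (C * K) :=
    ((holder_sum fun j => H2 j _ K hK (hh j)).subset (subset_univ _)).mono (by rw [← Finset.sum_mul]; exact (mul_le_mul_of_nonneg_right (by rw [hCdef]; linarith) hK))
  have KR : HolderLe σ (halfSpace m) (fun x : XX m => ∑ j, x.2 • kA (θ j) (fun y => fderiv ℝ β y (EuclideanSpace.single j 1)) x.1 x.2) (C * K) :=
    (((H1 β K hK h0).neg.subset (subset_univ _)).congr eR).mono (mul_le_mul_of_nonneg_right (by rw [hCdef]; linarith) hK)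
  have KR1 := ((holder_sum fun j => H3 j _ K hK (hh j)).subset (subset_univ (halfSpace m))).mono (K' := C * K)
    (by rw [← Finset.sum_mul]; exact (mul_le_mul_of_nonneg_right (by rw [hCdef]; linarith) hK))
  obtain ⟨u1, u2, r1, r2, r3, r4, r5, r6⟩ := bgen (s := halfSpace m) (sndL m) (D := 9) (K := C * K) (by norm_num) (by positivity)
    (fun x hx => (t_fderiv (de x.2).hasDerivWithinAt).congr_fderiv (ContinuousLinearMap.ext fun v => neg_mul _ _)) (fun x hx => t_fderiv (db x.2).hasDerivWithinAt) (fun x hx => t_fderiv (db1 x.2).hasDerivWithinAt)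
    (fun x hx => (dN x).hasFDerivWithinAt) (fun x hx => (dR x hx).hasFDerivWithinAt)
    (fun x hx => by
      show (x.2 * Real.exp (-x.2)) • _ = Real.exp (-x.2) • ∑ j, x.2 • _
      rw [← Finset.smul_sum, smul_smul, mul_comm]) Wa Wb Wb1 Wb2 KN KDN KR KR1
  refine ⟨u1, u2, ⟨r1, r2, ?_, ?_, ?_⟩, fun y => by simp [Bf], fun y => ?_⟩
  · exact r4.mono (le_of_eq (by ring))
  · exact r5.mono (le_of_eq (by ring))
  · exact r6.mono (le_of_eq (by ring))
  · rw [r3]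
    have e1 : (∑ j, ((y, 0) : XX m).2 • kA (θ j) (fun y => fderiv ℝ β y (EuclideanSpace.single j 1)) y 0) = 0 :=
      Finset.sum_eq_zero fun j _ => zero_smul _ _
    have e2 : kA ρ β y 0 = β y := by
      simp only [kA, zero_smul, add_zero]
      rw [integral_smul, h1ρ, smul_eq_mul, mul_one]
    show (((1 - 0) * Real.exp (-0) * kA ρ β y 0) • sndL m + Real.exp (-0) • (∑ j, ((y, 0) : XX m).2 • kA (θ j) (fun y => fderiv ℝ β y (EuclideanSpace.single j 1)) y 0)) (0, 1) = β y
    rw [e1, e2, smul_zero, add_zero]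
    simp
end BPart2


section SPart
open Topology MeasureTheory SchwartzMap Module
variable {m : ℕ} {σ : ℝ} (P : Prof)

noncomputable def Sz (g : XX m → ℝ) : XX m → ℝ := Zt P (kG P g)
noncomputable def Sphi (g : XX m → ℝ) (x : XX m) : ℝ :=
  fderiv ℝ (Sz P g) x (0, 1) + P.q x.2 * Sz P g x + (-(P.om x.2 / P.om 0)) * fderiv ℝ (Sz P g) (x.1, 0) (0, 1)

noncomputable def Prof.q2 (t : ℝ) : ℝ := -P.dv t - 2 * (P.q t * P.q1 t)

lemma Prof.hq1 {t : ℝ} (ht : 0 ≤ t) : HasDerivWithinAt P.q1 (P.q2 t) (Ici 0) t := by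
  have h1 := (P.hv t ht).fun_neg.fun_sub ((P.hq t).hasDerivWithinAt.fun_pow 2)
  refine (h1.congr_of_mem (fun s _ => ?_) ht).congr_deriv ?_
  · simp only [Prof.q1]
  · simp only [Prof.q2]; ring

lemma q_data (m : ℕ) (s0 : 0 < σ) (s1 : σ < 1) : ∃ D ≥ (0:ℝ), HolderLe σ (halfSpace m) (fun x => P.q x.2) D ∧ HolderLe σ (halfSpace m) (fun x => P.q1 x.2) D ∧
    HolderLe σ (halfSpace m) (fun x => P.q2 x.2) D := by
  have hc := P.c_pos
  have hq := holder_fst_snd (m := m) s0 s1 (by positivity) P.q_bd P.q_lip (halfSpace m)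
  have hq1 := holder_fst_snd (m := m) s0 s1 (by positivity) P.q1_bd P.q1_lip (halfSpace m)
  have hd := holder_fst_snd (m := m) s0 s1 (by positivity) P.dv_bd P.dv_lip (halfSpace m)
  set A := 2 * P.c + (P.c + P.c ^ 2)
  set A' := 2 * (P.c + P.c ^ 2) + (2 * P.c * (P.c + P.c^2) + P.c)
  set A'' := 2 * P.c + P.c
  have hA : 0 ≤ A := by positivity
  have hA' : 0 ≤ A' := by positivity
  have hA'' : 0 ≤ A'' := by positivity
  have hAA : 0 ≤ A * A' := by positivity
  have h3 := (hq.mul hA hA' hq1)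
  have h4 := hd.neg.sub (h3.add h3)
  refine ⟨A + A' + A'' + 4 * (A * A'), by positivity, hq.mono (by linarith), hq1.mono (by linarith), (h4.congr fun x _ => ?_).mono (by linarith)⟩
  simp only [Prof.q2]; ring

lemma om_data (m : ℕ) (s0 : 0 < σ) (s1 : σ < 1) : ∃ D ≥ (0:ℝ), HolderLe σ (halfSpace m) (fun x => -(P.om x.2 / P.om 0)) D ∧ HolderLe σ (halfSpace m) (fun x => P.Fo x.2 / P.om 0) D ∧
    HolderLe σ (halfSpace m) (fun x => P.v x.2 * P.om x.2 / P.om 0) D := by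
  have hc := P.c_pos
  have h0 := P.om_pos 0
  have ho := holder_fst_snd (m := m) s0 s1 (by positivity) P.om_abs P.om_lip (halfSpace m)
  have hv := holder_fst_snd (m := m) s0 s1 (by positivity) P.v_bd P.v_lip (halfSpace m)
  have bF : ∀ t, 0 ≤ t → |P.Fo t| ≤ P.c * P.c := fun t _ => (P.Fo_bd t).trans (mul_le_mul_of_nonneg_left (P.om_bd t) hc.le)
  have bv : ∀ t, 0 ≤ t → |P.v t * P.om t| ≤ P.c * P.c := fun t _ => by
    rw [abs_mul]; exact mul_le_mul (P.v_bd t) (P.om_abs t) (abs_nonneg _) hc.le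
  have hF := wt_holder m s0 s1 (fun t _ => (P.hFo t).hasDerivWithinAt) bF bv
  set A := 2 * P.c + P.c * P.c
  set A' := 2 * (P.c * P.c) + P.c * P.c
  set A'' := 2 * P.c + P.c
  have hA : 0 ≤ A := by positivity
  have hA' : 0 ≤ A' := by positivity
  have hA'' : 0 ≤ A'' := by positivity
  have hAA : 0 ≤ A'' * A := by positivity
  have hvo := hv.mul hA'' hA ho
  have hi : 0 ≤ ‖(1 / P.om 0)‖ := norm_nonneg _
  refine ⟨‖(1 / P.om 0)‖ * (A + A' + 2 * (A'' * A)), by positivity, ?_, ?_, ?_⟩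
  · refine ((ho.smul_const (1 / P.om 0)).neg.congr fun x _ => ?_).mono (mul_le_mul_of_nonneg_left (by linarith) hi)
    simp only [smul_eq_mul]; ring
  · refine ((hF.smul_const (1 / P.om 0)).congr fun x _ => ?_).mono (mul_le_mul_of_nonneg_left (by linarith) hi)
    simp only [smul_eq_mul]; ring
  · refine ((hvo.smul_const (1 / P.om 0)).congr fun x _ => ?_).mono (mul_le_mul_of_nonneg_left (by linarith) hi)
    simp only [smul_eq_mul]; ring

lemma C2h_of_univ {u : XX m → ℝ} {u1 u2} {K : ℝ} (d1 : ∀ x, HasFDerivAt u (u1 x) x) (d2 : ∀ x, HasFDerivAt u1 (u2 x) x)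
    (h0 : HolderLe σ univ u K) (h1 : HolderLe σ univ u1 K) (h2 : HolderLe σ univ u2 K) : C2h m σ u u1 u2 K :=
  ⟨fun x _ => (d1 x).hasFDerivWithinAt, fun x _ => (d2 x).hasFDerivWithinAt, h0.subset (subset_univ _), h1.subset (subset_univ _), h2.subset (subset_univ _)⟩

lemma holder_ev {X V : Type*} [PseudoMetricSpace X] [NormedAddCommGroup V] [NormedSpace ℝ V] {s : Set X} {h : X → V →L[ℝ] V →L[ℝ] ℝ} {K : ℝ} (v : V)
    (H : HolderLe σ s h K) : HolderLe σ s (fun x => h x v v) (‖v‖ * ‖v‖ * K) := by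
  have key : ∀ (A : V →L[ℝ] V →L[ℝ] ℝ) (k : ℝ), ‖A‖ ≤ k → ‖A v v‖ ≤ ‖v‖ * ‖v‖ * k := fun A k hk => by
    calc _ ≤ (k * ‖v‖) * ‖v‖ := (A v).le_of_opNorm_le (A.le_of_opNorm_le hk v) v
      _ = _ := by ring
  refine ⟨fun x hx => key _ _ (H.1 x hx), fun x hx y hy => ?_⟩
  have e : h x v v - h y v v = (h x - h y) v v := rfl
  rw [e, mul_assoc]
  exact key _ _ (H.2 x hx y hy)

lemma tr_ex (m : ℕ) (σ : ℝ) : ∃ n ≥ (0:ℝ), ∀ (h : XX m → XX m →L[ℝ] XX m →L[ℝ] ℝ) (s : Set (XX m)) (K : ℝ), HolderLe σ s h K → HolderLe σ s (fun x => trX m (h x)) (n * K) := by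
  refine ⟨(∑ i : Fin m, ‖((EuclideanSpace.single i 1, 0) : XX m)‖ * ‖((EuclideanSpace.single i 1, 0) : XX m)‖) + ‖((0, 1) : XX m)‖ * ‖((0, 1) : XX m)‖,
    add_nonneg (Finset.sum_nonneg fun i _ => mul_self_nonneg _) (mul_self_nonneg _), fun h s K H => ?_⟩
  have h1 := (holder_sum fun i : Fin m => holder_ev ((EuclideanSpace.single i 1, 0) : XX m) H).add (holder_ev ((0, 1) : XX m) H)
  rw [← Finset.sum_mul, ← add_mul] at h1
  exact h1.congr fun x _ => trX_apply m (h x)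

set_option maxHeartbeats 1000000 in
lemma S_reg (m : ℕ) (s0 : 0 < σ) (s1 : σ < 1) : ∃ C ≥ (0:ℝ), ∀ (g : XX m → ℝ) (K : ℝ), 0 ≤ K → HolderLe σ univ g K →
    (∀ y t, g (y, -t) = g (y, t)) → ∃ u1 u2 al, C2h m σ (Sphi P g) u1 u2 (C * K) ∧ (∀ y, Sphi P g (y, 0) = 0) ∧ (∀ y, u1 (y, 0) (0, 1) = 0) ∧
      HolderLe σ univ al (C * K) ∧ ∀ x : XX m, 0 ≤ x.2 → trX m (u2 x) + P.v x.2 * Sphi P g x = al x.1 * P.om x.2 + g x := by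
  have h0 := P.om_pos 0
  obtain ⟨C1, hC1, H1⟩ := zeta_reg P m s0 s1
  obtain ⟨Ck, hCk, Hk⟩ := kG_holder P m s0 s1
  obtain ⟨D, hD, D0, D1, D2⟩ := q_data P m s0 s1
  obtain ⟨D', hD', D0', D1', D2'⟩ := om_data P m s0 s1
  obtain ⟨C2, hC2, H2⟩ := C2h_tmul m hD (fun t _ => (P.hq t).hasDerivWithinAt) (fun t ht => P.hq1 ht) D0 D1 D2
  obtain ⟨C3, hC3, H3⟩ := C2h_tmul m hD' (a := fun t => -(P.om t / P.om 0)) (a1 := fun t => P.Fo t / P.om 0) (a2 := fun t => P.v t * P.om t / P.om 0)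
    (fun t _ => (((P.hom t).div_const _).fun_neg.congr_deriv (by ring)).hasDerivWithinAt)
    (fun t _ => ((P.hFo t).div_const _).hasDerivWithinAt) D0' D1' D2'
  obtain ⟨C4, hC4, H4⟩ := C2h_trace m s0
  obtain ⟨n, hn, Hn⟩ := tr_ex m σ
  have ni : 0 ≤ ‖1 / P.om 0‖ := norm_nonneg _
  refine ⟨C1 + C2 * C1 + C3 * (C4 * C1) + Ck + ‖1 / P.om 0‖ * (n * (C4 * C1)), by positivity, fun g K hK hg he => ?_⟩
  obtain ⟨Z1, Z2, U1, U2, z1, z2, z3, z4, z5, w1, w2, w3, w4, w5, e1, e2, e3, e4⟩ := H1 g K hK hg he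
  have hz : ∀ x, fderiv ℝ (Sz P g) x = Z1 x := fun x => (z1 x).fderiv
  have hCK : 0 ≤ C1 * K := by positivity
  have cU := C2h_of_univ w1 w2 w3 w4 w5
  obtain ⟨v1, v2, cV, V1, V2⟩ := H2 _ _ _ _ hCK (C2h_of_univ z1 z2 z3 z4 z5)
  obtain ⟨r1, r2, cR, R1, R2⟩ := H4 _ _ _ _ hCK w1 w2 w3 w4 w5
  obtain ⟨t1, t2, cT, T1, T2⟩ := H3 _ _ _ _ (by positivity) cR
  have eq : ∀ x, Sphi P g x = (Z1 x (0, 1) + P.q x.2 * Zt P (kG P g) x) + (-(P.om x.2 / P.om 0)) * Z1 (x.1, 0) (0, 1) := by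
    intro x; rw [Sphi, hz, hz]; rfl
  have n1 : 0 ≤ C2 * (C1 * K) := by positivity
  have n2 : 0 ≤ C3 * (C4 * (C1 * K)) := by positivity
  have n3 : 0 ≤ Ck * K := by positivity
  have n4 : 0 ≤ ‖1 / P.om 0‖ * (n * (C4 * (C1 * K))) := by positivity
  have F0 : P.Fo 0 = 0 := by have := P.Fo_odd 0; rw [neg_zero] at this; linarith
  refine ⟨_, _, fun y => -cG P g y - trX m (r2 (y, 0)) * (1 / P.om 0), (((cU.add cV).add cT).congr fun x _ => eq x).mono (by linarith), fun y => ?_, fun y => ?_, ?_, fun x hx => ?_⟩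
  · rw [eq, e1]
    show _ + P.q 0 * 0 + -(P.om 0 / P.om 0) * _ = _
    rw [div_self h0.ne']; ring
  · show U1 (y, 0) (0, 1) + v1 (y, 0) (0, 1) + t1 (y, 0) (0, 1) = 0
    rw [e2, V1, T1, R1, e1]
    show 0 + (P.q 0 * _ + _) + (_ + P.Fo 0 / P.om 0 * _ * _) = _
    rw [P.q_zero, F0]; ring
  · have k1 := (Hk g K hK hg he).1.neg
    have k2 : HolderLe σ univ (fun y : EuclideanSpace ℝ (Fin m) => trX m (r2 (y, 0))) _ :=
      HolderLe.comp (s := univ) s0.le (by positivity) (Hn _ _ _ cR.h2) (φ := fun y : EuclideanSpace ℝ (Fin m) => ((y, 0) : XX m)) (fun y _ => le_refl (0:ℝ))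
        (fun y y' => by rw [Prod.dist_eq]; simp)
    have k3 := k2.smul_const (1 / P.om 0)
    exact (k1.sub k3).mono (by linarith)
  · have tr : trX m (U2 x + v2 x + t2 x) = trX m (U2 x) + trX m (v2 x) + trX m (t2 x) := by rw [map_add, map_add]
    show trX m (U2 x + v2 x + t2 x) + _ = (-cG P g x.1 - trX m (r2 (x.1, 0)) * (1 / P.om 0)) * _ + _
    rw [tr, e4 x hx, V2, T2, eq, e3, R1, R2, R2]
    simp only [ktG, gperp, Prof.q2, Prof.q1, Prof.b]
    field_simp
    ring
end SPart


section Assembly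
open Topology MeasureTheory SchwartzMap Module
variable {m : ℕ} {σ : ℝ} (P : Prof)

lemma holder_lin {X Y : Type*} [PseudoMetricSpace X] [NormedAddCommGroup Y] [NormedSpace ℝ Y] {s : Set X} {h h' : X → Y} {K K' : ℝ} (a : ℝ)
    (H : HolderLe σ s h K) (H' : HolderLe σ s h' K') : HolderLe σ s (fun x => a • h x + h' x) (|a| * K + K') := by
  refine HolderLe.add (h := fun x => a • h x) ⟨fun x hx => ?_, fun x hx y hy => ?_⟩ H'
  · rw [norm_smul]; exact mul_le_mul_of_nonneg_left (H.1 x hx) (abs_nonneg a)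
  · rw [← smul_sub, norm_smul, mul_assoc]; exact mul_le_mul_of_nonneg_left (H.2 x hx y hy) (abs_nonneg a)

lemma fd_lin {V Y : Type*} [NormedAddCommGroup V] [NormedSpace ℝ V] [NormedAddCommGroup Y] [NormedSpace ℝ Y] {s : Set V} {h h' : V → Y} {d d' : V →L[ℝ] Y} {x : V} (a : ℝ)
    (H : HasFDerivWithinAt h d s x) (H' : HasFDerivWithinAt h' d' s x) : HasFDerivWithinAt (fun x => a • h x + h' x) (a • d + d') s x :=
  (H.fun_const_smul a).fun_add H'

set_option maxHeartbeats 1000000 in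
lemma C2h.lin {u v : XX m → ℝ} {u1 u2 v1 v2} {K K' : ℝ} (a : ℝ) (h : C2h m σ u u1 u2 K) (h' : C2h m σ v v1 v2 K') :
    C2h m σ (fun x => a * u x + v x) (fun x => a • u1 x + v1 x) (fun x => a • u2 x + v2 x) (|a| * K + K') :=
  ⟨fun x hx => fd_lin a (h.d1 x hx) (h'.d1 x hx), fun x hx => fd_lin a (h.d2 x hx) (h'.d2 x hx),
    holder_lin a h.h0 h'.h0, holder_lin a h.h1 h'.h1, holder_lin a h.h2 h'.h2⟩

lemma trX_lin (a : ℝ) (A B : XX m →L[ℝ] XX m →L[ℝ] ℝ) : trX m (a • A + B) = a * trX m A + trX m B := by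
  rw [map_add, map_smul, smul_eq_mul]

lemma Sz_lin (s0 : 0 < σ) (s1 : σ < 1) {g g' : XX m → ℝ} {K K' : ℝ} (hK : 0 ≤ K) (hK' : 0 ≤ K') (H : HolderLe σ univ g K) (H' : HolderLe σ univ g' K')
    (he : ∀ y t, g (y, -t) = g (y, t)) (he' : ∀ y t, g' (y, -t) = g' (y, t)) (a : ℝ) :
    Sz P (fun x => a * g x + g' x) = fun x => a * Sz P g x + Sz P g' x := by
  obtain ⟨C, hC, h⟩ := kG_holder P m s0 s1
  obtain ⟨-, -, k, -⟩ := h g K hK H he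
  obtain ⟨-, -, k', -⟩ := h g' K' hK' H' he'
  have e : kG P (fun x => a * g x + g' x) = fun x => a * kG P g x + kG P g' x :=
    funext fun x => kG_lin P (H.continuous' s0) (fun x => H.1 x trivial) (H'.continuous' s0) (fun x => H'.1 x trivial) a x
  rw [Sz, e]
  exact Zt_lin P (k.continuous' s0) (fun x => k.1 x trivial) (k'.continuous' s0) (fun x => k'.1 x trivial) a

lemma Sphi_lin (s0 : 0 < σ) (s1 : σ < 1) {g g' : XX m → ℝ} {K K' : ℝ} (hK : 0 ≤ K) (hK' : 0 ≤ K') (H : HolderLe σ univ g K) (H' : HolderLe σ univ g' K')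
    (he : ∀ y t, g (y, -t) = g (y, t)) (he' : ∀ y t, g' (y, -t) = g' (y, t)) (a : ℝ) (x : XX m) :
    Sphi P (fun x => a * g x + g' x) x = a * Sphi P g x + Sphi P g' x := by
  obtain ⟨C, hC, h⟩ := zeta_reg P m s0 s1
  obtain ⟨Z1, Z2, U1, U2, z1, -⟩ := h g K hK H he
  obtain ⟨Z1', Z2', U1', U2', z1', -⟩ := h g' K' hK' H' he'
  have e1 : ∀ x, fderiv ℝ (Sz P g) x = Z1 x := fun x => (z1 x).fderiv
  have e2 : ∀ x, fderiv ℝ (Sz P g') x = Z1' x := fun x => (z1' x).fderiv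
  have e3 : ∀ x, fderiv ℝ (fun x => a * Sz P g x + Sz P g' x) x (0, 1) = a * Z1 x (0, 1) + Z1' x (0, 1) := fun x => by
    have h1 : HasFDerivAt (Sz P g) (Z1 x) x := z1 x
    have h2 : HasFDerivAt (Sz P g') (Z1' x) x := z1' x
    rw [((h1.const_mul a).fun_add h2).fderiv]; rfl
  rw [Sphi, Sphi, Sphi, Sz_lin P s0 s1 hK hK' H H' he he' a, e3, e3, e1, e1, e2, e2]
  ring

noncomputable def LBf (ρ : 𝓢(EE m, ℝ)) (β : EE m → ℝ) (x : XX m) : ℝ :=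
  trX m (fderivWithin ℝ (fderivWithin ℝ (Bf ρ β) (halfSpace m)) (halfSpace m) x) + P.v x.2 * Bf ρ β x
noncomputable def Gd (ρ : 𝓢(EE m, ℝ)) (β : EE m → ℝ) (g : XX m → ℝ) (x : XX m) : ℝ := g (x.1, |x.2|) - LBf P ρ β (x.1, |x.2|)
noncomputable def Phi (ρ : 𝓢(EE m, ℝ)) (β : EE m → ℝ) (g : XX m → ℝ) (x : XX m) : ℝ := Bf ρ β x + Sphi P (Gd P ρ β g) x
noncomputable def Al (φ g : XX m → ℝ) (y : EE m) : ℝ := (lapP φ (y, 1) + P.v 1 * φ (y, 1) - g (y, 1)) / P.om 1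

lemma Gd_even (ρ : 𝓢(EE m, ℝ)) (β : EE m → ℝ) (g : XX m → ℝ) (y : EE m) (t : ℝ) : Gd P ρ β g (y, -t) = Gd P ρ β g (y, t) := by
  simp only [Gd, abs_neg]

lemma Gd_holder (ρ : 𝓢(EE m, ℝ)) (h1ρ : ∫ z, ρ z = 1) (s0 : 0 < σ) (s1 : σ < 1) :
    ∃ C ≥ (0:ℝ), ∀ (β : EE m → ℝ) (g : XX m → ℝ) (K K' : ℝ), 0 ≤ K → 0 ≤ K' → Differentiable ℝ β → HolderLe σ univ β K → HolderLe σ univ (fderiv ℝ β) K →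
      HolderLe σ (halfSpace m) g K' → HolderLe σ univ (Gd P ρ β g) (C * (K + K')) := by
  obtain ⟨C, hC, H⟩ := Bf_reg ρ h1ρ s0 s1
  obtain ⟨n, hn, Hn⟩ := tr_ex m σ
  have hc := P.c_pos
  have hv := holder_fst_snd (m := m) s0 s1 (by positivity) P.v_bd P.v_lip (halfSpace m)
  refine ⟨1 + n * C + 2 * ((2 * P.c + P.c) * C), by positivity, fun β g K K' hK hK' hd h0 h1 hg => ?_⟩
  obtain ⟨u1, u2, cu, -, -⟩ := H β K hK hd h0 h1
  have p1 : 0 ≤ n * (C * K) := by positivity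
  have p2 : 0 ≤ 2 * ((2 * P.c + P.c) * (C * K)) := by positivity
  have p3 : 0 ≤ (n * C + 2 * ((2 * P.c + P.c) * C)) * K' := by positivity
  have k1 : HolderLe σ (halfSpace m) (fun x => trX m (u2 x) + P.v x.2 * Bf ρ β x) _ := (Hn _ _ _ cu.h2).add (hv.mul (by positivity) (by positivity) cu.h0)
  have k2 : HolderLe σ (halfSpace m) (LBf P ρ β) _ := k1.congr fun x hx => by rw [LBf, cu.fd2 x hx]
  have k3 := HolderLe.comp (s := univ) s0.le (by positivity) (hg.sub k2) (φ := fun x : XX m => ((x.1, |x.2|) : XX m)) (fun x _ => abs_nonneg x.2)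
    (fun x y => by
      rw [Prod.dist_eq, Prod.dist_eq]
      refine max_le_max le_rfl ?_
      rw [Real.dist_eq, Real.dist_eq]; exact abs_abs_sub_abs_le _ _)
  exact HolderLe.mono (h := Gd P ρ β g) k3 (by nlinarith)

lemma Gd_lin (ρ : 𝓢(EE m, ℝ)) (h1ρ : ∫ z, ρ z = 1) (s0 : 0 < σ) (s1 : σ < 1) {β β' : EE m → ℝ} {K K' : ℝ} (hK : 0 ≤ K) (hK' : 0 ≤ K')
    (hd : Differentiable ℝ β) (h0 : HolderLe σ univ β K) (h1 : HolderLe σ univ (fderiv ℝ β) K)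
    (hd' : Differentiable ℝ β') (h0' : HolderLe σ univ β' K') (h1' : HolderLe σ univ (fderiv ℝ β') K') (g g' : XX m → ℝ) (a : ℝ) :
    Gd P ρ (fun y => a * β y + β' y) (fun x => a * g x + g' x) = fun x => a * Gd P ρ β g x + Gd P ρ β' g' x := by
  obtain ⟨C, hC, H⟩ := Bf_reg ρ h1ρ s0 s1
  obtain ⟨u1, u2, cu, -, -⟩ := H β K hK hd h0 h1
  obtain ⟨v1, v2, cv, -, -⟩ := H β' K' hK' hd' h0' h1'
  have cw := cu.lin a cv
  have e : Bf ρ (fun y => a * β y + β' y) = fun x => a * Bf ρ β x + Bf ρ β' x :=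
    funext fun x => Bf_lin ρ hd.continuous (fun x => h0.1 x trivial) hd'.continuous (fun x => h0'.1 x trivial) a x
  funext x
  have hx : ((x.1, |x.2|) : XX m) ∈ halfSpace m := abs_nonneg x.2
  simp only [Gd, LBf]
  rw [e, cw.fd2 _ hx, cu.fd2 _ hx, cv.fd2 _ hx, trX_lin]
  ring

lemma Phi_lin (ρ : 𝓢(EE m, ℝ)) (h1ρ : ∫ z, ρ z = 1) (s0 : 0 < σ) (s1 : σ < 1) {β β' : EE m → ℝ} {g g' : XX m → ℝ} {K K' : ℝ} (hK : 0 ≤ K) (hK' : 0 ≤ K')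
    (hd : Differentiable ℝ β) (h0 : HolderLe σ univ β K) (h1 : HolderLe σ univ (fderiv ℝ β) K) (hg : HolderLe σ (halfSpace m) g K)
    (hd' : Differentiable ℝ β') (h0' : HolderLe σ univ β' K') (h1' : HolderLe σ univ (fderiv ℝ β') K') (hg' : HolderLe σ (halfSpace m) g' K') (a : ℝ) :
    Phi P ρ (fun y => a * β y + β' y) (fun x => a * g x + g' x) = fun x => a * Phi P ρ β g x + Phi P ρ β' g' x := by
  obtain ⟨C, hC, H⟩ := Gd_holder P ρ h1ρ s0 s1
  funext x
  rw [Phi, Phi, Phi, Gd_lin P ρ h1ρ s0 s1 hK hK' hd h0 h1 hd' h0' h1',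
    Sphi_lin P s0 s1 (by positivity) (by positivity) (H β g K K hK hK hd h0 h1 hg) (H β' g' K' K' hK' hK' hd' h0' h1' hg') (Gd_even P ρ β g) (Gd_even P ρ β' g'),
    Bf_lin ρ hd.continuous (fun x => h0.1 x trivial) hd'.continuous (fun x => h0'.1 x trivial)]
  ring

set_option maxHeartbeats 1000000 in
lemma Phi_reg (ρ : 𝓢(EE m, ℝ)) (h1ρ : ∫ z, ρ z = 1) (s0 : 0 < σ) (s1 : σ < 1) :
    ∃ C ≥ (0:ℝ), ∀ (β : EE m → ℝ) (g : XX m → ℝ) (K K' : ℝ), 0 ≤ K → 0 ≤ K' → Differentiable ℝ β → HolderLe σ univ β K → HolderLe σ univ (fderiv ℝ β) K →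
      HolderLe σ (halfSpace m) g K' → ∃ u1 u2, C2h m σ (Phi P ρ β g) u1 u2 (C * (K + K')) ∧ (∀ y, Phi P ρ β g (y, 0) = 0) ∧ (∀ y, u1 (y, 0) (0, 1) = β y) ∧
        HolderLe σ univ (Al P (Phi P ρ β g) g) (C * (K + K')) ∧
        ∀ x : XX m, 0 ≤ x.2 → trX m (u2 x) + P.v x.2 * Phi P ρ β g x = Al P (Phi P ρ β g) g x.1 * P.om x.2 + g x := by
  obtain ⟨C1, hC1, H1⟩ := Gd_holder P ρ h1ρ s0 s1
  obtain ⟨C2, hC2, H2⟩ := S_reg P m s0 s1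
  obtain ⟨C3, hC3, H3⟩ := Bf_reg ρ h1ρ s0 s1
  refine ⟨C3 + C2 * C1, by positivity, fun β g K K' hK hK' hd h0 h1 hg => ?_⟩
  obtain ⟨u1, u2, cu, ua, ub⟩ := H3 β K hK hd h0 h1
  have hG := H1 β g K K' hK hK' hd h0 h1 hg
  obtain ⟨v1, v2, al, cv, va, vb, vc, vd⟩ := H2 _ _ (by positivity) hG (Gd_even P ρ β g)
  have p1 : 0 ≤ C3 * K' := by positivity
  have p2 : 0 ≤ C3 * K := by positivity
  have cw : C2h m σ (Phi P ρ β g) (fun x => u1 x + v1 x) (fun x => u2 x + v2 x) _ := cu.add cv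
  have pde : ∀ x : XX m, 0 ≤ x.2 → trX m (u2 x + v2 x) + P.v x.2 * Phi P ρ β g x = al x.1 * P.om x.2 + g x := by
    intro x hx
    have e1 := vd x hx
    have e2 : Gd P ρ β g x = g x - (trX m (u2 x) + P.v x.2 * Bf ρ β x) := by
      have : ((x.1, |x.2|) : XX m) = x := by rw [abs_of_nonneg hx]
      rw [Gd, this, LBf, cu.fd2 x hx]
    rw [e2] at e1
    rw [map_add, Phi]
    linarith
  have eal : Al P (Phi P ρ β g) g = al := by
    funext y
    have h2 := pde (y, 1) zero_le_one
    rw [Al, cw.lap (x := (y, 1)) one_pos]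
    have h3 : trX m (u2 (y, 1) + v2 (y, 1)) + P.v 1 * Phi P ρ β g (y, 1) = al y * P.om 1 + g (y, 1) := h2
    rw [h3, add_sub_cancel_right, mul_div_cancel_right₀ _ (P.om_pos 1).ne']
  refine ⟨_, _, cw.mono (by linarith), fun y => ?_, fun y => ?_, ?_, ?_⟩
  · rw [Phi, ua, va, add_zero]
  · show u1 (y, 0) (0, 1) + v1 (y, 0) (0, 1) = β y
    rw [ub, vb, add_zero]
  · rw [eal]; exact vc.mono (by linarith)
  · rw [eal]; exact pde

/-- the submodule of admissible data -/
def Dat (m : ℕ) (σ : ℝ) : Submodule ℝ ((EE m → ℝ) × (XX m → ℝ)) where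
  carrier := {p | ∃ K : ℝ, 0 ≤ K ∧ Differentiable ℝ p.1 ∧ HolderLe σ univ p.1 K ∧ HolderLe σ univ (fderiv ℝ p.1) K ∧ HolderLe σ (halfSpace m) p.2 K}
  zero_mem' := by
    have hz : ∀ (X Y : Type) [PseudoMetricSpace X] [NormedAddCommGroup Y] [NormedSpace ℝ Y] (s : Set X), HolderLe σ s (fun _ : X => (0:Y)) 0 := fun X Y _ _ _ s => by
      have := HolderLe.const (σ := σ) (s := s) (0 : Y); rwa [norm_zero] at this
    refine ⟨0, le_rfl, differentiable_const (c := (0:ℝ)), hz _ _ _, ?_, hz _ _ _⟩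
    have : fderiv ℝ ((0 : (EE m → ℝ) × (XX m → ℝ)).1) = fun _ => 0 := fderiv_const (0:ℝ)
    rw [this]; exact hz _ _ _
  add_mem' := by
    rintro ⟨β, g⟩ ⟨β', g'⟩ ⟨K, hK, hd, h0, h1, hg⟩ ⟨K', hK', hd', h0', h1', hg'⟩
    refine ⟨K + K', by positivity, hd.add hd', h0.add h0', ?_, hg.add hg'⟩
    exact (h1.add h1').congr fun x _ => fderiv_add (hd x) (hd' x)
  smul_mem' := by
    rintro a ⟨β, g⟩ ⟨K, hK, hd, h0, h1, hg⟩
    have key : ∀ {X Y : Type} [PseudoMetricSpace X] [NormedAddCommGroup Y] [NormedSpace ℝ Y] {s : Set X} {h : X → Y}, HolderLe σ s h K → HolderLe σ s (fun x => a • h x) (|a| * K) := by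
      intro X Y _ _ _ s h H
      refine ⟨fun x hx => ?_, fun x hx y hy => ?_⟩
      · rw [norm_smul]; exact mul_le_mul_of_nonneg_left (H.1 x hx) (abs_nonneg a)
      · rw [← smul_sub, norm_smul, mul_assoc]; exact mul_le_mul_of_nonneg_left (H.2 x hx y hy) (abs_nonneg a)
    refine ⟨|a| * K, by positivity, hd.const_smul a, key h0, ?_, key hg⟩
    exact (key h1).congr fun x _ => fderiv_const_smul (hd x) a

noncomputable def Tf (ρ : 𝓢(EE m, ℝ)) (p : (EE m → ℝ) × (XX m → ℝ)) : (XX m → ℝ) × (EE m → ℝ) :=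
  (Phi P ρ p.1 p.2, Al P (Phi P ρ p.1 p.2) p.2)

lemma Tf_lin (ρ : 𝓢(EE m, ℝ)) (h1ρ : ∫ z, ρ z = 1) (s0 : 0 < σ) (s1 : σ < 1) (a : ℝ) (p p' : Dat m σ) :
    Tf P ρ (a • p + p' : Dat m σ) = a • Tf P ρ p + Tf P ρ p' := by
  obtain ⟨⟨β, g⟩, K, hK, hd, h0, h1, hg⟩ := p
  obtain ⟨⟨β', g'⟩, K', hK', hd', h0', h1', hg'⟩ := p'
  obtain ⟨C, hC, H⟩ := Phi_reg P ρ h1ρ s0 s1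
  obtain ⟨u1, u2, cu, -⟩ := H β g K K hK hK hd h0 h1 hg
  obtain ⟨v1, v2, cv, -⟩ := H β' g' K' K' hK' hK' hd' h0' h1' hg'
  have e := Phi_lin P ρ h1ρ s0 s1 hK hK' hd h0 h1 hg hd' h0' h1' hg' a
  have e2 : Al P (Phi P ρ (fun y => a * β y + β' y) (fun x => a * g x + g' x)) (fun x => a * g x + g' x) = fun y => a * Al P (Phi P ρ β g) g y + Al P (Phi P ρ β' g') g' y := by
    funext y
    rw [e]
    simp only [Al]
    rw [(cu.lin a cv).lap (x := (y, 1)) one_pos, cu.lap (x := (y, 1)) one_pos, cv.lap (x := (y, 1)) one_pos, trX_lin]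
    ring
  exact Prod.ext e e2

lemma lin_ext {V W : Type*} [AddCommGroup V] [Module ℝ V] [AddCommGroup W] [Module ℝ W] (D : Submodule ℝ V) (F : V → W)
    (h : ∀ (a : ℝ) (p p' : D), F (a • p + p' : D) = a • F p + F p') : ∃ T : V →ₗ[ℝ] W, ∀ p ∈ D, T p = F p := by
  have h0 : F (0 : D) = 0 := by
    have := h 1 0 0
    rw [one_smul, one_smul, add_zero] at this
    simpa using this
  let T0 : D →ₗ[ℝ] W := ⟨⟨fun p => F p, fun p p' => by have := h 1 p p'; rwa [one_smul, one_smul] at this⟩,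
    fun a p => by have := h a p 0; rwa [h0, add_zero, add_zero] at this⟩
  obtain ⟨T, hT⟩ := T0.exists_extend
  exact ⟨T, fun p hp => LinearMap.congr_fun hT ⟨p, hp⟩⟩
end Assembly

/-- Linear solvability theory for the Dirichlet-to-Neumann problem in a
half-space: there is a linear solution operator `(β, g) ↦ (φ, α)` for
`Δφ + f'(w(t))φ = α(y) w'(t) + g`, `φ(y,0) = 0`, `∂_t φ(y,0) = β(y)`, with the uniform
estimate `‖φ‖_{C^{2,σ}} + ‖α‖_{C^{0,σ}} ≤ C(‖β‖_{C^{1,σ}} + ‖g‖_{C^{0,σ}})`. -/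
theorem half_space_linear_theory (m : ℕ) (hm : 1 ≤ m) (σ : ℝ)
    (hσ : σ ∈ Set.Ioo (0 : ℝ) 1) (f w : ℝ → ℝ) (hf : Monostable f)
    (hw : IsHeteroclinic f w) :
    ∃ C > (0 : ℝ),
      ∃ T : ((EuclideanSpace ℝ (Fin m) → ℝ) × (EuclideanSpace ℝ (Fin m) × ℝ → ℝ)) →
            ((EuclideanSpace ℝ (Fin m) × ℝ → ℝ) × (EuclideanSpace ℝ (Fin m) → ℝ)),
        IsLinearMap ℝ T ∧
        ∀ (β : EuclideanSpace ℝ (Fin m) → ℝ) (g : EuclideanSpace ℝ (Fin m) × ℝ → ℝ)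
          (Kβ Kg : ℝ), 0 ≤ Kβ → 0 ≤ Kg →
          Differentiable ℝ β → HolderLe σ Set.univ β Kβ →
          HolderLe σ Set.univ (fderiv ℝ β) Kβ →
          HolderLe σ (halfSpace m) g Kg →
          ContDiffOn ℝ 2 (T (β, g)).1 (halfSpace m) ∧
          (∀ (y : EuclideanSpace ℝ (Fin m)) (t : ℝ), 0 < t →
            lapP (T (β, g)).1 (y, t) + deriv f (w t) * (T (β, g)).1 (y, t)
              = (T (β, g)).2 y * derivWithin w (Set.Ici 0) t + g (y, t)) ∧
          (∀ y : EuclideanSpace ℝ (Fin m), (T (β, g)).1 (y, 0) = 0) ∧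
          (∀ y : EuclideanSpace ℝ (Fin m),
            derivWithin (fun s : ℝ => (T (β, g)).1 (y, s)) (Set.Ici 0) 0 = β y) ∧
          HolderLe σ (halfSpace m) (T (β, g)).1 (C * (Kβ + Kg)) ∧
          HolderLe σ (halfSpace m)
            (iteratedFDerivWithin ℝ 2 (T (β, g)).1 (halfSpace m)) (C * (Kβ + Kg)) ∧
          HolderLe σ Set.univ (T (β, g)).2 (C * (Kβ + Kg)) := by
  obtain ⟨s0, s1⟩ := hσ
  obtain ⟨P, hP⟩ := prof_exists hf hw
  obtain ⟨ρ, h1ρ⟩ := rho_ex m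
  obtain ⟨C, hC, H⟩ := Phi_reg P ρ h1ρ s0 s1
  obtain ⟨T, hT⟩ := lin_ext (Dat m σ) (Tf P ρ) (Tf_lin P ρ h1ρ s0 s1)
  refine ⟨C + 1, by positivity, T, T.isLinear, fun β g K K' hK hK' hd h0 h1 hg => ?_⟩
  have hmem : ((β, g) : (EE m → ℝ) × (XX m → ℝ)) ∈ Dat m σ :=
    ⟨K + K', by positivity, hd, h0.mono (by linarith), h1.mono (by linarith), hg.mono (by linarith)⟩
  rw [hT _ hmem]
  obtain ⟨u1, u2, cu, e0, e1, ha, pde⟩ := H β g K K' hK hK' hd h0 h1 hg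
  have hle : C * (K + K') ≤ (C + 1) * (K + K') := mul_le_mul_of_nonneg_right (by linarith) (by positivity)
  have cu' := cu.mono hle
  refine ⟨cu'.contDiffOn s0, fun y t ht => ?_, e0, fun y => ?_, cu'.h0, cu'.holder_iter (by positivity), ha.mono hle⟩
  · have h2 := pde (y, t) ht.le
    rw [← cu.lap (x := (y, t)) ht] at h2
    rw [← (hP t ht.le).1, ← (hP t ht.le).2]
    exact h2
  · rw [← e1 y]; exact cu.deriv0 y
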